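/- arXiv:math/0404112 — 2 statements merged into one kernel-verified Lean document; each statement's English description precedes it below -/
import Mathlib

section
/- For every λ > 0 and every δ > 0 there is a constant C = C(𝔻₀, λ, δ) > 0 such that for all integers Q ≥ 2 one has |R^{(2)}_{𝔻₀,Q}(λ) − 2πλ/3| ≤ C · Q^{−1/10+δ}. In particular R^{(2)}_{𝔻₀,Q}(λ) → 2πλ/3 as Q → ∞. -/
open MeasureTheory Real

/-- The point of `ℝ²` (as `EuclideanSpace ℝ (Fin 2)`) associated to a pair of reals. -/
noncomputable def toPt (x y : ℝ) : EuclideanSpace ℝ (Fin 2) :=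
  (WithLp.equiv 2 (Fin 2 → ℝ)).symm ![x, y]

/-- The (undirected) angle `∠ P P_{(x,y)} P'` at the vertex `(x,y)` between the lattice
points `P` and `P'`. -/
noncomputable def angleAt (x y : ℝ) (P P' : ℤ × ℤ) : ℝ :=
  EuclideanGeometry.angle (toPt P.1 P.2) (toPt x y) (toPt P'.1 P'.2)

/-- `Box Q = ℤ² ∩ [-Q,Q]²`. -/
def Box (Q : ℕ) : Set (ℤ × ℤ) := {p | |p.1| ≤ (Q : ℤ) ∧ |p.2| ≤ (Q : ℤ)}

/-- The pair correlation repartition `R^{(2)}_{(x,y),Q}(λ)`. -/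
noncomputable def R2pt (x y : ℝ) (Q : ℕ) (lam : ℝ) : ℝ :=
  (({pp : (ℤ × ℤ) × (ℤ × ℤ) | pp.1 ∈ Box Q ∧ pp.2 ∈ Box Q ∧ pp.1 ≠ pp.2 ∧
      ((2 * (Q : ℝ) + 1) ^ 2 / (2 * π)) * |angleAt x y pp.1 pp.2| ≤ lam}).ncard : ℝ)
    / (2 * (Q : ℝ) + 1) ^ 2

/-- The closed disc of center `(x₀,y₀)` and radius `r₀` in the Euclidean plane. -/
def Disc (x0 y0 r0 : ℝ) : Set (ℝ × ℝ) :=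
  {p | (p.1 - x0) ^ 2 + (p.2 - y0) ^ 2 ≤ r0 ^ 2}

/-- The average `R^{(2)}_{𝔻₀,Q}(λ)` of the pair correlation repartition over the disc. -/
noncomputable def R2avg (x0 y0 r0 : ℝ) (Q : ℕ) (lam : ℝ) : ℝ :=
  (1 / (π * r0 ^ 2)) * ∫ p in Disc x0 y0 r0, R2pt p.1 p.2 Q lam

/-- The number of integers in `[lo, hi]`, for `lo ≤ hi`. -/
noncomputable def intCount (lo hi : ℝ) : ℝ := (⌊hi⌋ : ℝ) - ⌈lo⌉ + 1

lemma intCount_eq_card {lo hi : ℝ} (h : lo ≤ hi) :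
    intCount lo hi = ((Finset.Icc ⌈lo⌉ ⌊hi⌋).card : ℝ) := by
  have h1 : ⌈lo⌉ ≤ ⌊hi⌋ + 1 := by
    have : (⌈lo⌉ : ℝ) < ⌊hi⌋ + 2 := by
      linarith [Int.ceil_lt_add_one lo, Int.lt_floor_add_one hi]
    have : ⌈lo⌉ < ⌊hi⌋ + 2 := by exact_mod_cast this
    omega
  rw [Int.card_Icc, intCount]
  have h2 : (((⌊hi⌋ + 1 - ⌈lo⌉).toNat : ℤ) : ℝ) = ((⌊hi⌋ + 1 - ⌈lo⌉ : ℤ) : ℝ) := by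
    rw [Int.toNat_of_nonneg (by omega)]
  rw [← Int.cast_natCast, h2]
  push_cast
  ring

lemma intCount_nonneg {lo hi : ℝ} (h : lo ≤ hi) : 0 ≤ intCount lo hi := by
  rw [intCount_eq_card h]; positivity

lemma intCount_le (lo hi : ℝ) : intCount lo hi ≤ hi - lo + 1 := by
  unfold intCount
  linarith [Int.floor_le hi, Int.le_ceil lo]

lemma le_intCount (lo hi : ℝ) : hi - lo - 1 ≤ intCount lo hi := by
  unfold intCount
  linarith [Int.lt_floor_add_one hi, Int.ceil_lt_add_one lo]

/-- Over a full period of a rational rotation, slightly perturbed, the lattice count is exact up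
to a bounded error. -/
lemma abs_sum_intCount_period_sub_le (p : ℤ) (q : ℕ) (hq : 0 < q) (hpq : IsCoprime p (q : ℤ))
    (η : ℕ → ℝ) (hη : ∀ k < q, |η k| ≤ 1 / q) (α β c : ℝ) (hαβ : α ≤ β) :
    |∑ k ∈ Finset.range q, intCount (α + (c + p * k / q + η k)) (β + (c + p * k / q + η k))
      - q * (β - α)| ≤ 3 := by
  have hq' : (0 : ℝ) < q := by exact_mod_cast hq
  set t : ℕ → ℝ := fun k => c + p * k / q + η k with ht
  have key : ∀ k < q, ∀ X : ℤ, |((q * X - p * k : ℤ) : ℝ) - q * c - q * (X - t k)| ≤ 1 := by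
    intro k hk X
    have : ((q * X - p * k : ℤ) : ℝ) - q * c - q * (X - t k) = q * η k := by
      simp only [ht]; push_cast; field_simp; ring
    rw [this, abs_mul, abs_of_pos hq']
    have := mul_le_mul_of_nonneg_left (hη k hk) hq'.le
    rwa [mul_one_div_cancel hq'.ne'] at this
  set A : Finset (Σ _ : ℕ, ℤ) :=
    (Finset.range q).sigma (fun k => Finset.Icc ⌈α + t k⌉ ⌊β + t k⌋) with hA
  have hsum : ∑ k ∈ Finset.range q, intCount (α + t k) (β + t k) = (A.card : ℝ) := by
    rw [hA, Finset.card_sigma]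
    push_cast
    exact Finset.sum_congr rfl fun k _ => intCount_eq_card (by linarith)
  have hmem : ∀ k : ℕ, ∀ X : ℤ, (⟨k, X⟩ : Σ _ : ℕ, ℤ) ∈ A ↔
      k < q ∧ α ≤ X - t k ∧ X - t k ≤ β := by
    intro k X
    simp only [hA, Finset.mem_sigma, Finset.mem_range, Finset.mem_Icc, Int.ceil_le, Int.le_floor]
    constructor <;> rintro ⟨h1, h2, h3⟩ <;> exact ⟨h1, by linarith, by linarith⟩
  let φ : (Σ _ : ℕ, ℤ) → ℤ := fun s => q * s.2 - p * s.1
  have hφ : Set.InjOn φ A := by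
    rintro ⟨k, X⟩ h1 ⟨k', X'⟩ h2 h
    have hk := ((hmem k X).1 h1).1
    have hk' := ((hmem k' X').1 h2).1
    simp only [φ] at h
    have hd : (q : ℤ) ∣ p * ((k : ℤ) - k') := ⟨X - X', by linarith⟩
    have hd' : (q : ℤ) ∣ (k : ℤ) - k' := hpq.symm.dvd_of_dvd_mul_left hd
    have hkk : (k : ℤ) - k' = 0 := by
      apply Int.eq_zero_of_abs_lt_dvd hd'
      rw [abs_lt]; constructor <;> omega
    have hkk' : k = k' := by omega
    subst hkk'
    have : (q : ℤ) * X = q * X' := by linarith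
    have := mul_left_cancel₀ (by exact_mod_cast hq.ne') this
    subst this; rfl
  have hcard : (A.image φ).card = A.card := Finset.card_image_of_injOn hφ
  have hup : A.image φ ⊆ Finset.Icc ⌈q * (α + c) - 1⌉ ⌊q * (β + c) + 1⌋ := by
    intro m hm
    obtain ⟨⟨k, X⟩, h1, rfl⟩ := Finset.mem_image.1 hm
    obtain ⟨hk, h2, h3⟩ := (hmem k X).1 h1
    have h4 := abs_le.1 (key k hk X)
    have h5 := mul_le_mul_of_nonneg_left h2 hq'.le
    have h6 := mul_le_mul_of_nonneg_left h3 hq'.le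
    rw [Finset.mem_Icc, Int.ceil_le, Int.le_floor]
    simp only [φ]
    constructor <;> linarith [h4.1, h4.2]
  have hlo : Finset.Icc ⌈q * (α + c) + 1⌉ ⌊q * (β + c) - 1⌋ ⊆ A.image φ := by
    intro m hm
    rw [Finset.mem_Icc, Int.ceil_le, Int.le_floor] at hm
    obtain ⟨x, z, hxz⟩ := hpq
    set k' : ℤ := (-(x * m)) % q with hk'
    have hk0 : 0 ≤ k' := Int.emod_nonneg _ (by exact_mod_cast hq.ne')
    have hkq : k' < q := Int.emod_lt_of_pos _ (by exact_mod_cast hq)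
    have hdv : (q : ℤ) ∣ m + p * k' := by
      have h1 : -(x * m) = q * ((-(x * m)) / q) + k' := (Int.mul_ediv_add_emod _ _).symm
      refine ⟨z * m - p * ((-(x * m)) / q), ?_⟩
      have : k' = -(x * m) - q * ((-(x * m)) / q) := by linarith
      rw [this]
      linear_combination (-m) * hxz
    obtain ⟨X, hX⟩ := hdv
    have hkn : ((k'.toNat : ℕ) : ℤ) = k' := Int.toNat_of_nonneg hk0
    have hkq' : k'.toNat < q := by omega
    have hφm : φ ⟨k'.toNat, X⟩ = m := by simp only [φ, hkn]; linarith
    refine Finset.mem_image.2 ⟨⟨k'.toNat, X⟩, (hmem _ _).2 ⟨hkq', ?_⟩, hφm⟩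
    have h4 := abs_le.1 (key _ hkq' X)
    have h7 : ((q * X - p * (k'.toNat : ℕ) : ℤ) : ℝ) = m := by
      exact_mod_cast hφm
    rw [h7] at h4
    constructor
    · refine le_of_mul_le_mul_left ?_ hq'
      linarith [h4.1, h4.2]
    · refine le_of_mul_le_mul_left ?_ hq'
      linarith [h4.1, h4.2]
  have hU : (A.card : ℝ) ≤ intCount (q * (α + c) - 1) (q * (β + c) + 1) := by
    rw [intCount_eq_card (by nlinarith), ← hcard]
    exact_mod_cast Finset.card_le_card hup
  have hL : intCount (q * (α + c) + 1) (q * (β + c) - 1) ≤ A.card := by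
    by_cases h : q * (α + c) + 1 ≤ q * (β + c) - 1
    · rw [intCount_eq_card h, ← hcard]
      exact_mod_cast Finset.card_le_card hlo
    · have h0 : (Finset.Icc ⌈q * (α + c) + 1⌉ ⌊q * (β + c) - 1⌋).card ≤ A.card := by
        rw [← hcard]; exact Finset.card_le_card hlo
      rw [Int.card_Icc] at h0
      unfold intCount
      have : ⌊q * (β + c) - 1⌋ + 1 - ⌈q * (α + c) + 1⌉ ≤ (A.card : ℤ) := by omega
      have : ((⌊q * (β + c) - 1⌋ + 1 - ⌈q * (α + c) + 1⌉ : ℤ) : ℝ) ≤ ((A.card : ℤ) : ℝ) := by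
        exact_mod_cast this
      push_cast at this
      linarith
  rw [hsum, abs_le]
  have h1 := intCount_le (q * (α + c) - 1) (q * (β + c) + 1)
  have h2 := le_intCount (q * (α + c) + 1) (q * (β + c) - 1)
  constructor <;> nlinarith

/-- A nonnegative sequence whose sums over blocks of length `q` are all close to `q * L` has
all its sums over intervals close to their expected value. -/
lemma abs_sum_range_sub_le_of_block (f : ℕ → ℝ) (hf : ∀ k, 0 ≤ f k) (q : ℕ) (hq : 0 < q)
    (L : ℝ) (hL : 0 ≤ L)
    (h : ∀ a, |∑ k ∈ Finset.range q, f (a + k) - q * L| ≤ 3) (a n : ℕ) :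
    |∑ k ∈ Finset.range n, f (a + k) - n * L| ≤ 3 * (n / q : ℝ) + q * L + 3 := by
  have hq' : (0 : ℝ) < q := by exact_mod_cast hq
  have hblock : ∀ j : ℕ, |∑ k ∈ Finset.range (q * j), f (a + k) - (q * j : ℕ) * L| ≤ 3 * j := by
    intro j
    induction j with
    | zero => simp
    | succ j ih =>
      rw [Nat.mul_succ, Finset.sum_range_add]
      have h1 := h (a + q * j)
      simp only [← add_assoc] at *
      rw [abs_le] at *
      push_cast at *
      constructor <;> linarith [h1.1, h1.2, ih.1, ih.2]
  have hn : n = q * (n / q) + n % q := (Nat.div_add_mod n q).symm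
  set j := n / q with hj
  set m := n % q with hm
  have hmq : m < q := Nat.mod_lt _ hq
  have hjn : (j : ℝ) ≤ n / q := Nat.cast_div_le
  have hsum : ∑ k ∈ Finset.range n, f (a + k) = ∑ k ∈ Finset.range (q * j), f (a + k)
      + ∑ k ∈ Finset.range m, f (a + q * j + k) := by
    rw [hn, Finset.sum_range_add]
    simp only [add_assoc]
  have htail0 : 0 ≤ ∑ k ∈ Finset.range m, f (a + q * j + k) := Finset.sum_nonneg fun _ _ => hf _
  have htail1 : ∑ k ∈ Finset.range m, f (a + q * j + k) ≤
      ∑ k ∈ Finset.range q, f (a + q * j + k) :=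
    Finset.sum_le_sum_of_subset_of_nonneg (Finset.range_mono hmq.le) fun _ _ _ => hf _
  have h1 := abs_le.1 (h (a + q * j))
  have h2 := abs_le.1 (hblock j)
  have hmL : (m : ℝ) * L ≤ q * L := by
    apply mul_le_mul_of_nonneg_right _ hL
    exact_mod_cast hmq.le
  have hmL0 : 0 ≤ (m : ℝ) * L := by positivity
  have hnr : (n : ℝ) = (q * j : ℕ) + m := by exact_mod_cast hn
  rw [hsum, hnr, abs_le]
  rw [hnr] at hjn
  constructor <;> linarith [h1.1, h1.2, h2.1, h2.2]

/-- Discrepancy of the rotation by `θ` in terms of a Dirichlet approximation of `θ`. -/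
lemma exists_approx_and_discrepancy (θ : ℝ) (T : ℕ) (hT : 0 < T) :
    ∃ (p : ℤ) (q : ℕ), 0 < q ∧ q ≤ T ∧ |θ - p / q| ≤ 1 / ((T + 1) * q) ∧
      ∀ (α β c : ℝ), α ≤ β → ∀ a n : ℕ,
        |∑ k ∈ Finset.range n, intCount (α + (c + θ * (a + k : ℕ))) (β + (c + θ * (a + k : ℕ)))
          - n * (β - α)| ≤ 3 * (n / q : ℝ) + q * (β - α) + 3 := by
  obtain ⟨ξ, h1, h2⟩ := Real.exists_rat_abs_sub_le_and_den_le θ hT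
  have hq : 0 < ξ.den := ξ.den_pos
  have hq' : (0 : ℝ) < ξ.den := by exact_mod_cast hq
  have hξ : ((ξ : ℚ) : ℝ) = (ξ.num : ℝ) / ξ.den := by exact_mod_cast (Rat.num_div_den ξ).symm
  rw [hξ] at h1
  refine ⟨ξ.num, ξ.den, hq, h2, h1, fun α β c hαβ a n => ?_⟩
  refine abs_sum_range_sub_le_of_block
    (fun k => intCount (α + (c + θ * k)) (β + (c + θ * k)))
    (fun k => intCount_nonneg (by linarith)) ξ.den hq (β - α) (by linarith) (fun a => ?_) a n
  have hcop : IsCoprime ξ.num (ξ.den : ℤ) := by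
    rw [Int.isCoprime_iff_gcd_eq_one]; exact ξ.reduced
  have := abs_sum_intCount_period_sub_le ξ.num ξ.den hq hcop
    (fun k => (θ - ξ.num / ξ.den) * k) ?_ α β (c + θ * a) hαβ
  · convert this using 5 with k
    all_goals push_cast; ring_nf
  · intro k hk
    have hk' : (k : ℝ) ≤ ξ.den := by exact_mod_cast hk.le
    have hTd : (ξ.den : ℝ) ≤ T + 1 := by
      have : (ξ.den : ℝ) ≤ T := by exact_mod_cast h2
      linarith
    rw [abs_mul, Nat.abs_cast]
    calc |θ - ξ.num / ξ.den| * k ≤ 1 / ((T + 1) * ξ.den) * ξ.den := by gcongr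
      _ = 1 / (T + 1) := by field_simp
      _ ≤ 1 / ξ.den := one_div_le_one_div_of_le hq' hTd

lemma sum_inv_le_two_sqrt (T : ℕ) : ∑ q ∈ Finset.Icc 1 T, (1 / q : ℝ) ≤ 2 * √T := by
  induction T with
  | zero => simp
  | succ n ih =>
    rw [Finset.sum_Icc_succ_top (by omega)]
    have h0 : (0 : ℝ) ≤ n := Nat.cast_nonneg n
    have h1 : √(n : ℝ) ^ 2 = n := Real.sq_sqrt h0
    have h2 : √((n + 1 : ℕ) : ℝ) ^ 2 = n + 1 := by
      rw [Real.sq_sqrt (by positivity)]; push_cast; ring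
    set s := √(n : ℝ)
    set t := √((n + 1 : ℕ) : ℝ) with ht
    have hs : 0 ≤ s := Real.sqrt_nonneg _
    have htp : 0 < t := by rw [ht]; positivity
    have hst : s ≤ t := Real.sqrt_le_sqrt (by push_cast; linarith)
    have h3 : 1 / ((n + 1 : ℕ) : ℝ) ≤ 2 * (t - s) := by
      have : ((n + 1 : ℕ) : ℝ) = t ^ 2 := by rw [h2]; push_cast; ring
      rw [this, div_le_iff₀ (by positivity)]
      have h4 : (t - s) * (t + s) = 1 := by nlinarith
      have h5 : 1 ≤ t := by nlinarith
      nlinarith [mul_nonneg (sub_nonneg.2 hst) (sub_nonneg.2 h5),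
        mul_nonneg (sub_nonneg.2 hst) htp.le]
    linarith

/-- Few fractions with denominator `d` have a Dirichlet approximation of small denominator. -/
lemma sum_inv_approx_den_le (d T : ℕ) (hd : 0 < d) (hT : 0 < T) (p : ℤ → ℤ) (q : ℤ → ℕ)
    (hq : ∀ a, 0 < q a) (hqT : ∀ a, q a ≤ T)
    (h : ∀ a : ℤ, |(a / d : ℝ) - p a / q a| ≤ 1 / ((T + 1) * q a)) :
    ∑ a ∈ Finset.Ioc (-(d : ℤ)) d, (1 / q a : ℝ) ≤ 12 * (d / √T) + 3 * T := by
  have hd' : (0 : ℝ) < d := by exact_mod_cast hd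
  have hT' : (0 : ℝ) < T := by exact_mod_cast hT
  have hfib : ∀ b ∈ Finset.Icc 1 T,
      (((Finset.Ioc (-(d : ℤ)) d).filter (fun a => q a = b)).card : ℝ) ≤ 6 * (d / T) + 3 * b := by
    intro b hb
    have hb1 : 1 ≤ b := (Finset.mem_Icc.1 hb).1
    have hb' : (0 : ℝ) < b := by exact_mod_cast hb1
    have hsub : (Finset.Ioc (-(d : ℤ)) d).filter (fun a => q a = b) ⊆
        (Finset.Icc (-(b : ℤ)) b).biUnion (fun r =>
          Finset.Icc ⌈(d * r / b - d / (T * b) : ℝ)⌉ ⌊(d * r / b + d / (T * b) : ℝ)⌋) := by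
      intro a ha
      rw [Finset.mem_filter, Finset.mem_Ioc] at ha
      obtain ⟨⟨ha1, ha2⟩, rfl⟩ := ha
      have h1 := h a
      have hTq : (1 : ℝ) / ((T + 1) * q a) ≤ 1 / (T * q a) := by
        apply one_div_le_one_div_of_le (by positivity)
        nlinarith
      have e1 : (a / d : ℝ) - p a / q a = (a - d * p a / q a) / d := by field_simp
      have h2 : |(a : ℝ) - d * p a / q a| ≤ d / (T * q a) := by
        have := h1.trans hTq
        rw [e1, abs_div, abs_of_pos hd', div_le_iff₀ hd'] at this
        calc _ ≤ _ := this
          _ = _ := by ring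
      have haR : |(a / d : ℝ)| ≤ 1 := by
        rw [abs_div, abs_of_pos hd', div_le_one hd']
        have : |a| ≤ d := abs_le.2 ⟨by omega, ha2⟩
        exact_mod_cast this
      have hpa : |p a| ≤ q a := by
        have h3 : |(p a / q a : ℝ)| < 1 + 1 / q a := by
          have h4 : (1 : ℝ) / ((T + 1) * q a) < 1 / q a := by
            apply one_div_lt_one_div_of_lt hb'
            nlinarith
          have h5 := abs_sub_abs_le_abs_sub (p a / q a : ℝ) (a / d)
          rw [abs_sub_comm (p a / q a : ℝ)] at h5
          linarith
        rw [abs_div, Nat.abs_cast, div_lt_iff₀ hb', add_mul, one_div_mul_cancel hb'.ne'] at h3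
        have : |p a| < q a + 1 := by
          have : ((|p a| : ℤ) : ℝ) < ((q a + 1 : ℤ) : ℝ) := by push_cast; linarith
          exact_mod_cast this
        omega
      rw [Finset.mem_biUnion]
      refine ⟨p a, Finset.mem_Icc.2 (abs_le.1 hpa : -(q a : ℤ) ≤ p a ∧ p a ≤ q a), ?_⟩
      rw [Finset.mem_Icc, Int.ceil_le, Int.le_floor]
      rw [abs_le] at h2
      constructor <;> linarith [h2.1, h2.2]
    have h1 : (((Finset.Ioc (-(d : ℤ)) d).filter (fun a => q a = b)).card : ℝ) ≤
        ∑ r ∈ Finset.Icc (-(b : ℤ)) b, (2 * d / (T * b) + 1 : ℝ) := by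
      refine le_trans (Nat.cast_le.2 ((Finset.card_le_card hsub).trans Finset.card_biUnion_le)) ?_
      push_cast
      refine Finset.sum_le_sum fun r _ => ?_
      have hpos : (0 : ℝ) ≤ d / (T * b) := by positivity
      rw [← intCount_eq_card (by linarith)]
      refine (intCount_le _ _).trans (le_of_eq ?_)
      ring
    refine h1.trans ?_
    rw [Finset.sum_const, Int.card_Icc, nsmul_eq_mul]
    have hc : (((b : ℤ) + 1 - -(b : ℤ)).toNat : ℝ) ≤ 3 * b := by
      have : ((b : ℤ) + 1 - -(b : ℤ)).toNat ≤ 3 * b := by omega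
      exact_mod_cast this
    calc _ ≤ 3 * b * (2 * d / (T * b) + 1 : ℝ) := by gcongr
      _ = _ := by field_simp; ring
  have hmap : ∀ a ∈ Finset.Ioc (-(d : ℤ)) d, q a ∈ Finset.Icc 1 T := fun a _ =>
    Finset.mem_Icc.2 ⟨hq a, hqT a⟩
  rw [← Finset.sum_fiberwise_of_maps_to hmap]
  calc ∑ b ∈ Finset.Icc 1 T, ∑ a ∈ Finset.Ioc (-(d : ℤ)) d with q a = b, (1 / q a : ℝ)
      ≤ ∑ b ∈ Finset.Icc 1 T, (6 * (d / T) * (1 / b) + 3 : ℝ) := by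
        refine Finset.sum_le_sum fun b hb => ?_
        have hb' : (0 : ℝ) < b := by exact_mod_cast (Finset.mem_Icc.1 hb).1
        have : ∑ a ∈ Finset.Ioc (-(d : ℤ)) d with q a = b, (1 / q a : ℝ) =
            (((Finset.Ioc (-(d : ℤ)) d).filter (fun a => q a = b)).card : ℝ) * (1 / b) := by
          rw [← nsmul_eq_mul, ← Finset.sum_const]
          refine Finset.sum_congr rfl fun a ha => ?_
          rw [(Finset.mem_filter.1 ha).2]
        rw [this]
        calc _ ≤ (6 * (d / T) + 3 * b) * (1 / b : ℝ) := by gcongr; exact hfib b hb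
          _ = _ := by field_simp
    _ = 6 * (d / T) * ∑ b ∈ Finset.Icc 1 T, (1 / b : ℝ) + 3 * T := by
        rw [Finset.sum_add_distrib, ← Finset.mul_sum, Finset.sum_const, Nat.card_Icc,
          nsmul_eq_mul, Nat.add_sub_cancel, mul_comm (T : ℝ) 3]
    _ ≤ 6 * (d / T) * (2 * √T) + 3 * T := by
        gcongr; exact sum_inv_le_two_sqrt T
    _ = _ := by
        have : (T : ℝ) = √T * √T := (Real.mul_self_sqrt hT'.le).symm
        have hs : 0 < √(T : ℝ) := Real.sqrt_pos.2 hT'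
        have h9 : (d / T : ℝ) * √T = d / √T := by
          nth_rewrite 1 [this]; field_simp
        linear_combination 12 * h9

lemma monotone_intFloor_comp {f : ℝ → ℝ} (hf : Monotone f) : Monotone fun x => (⌊f x⌋ : ℝ) :=
  fun _ _ h => Int.cast_le.2 (Int.floor_mono (hf h))

lemma monotone_intCeil_comp {f : ℝ → ℝ} (hf : Monotone f) : Monotone fun x => (⌈f x⌉ : ℝ) :=
  fun _ _ h => Int.cast_le.2 (Int.ceil_mono (hf h))

lemma intervalIntegrable_intCount (f g : ℝ → ℝ) (hf : Monotone f) (hg : Monotone g) (a b : ℝ) :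
    IntervalIntegrable (fun x => intCount (f x) (g x)) volume a b := by
  exact ((monotone_intFloor_comp hg).intervalIntegrable.sub
    (monotone_intCeil_comp hf).intervalIntegrable).add intervalIntegrable_const

/-- Counting lattice points near a moving point, or near moving intervals: exchanging the two
integrations. -/
lemma integral_intCount_swap (α β c W : ℝ) :
    ∫ x in α..β, intCount (x + c - W) (x + c + W) =
      ∫ τ in (-W)..W, intCount (α + (c + τ)) (β + (c + τ)) := by
  have hF : ∀ a b : ℝ, IntervalIntegrable (fun x : ℝ => (⌊x⌋ : ℝ)) volume a b := fun a b =>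
    Monotone.intervalIntegrable fun x y h => by exact_mod_cast Int.floor_mono h
  have hC : ∀ a b : ℝ, IntervalIntegrable (fun x : ℝ => (⌈x⌉ : ℝ)) volume a b := fun a b =>
    Monotone.intervalIntegrable fun x y h => by exact_mod_cast Int.ceil_mono h
  have hFC : ∀ a b : ℝ, ∫ x in a..b, (⌈x⌉ : ℝ) = (∫ x in a..b, (⌊x⌋ : ℝ)) + (b - a) := by
    intro a b
    have : ∫ x in a..b, (⌈x⌉ : ℝ) = ∫ x in a..b, ((⌊x⌋ : ℝ) + 1) := by
      apply intervalIntegral.integral_congr_ae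
      have hnull : volume (Set.range ((↑) : ℤ → ℝ)) = 0 :=
        (Set.countable_range _).measure_zero _
      filter_upwards [compl_mem_ae_iff.2 hnull] with x hx _
      have : ⌈x⌉ = ⌊x⌋ + 1 := by
        rw [Int.ceil_eq_iff]
        refine ⟨by push_cast; have := Int.floor_le x; have h2 : (⌊x⌋ : ℝ) ≠ x :=
          fun h => hx ⟨_, h⟩; have := lt_of_le_of_ne this h2; linarith, ?_⟩
        push_cast
        exact (Int.lt_floor_add_one x).le
      rw [this]; push_cast; ring
    rw [this, intervalIntegral.integral_add (hF a b) intervalIntegrable_const]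
    simp
  have hsub : ∀ a b c : ℝ, (∫ x in a..b, (⌊x⌋ : ℝ)) = (∫ x in c..b, (⌊x⌋ : ℝ)) -
      ∫ x in c..a, (⌊x⌋ : ℝ) := fun a b c =>
    (intervalIntegral.integral_interval_sub_left (hF c b) (hF c a)).symm
  have e1 : ∫ x in α..β, intCount (x + c - W) (x + c + W) =
      (∫ x in (α + (c + W))..(β + (c + W)), (⌊x⌋ : ℝ)) -
      (∫ x in (α + (c - W))..(β + (c - W)), (⌈x⌉ : ℝ)) + (β - α) := by
    rw [← intervalIntegral.integral_comp_add_right (fun x => (⌊x⌋ : ℝ)),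
      ← intervalIntegral.integral_comp_add_right (fun x => (⌈x⌉ : ℝ))]
    have h1 : Monotone fun x : ℝ => (⌊x + (c + W)⌋ : ℝ) :=
      monotone_intFloor_comp fun x y h => by simpa using h
    have h2 : Monotone fun x : ℝ => (⌈x + (c - W)⌉ : ℝ) :=
      monotone_intCeil_comp fun x y h => by simpa using h
    rw [← intervalIntegral.integral_sub h1.intervalIntegrable h2.intervalIntegrable]
    have h3 : β - α = ∫ x in α..β, (1 : ℝ) := by simp
    rw [h3]
    rw [← intervalIntegral.integral_add (h1.intervalIntegrable.sub h2.intervalIntegrable)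
      intervalIntegrable_const]
    refine intervalIntegral.integral_congr fun x _ => ?_
    simp only [intCount]
    ring_nf
  have e2 : ∫ τ in (-W)..W, intCount (α + (c + τ)) (β + (c + τ)) =
      (∫ x in (-W + (β + c))..(W + (β + c)), (⌊x⌋ : ℝ)) -
      (∫ x in (-W + (α + c))..(W + (α + c)), (⌈x⌉ : ℝ)) + 2 * W := by
    rw [← intervalIntegral.integral_comp_add_right (fun x => (⌊x⌋ : ℝ)),
      ← intervalIntegral.integral_comp_add_right (fun x => (⌈x⌉ : ℝ))]
    have h1 : Monotone fun x : ℝ => (⌊x + (β + c)⌋ : ℝ) :=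
      monotone_intFloor_comp fun x y h => by simpa using h
    have h2 : Monotone fun x : ℝ => (⌈x + (α + c)⌉ : ℝ) :=
      monotone_intCeil_comp fun x y h => by simpa using h
    rw [← intervalIntegral.integral_sub h1.intervalIntegrable h2.intervalIntegrable]
    have h3 : 2 * W = ∫ x in (-W)..W, (1 : ℝ) := by simp; ring
    rw [h3]
    rw [← intervalIntegral.integral_add (h1.intervalIntegrable.sub h2.intervalIntegrable)
      intervalIntegrable_const]
    refine intervalIntegral.integral_congr fun x _ => ?_
    simp only [intCount]
    ring_nf
  rw [e1, e2, hFC, hFC, hsub (α + (c + W)) _ 0, hsub (α + (c - W)) _ 0,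
    hsub (-W + (β + c)) _ 0, hsub (-W + (α + c)) _ 0]
  ring_nf

lemma abs_sum_integral_intCount_sub_le (α β c θ Wm E : ℝ) (m : ℕ)
    (W : ℕ → ℝ) (hW0 : ∀ j, 0 ≤ W j) (hWmono : Monotone W) (hWm : ∀ j < m, W j ≤ Wm)
    (hWm0 : 0 ≤ Wm) (hE0 : 0 ≤ E)
    (hE : ∀ c, ∀ a n : ℕ, n ≤ m →
      |∑ k ∈ Finset.range n, intCount (α + (c + θ * (a + k : ℕ))) (β + (c + θ * (a + k : ℕ)))
          - n * (β - α)| ≤ E) :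
    |∑ j ∈ Finset.range m, (∫ τ in (-(W j))..(W j),
        intCount (α + (c + θ * j + τ)) (β + (c + θ * j + τ)))
      - (β - α) * ∑ j ∈ Finset.range m, 2 * W j| ≤ 2 * Wm * E := by
  set G : ℕ → ℝ → ℝ := fun j τ =>
    intCount (α + (c + θ * j + τ)) (β + (c + θ * j + τ)) - (β - α) with hG
  have hmonoG : ∀ z : ℝ, ∀ j : ℕ, Monotone fun τ : ℝ => z + (c + θ * j + τ) :=
    fun z j x y h => by simpa using h
  have hGint : ∀ j a b, IntervalIntegrable (G j) volume a b := fun j a b =>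
    (intervalIntegrable_intCount _ _ (hmonoG α j) (hmonoG β j) a b).sub intervalIntegrable_const
  have hGi : ∀ j, IntegrableOn (G j) (Set.Icc (-(W j)) (W j)) := fun j => by
    rw [integrableOn_Icc_iff_integrableOn_Ioc,
      ← intervalIntegrable_iff_integrableOn_Ioc_of_le (by linarith [hW0 j])]
    exact hGint j _ _
  have e1 : ∑ j ∈ Finset.range m, (∫ τ in (-(W j))..(W j),
        intCount (α + (c + θ * j + τ)) (β + (c + θ * j + τ)))
      - (β - α) * ∑ j ∈ Finset.range m, 2 * W j =
      ∫ τ, ∑ j ∈ Finset.range m, (Set.Icc (-(W j)) (W j)).indicator (G j) τ := by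
    rw [integral_finsetSum _ fun j _ => (integrable_indicator_iff measurableSet_Icc).2 (hGi j),
      Finset.mul_sum, ← Finset.sum_sub_distrib]
    refine Finset.sum_congr rfl fun j _ => ?_
    rw [integral_indicator measurableSet_Icc, integral_Icc_eq_integral_Ioc,
      ← intervalIntegral.integral_of_le (by linarith [hW0 j]), hG,
      intervalIntegral.integral_sub
        (intervalIntegrable_intCount _ _ (hmonoG α j) (hmonoG β j) _ _) intervalIntegrable_const]
    simp
    ring
  have hb : ∀ τ, ‖∑ j ∈ Finset.range m, (Set.Icc (-(W j)) (W j)).indicator (G j) τ‖ ≤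
      (Set.Icc (-Wm) Wm).indicator (fun _ => E) τ := by
    intro τ
    by_cases hτ : ∃ j < m, |τ| ≤ W j
    · classical
      have hτm : τ ∈ Set.Icc (-Wm) Wm := by
        obtain ⟨j, hj, h⟩ := hτ
        exact abs_le.1 (h.trans (hWm j hj))
      rw [Set.indicator_of_mem hτm]
      have hτ' : ∃ j, |τ| ≤ W j := hτ.imp fun _ h => h.2
      set j0 := Nat.find hτ' with hj0
      have hj0m : j0 < m := by
        obtain ⟨j, hj, h⟩ := hτ
        exact (Nat.find_min' hτ' h).trans_lt hj
      have hiff : ∀ j, τ ∈ Set.Icc (-(W j)) (W j) ↔ j0 ≤ j := by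
        intro j
        rw [Set.mem_Icc, ← abs_le]
        exact ⟨fun h => Nat.find_min' hτ' h, fun h => (Nat.find_spec hτ').trans (hWmono h)⟩
      have e2 : ∑ j ∈ Finset.range m, (Set.Icc (-(W j)) (W j)).indicator (G j) τ =
          ∑ k ∈ Finset.range (m - j0), G (j0 + k) τ := by
        conv_lhs => rw [show m = j0 + (m - j0) by omega, Finset.sum_range_add]
        rw [Finset.sum_eq_zero, zero_add]
        · refine Finset.sum_congr rfl fun k _ => ?_
          rw [Set.indicator_of_mem ((hiff _).2 (by omega))]
        · intro j hj
          rw [Set.indicator_of_notMem]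
          rw [hiff]
          have := Finset.mem_range.1 hj
          omega
      rw [e2, Real.norm_eq_abs]
      have := hE (c + τ) j0 (m - j0) (by omega)
      convert this using 2
      rw [hG, Finset.sum_sub_distrib]
      simp only [Finset.sum_const, Finset.card_range, nsmul_eq_mul]
      congr 1
      refine Finset.sum_congr rfl fun k _ => ?_
      ring_nf
    · push Not at hτ
      rw [Finset.sum_eq_zero, norm_zero]
      · exact Set.indicator_nonneg (fun _ _ => hE0) τ
      · intro j hj
        rw [Set.indicator_of_notMem]
        rw [Set.mem_Icc, ← abs_le, not_le]
        exact hτ j (Finset.mem_range.1 hj)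
  rw [e1, ← Real.norm_eq_abs]
  refine (norm_integral_le_of_norm_le ?_ (Filter.Eventually.of_forall hb)).trans (le_of_eq ?_)
  · rw [integrable_indicator_iff measurableSet_Icc]
    exact integrableOn_const (by simp)
  · rw [integral_indicator measurableSet_Icc, setIntegral_const]
    rw [Real.volume_real_Icc_of_le (by linarith), smul_eq_mul]
    ring

/-- Half-width of the strip of points `(x, y)` seeing the lattice points at heights `w + j` and
`w + j + d`, differing by `(a, d)`, under a small angle `e`. -/
noncomputable def stripWidth (e w : ℝ) (d : ℕ) (a : ℤ) (j : ℕ) : ℝ :=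
  e * ((w + j) * (w + j + d) * (1 + (a / d : ℝ) ^ 2)) / d

lemma stripWidth_nonneg {e w : ℝ} (he : 0 ≤ e) (hw : 0 ≤ w) (d : ℕ) (a : ℤ) (j : ℕ) :
    0 ≤ stripWidth e w d a j := by
  unfold stripWidth; positivity

lemma stripWidth_monotone {e w : ℝ} (he : 0 ≤ e) (hw : 0 ≤ w) (d : ℕ) (a : ℤ) :
    Monotone (stripWidth e w d a) := by
  intro i j hij
  have : (i : ℝ) ≤ j := by exact_mod_cast hij
  unfold stripWidth
  gcongr

lemma abs_intCast_div_le_one {d : ℕ} {a : ℤ} (h1 : -(d : ℤ) ≤ a) (h2 : a ≤ d) :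
    |(a / d : ℝ)| ≤ 1 := by
  rw [abs_div, Nat.abs_cast]
  apply div_le_one_of_le₀ _ (Nat.cast_nonneg d)
  exact_mod_cast abs_le.2 ⟨h1, h2⟩

lemma stripWidth_le {e w : ℝ} (he : 0 ≤ e) (hw : 0 ≤ w) (hw1 : w ≤ 1) {d n j : ℕ} {a : ℤ}
    (ha1 : -(d : ℤ) ≤ a) (ha2 : a ≤ d) (hj : j < n - d) :
    stripWidth e w d a j ≤ 2 * (e * n ^ 2) / d := by
  have h1 : (a / d : ℝ) ^ 2 ≤ 1 := by
    rw [sq_le_one_iff_abs_le_one]; exact abs_intCast_div_le_one ha1 ha2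
  have hjn : (j : ℝ) + d + 1 ≤ n := by
    have : j + d + 1 ≤ n := by omega
    exact_mod_cast this
  have hd0 : (0 : ℝ) ≤ d := Nat.cast_nonneg d
  have hj0 : (0 : ℝ) ≤ j := Nat.cast_nonneg j
  have h2 : (w + j) * (w + j + d) * (1 + (a / d : ℝ) ^ 2) ≤ n * n * 2 := by
    gcongr <;> linarith
  unfold stripWidth
  calc e * ((w + j) * (w + j + d) * (1 + (a / d : ℝ) ^ 2)) / d ≤ e * (n * n * 2) / d := by gcongr
    _ = 2 * (e * n ^ 2) / d := by ring

lemma sum_Ioc_neg_sq (m : ℕ) :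
    ∑ a ∈ Finset.Ioc (-(m : ℤ)) m, (a : ℝ) ^ 2 = m * (2 * m ^ 2 + 1) / 3 := by
  induction m with
  | zero => simp
  | succ m ih =>
    have : Finset.Ioc (-((m + 1 : ℕ) : ℤ)) (m + 1 : ℕ) =
        insert (-(m : ℤ)) (insert ((m : ℤ) + 1) (Finset.Ioc (-(m : ℤ)) m)) := by
      ext a; simp only [Finset.mem_Ioc, Finset.mem_insert]; push_cast; omega
    rw [this, Finset.sum_insert, Finset.sum_insert, ih]
    · push_cast; ring
    · simp
    · simp only [Finset.mem_insert, Finset.mem_Ioc]; omega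

lemma sum_one_add_sq_div (d : ℕ) (hd : 0 < d) :
    ∑ a ∈ Finset.Ioc (-(d : ℤ)) d, (1 + (a / d : ℝ) ^ 2) =
      (8 / 3 * d + 1 / (3 * d) : ℝ) := by
  have hd' : (0 : ℝ) < d := by exact_mod_cast hd
  have h1 : ∑ a ∈ Finset.Ioc (-(d : ℤ)) d, (a / d : ℝ) ^ 2 = (2 * d ^ 2 + 1) / (3 * d) := by
    simp only [div_pow]
    rw [← Finset.sum_div, sum_Ioc_neg_sq]
    field_simp
  have h2 : (((d : ℤ) - -(d : ℤ)).toNat : ℝ) = 2 * d := by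
    have : ((d : ℤ) - -(d : ℤ)).toNat = 2 * d := by omega
    rw [this]; push_cast; ring
  rw [Finset.sum_add_distrib, h1, Finset.sum_const, Int.card_Ioc, nsmul_eq_mul, h2]
  field_simp
  ring

lemma sum_pairs_eq (w : ℝ) (n : ℕ) :
    ∑ d ∈ Finset.range n, ∑ j ∈ Finset.range (n - (d + 1)), (w + j) * (w + j + (d + 1 : ℕ)) =
      ((n * w + n * (n - 1) / 2) ^ 2
        - (n * w ^ 2 + w * (n * (n - 1)) + n * (n - 1) * (2 * n - 1) / 6)) / 2 := by
  induction n with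
  | zero => simp
  | succ n ih =>
    have h1 : ∑ d ∈ Finset.range n, (w + (n - (d + 1) : ℕ)) = n * w + n * (n - 1) / 2 := by
      have : ∀ m : ℕ, ∑ i ∈ Finset.range m, (w + (i : ℝ)) = m * w + m * (m - 1) / 2 := by
        intro m
        induction m with
        | zero => simp
        | succ m ih => rw [Finset.sum_range_succ, ih]; push_cast; ring
      rw [← this, ← Finset.sum_range_reflect]
      refine Finset.sum_congr rfl fun d hd => ?_
      have := Finset.mem_range.1 hd
      congr 3
      omega
    rw [Finset.sum_range_succ]
    have h2 : ∀ d ∈ Finset.range n,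
        ∑ j ∈ Finset.range (n + 1 - (d + 1)), (w + j) * (w + j + (d + 1 : ℕ)) =
        ∑ j ∈ Finset.range (n - (d + 1)), (w + j) * (w + j + (d + 1 : ℕ)) +
          (w + (n - (d + 1) : ℕ)) * (w + n) := by
      intro d hd
      have hd' := Finset.mem_range.1 hd
      rw [show n + 1 - (d + 1) = n - (d + 1) + 1 by omega, Finset.sum_range_succ]
      congr 2
      rw [Nat.cast_sub (by omega)]
      ring
    rw [Finset.sum_congr rfl h2, Finset.sum_add_distrib, ih, ← Finset.sum_mul, h1]
    simp
    ring

lemma abs_sum_pairs_sub_le (w : ℝ) (hw : 0 ≤ w) (hw1 : w ≤ 1) (n : ℕ) :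
    |∑ d ∈ Finset.range n, ∑ j ∈ Finset.range (n - (d + 1)),
      (w + j) * (w + j + (d + 1 : ℕ)) - (n : ℝ) ^ 4 / 8| ≤ (n : ℝ) ^ 3 := by
  rw [sum_pairs_eq]
  rcases Nat.eq_zero_or_pos n with rfl | hn
  · simp
  have hn' : (1 : ℝ) ≤ n := by exact_mod_cast hn
  set x : ℝ := (n : ℝ)
  have e : ((x * w + x * (x - 1) / 2) ^ 2
        - (x * w ^ 2 + w * (x * (x - 1)) + x * (x - 1) * (2 * x - 1) / 6)) / 2 - x ^ 4 / 8 =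
      x ^ 3 * (w - 1 / 2) / 2 - x ^ 3 / 6 + x ^ 2 * ((w - 1 / 2) ^ 2 / 2 - w / 2 + 1 / 4)
        - x * (w ^ 2 / 2 - w / 2 + 1 / 12) := by ring
  have h2 : 0 ≤ x ^ 3 - x ^ 2 := by nlinarith [sq_nonneg x]
  have h3 : 0 ≤ x ^ 2 - x := by nlinarith
  rw [e, abs_le]
  constructor
  · nlinarith [mul_nonneg hw (pow_nonneg (zero_le_one.trans hn') 3),
      mul_nonneg (mul_nonneg hw (sub_nonneg.2 hw1)) h3, sq_nonneg (w - 1 / 2),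
      mul_nonneg hw (sq_nonneg x), mul_nonneg (sub_nonneg.2 hw1) (sq_nonneg x),
      mul_nonneg (sq_nonneg (w - 1/2)) (sq_nonneg x)]
  · nlinarith [mul_nonneg (sub_nonneg.2 hw1) (pow_nonneg (zero_le_one.trans hn') 3),
      mul_nonneg (mul_nonneg hw (sub_nonneg.2 hw1)) h3, sq_nonneg (w - 1 / 2),
      mul_nonneg hw (sq_nonneg x), mul_nonneg (sub_nonneg.2 hw1) (sq_nonneg x),
      mul_nonneg (mul_nonneg hw (sub_nonneg.2 hw1)) (sq_nonneg x)]

lemma sum_inv_sq_le_two (n : ℕ) :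
    ∑ d ∈ Finset.range n, (1 / ((d + 1 : ℕ) : ℝ) ^ 2) ≤ 2 := by
  have h : ∀ n : ℕ, ∑ d ∈ Finset.range (n + 1), (1 / ((d + 1 : ℕ) : ℝ) ^ 2) ≤
      2 - 1 / ((n : ℝ) + 1) := by
    intro n
    induction n with
    | zero => norm_num
    | succ n ih =>
      rw [Finset.sum_range_succ]
      have : 1 / ((n + 1 + 1 : ℕ) : ℝ) ^ 2 ≤
          1 / ((n : ℝ) + 1) - 1 / (((n + 1 : ℕ) : ℝ) + 1) := by
        have e : 1 / ((n : ℝ) + 1) - 1 / (((n + 1 : ℕ) : ℝ) + 1) =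
            1 / (((n : ℝ) + 1) * (n + 2)) := by
          push_cast; field_simp; ring
        rw [e]
        apply one_div_le_one_div_of_le (by positivity)
        push_cast
        nlinarith
      linarith
  have h1 := h n
  rw [Finset.sum_range_succ] at h1
  have h2 : (0 : ℝ) ≤ 1 / ((n : ℝ) + 1) := by positivity
  have h3 : (0 : ℝ) ≤ 1 / ((n + 1 : ℕ) : ℝ) ^ 2 := by positivity
  linarith

/-- The main term: total width of all the strips. -/
lemma abs_sum_stripWidth_sub_le (e w : ℝ) (he : 0 ≤ e) (hw : 0 ≤ w) (hw1 : w ≤ 1) (n : ℕ) :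
    |∑ d ∈ Finset.range n, ∑ a ∈ Finset.Ioc (-((d + 1 : ℕ) : ℤ)) (d + 1 : ℕ),
      ∑ j ∈ Finset.range (n - (d + 1)), 2 * stripWidth e w (d + 1) a j - 2 / 3 * e * (n : ℝ) ^ 4|
      ≤ 7 * e * (n : ℝ) ^ 3 := by
  have h1 : ∀ d ∈ Finset.range n, ∑ a ∈ Finset.Ioc (-((d + 1 : ℕ) : ℤ)) (d + 1 : ℕ),
      ∑ j ∈ Finset.range (n - (d + 1)), 2 * stripWidth e w (d + 1) a j =
      16 / 3 * e * ∑ j ∈ Finset.range (n - (d + 1)), (w + j) * (w + j + (d + 1 : ℕ)) +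
      2 / 3 * e * ((1 / ((d + 1 : ℕ) : ℝ) ^ 2) *
        ∑ j ∈ Finset.range (n - (d + 1)), (w + j) * (w + j + (d + 1 : ℕ))) := by
    intro d _
    have hd' : (0 : ℝ) < (d + 1 : ℕ) := by positivity
    rw [Finset.sum_comm, Finset.mul_sum, Finset.mul_sum, Finset.mul_sum,
      ← Finset.sum_add_distrib]
    refine Finset.sum_congr rfl fun j _ => ?_
    have : ∀ a : ℤ, 2 * stripWidth e w (d + 1) a j =
        2 * e * ((w + j) * (w + j + (d + 1 : ℕ))) / (d + 1 : ℕ) *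
          (1 + (a / (d + 1 : ℕ) : ℝ) ^ 2) := by
      intro a; unfold stripWidth; ring
    simp only [this]
    rw [← Finset.mul_sum, sum_one_add_sq_div (d + 1) (by omega)]
    field_simp
    ring
  rw [Finset.sum_congr rfl h1, Finset.sum_add_distrib, ← Finset.mul_sum, ← Finset.mul_sum]
  have h2 := abs_le.1 (abs_sum_pairs_sub_le w hw hw1 n)
  set S := ∑ d ∈ Finset.range n, ∑ j ∈ Finset.range (n - (d + 1)),
    (w + j) * (w + j + (d + 1 : ℕ)) with hS
  set R := ∑ d ∈ Finset.range n, (1 / ((d + 1 : ℕ) : ℝ) ^ 2 *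
    ∑ j ∈ Finset.range (n - (d + 1)), (w + j) * (w + j + (d + 1 : ℕ))) with hR
  have hR0 : 0 ≤ R := Finset.sum_nonneg fun d _ => mul_nonneg (by positivity)
    (Finset.sum_nonneg fun j _ => by positivity)
  have hR1 : R ≤ 2 * (n : ℝ) ^ 3 := by
    have : R ≤ ∑ d ∈ Finset.range n, (1 / ((d + 1 : ℕ) : ℝ) ^ 2 * (n : ℝ) ^ 3) := by
      refine Finset.sum_le_sum fun d _ => mul_le_mul_of_nonneg_left ?_ (by positivity)
      calc ∑ j ∈ Finset.range (n - (d + 1)), (w + j) * (w + j + (d + 1 : ℕ))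
          ≤ ∑ j ∈ Finset.range (n - (d + 1)), (n * n : ℝ) := by
            refine Finset.sum_le_sum fun j hj => ?_
            have hj' := Finset.mem_range.1 hj
            have hjn : (j : ℝ) + (d + 1 : ℕ) + 1 ≤ n := by
              have : j + (d + 1) + 1 ≤ n := by omega
              exact_mod_cast this
            have hd0 : (0 : ℝ) ≤ (d + 1 : ℕ) := Nat.cast_nonneg _
            gcongr <;> linarith
        _ = ((n - (d + 1) : ℕ) : ℝ) * (n * n) := by
            rw [Finset.sum_const, Finset.card_range, nsmul_eq_mul]
        _ ≤ n * (n * n) := by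
            gcongr; exact Nat.sub_le _ _
        _ = _ := by ring
    refine this.trans ?_
    rw [← Finset.sum_mul]
    gcongr
    exact sum_inv_sq_le_two n
  have h3 : 0 ≤ e * (n : ℝ) ^ 3 := by positivity
  have e1 := mul_le_mul_of_nonneg_left h2.1 he
  have e2 := mul_le_mul_of_nonneg_left h2.2 he
  have e3 := mul_le_mul_of_nonneg_left hR1 he
  have e4 := mul_nonneg he hR0
  rw [abs_le]
  constructor <;> nlinarith

lemma abs_sum_strip_sub_le (e w α β : ℝ) (he : 0 ≤ e) (hw : 0 ≤ w) (hw1 : w ≤ 1) (hαβ : α ≤ β)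
    (n T : ℕ) (hT : 0 < T) (E₀ : ℝ) (hE : e * (n : ℝ) ^ 2 ≤ E₀) :
    |∑ d ∈ Finset.range n, ∑ a ∈ Finset.Ioc (-((d + 1 : ℕ) : ℤ)) (d + 1 : ℕ),
      ∑ j ∈ Finset.range (n - (d + 1)), ((∫ x in α..β,
        intCount (x + a / (d + 1 : ℕ) * (w + j) - stripWidth e w (d + 1) a j)
          (x + a / (d + 1 : ℕ) * (w + j) + stripWidth e w (d + 1) a j))
          - (β - α) * (2 * stripWidth e w (d + 1) a j))| ≤
      4 * E₀ * (36 * ((n : ℝ) ^ 2 / √T) + 18 * (n * T * √n) + 2 * (n * (T * (β - α) + 3))) := by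
  have hE0 : 0 ≤ E₀ := le_trans (by positivity) hE
  choose p q hq hqT hpq hdisc using fun θ : ℝ => exists_approx_and_discrepancy θ T hT
  have hfix : ∀ d ∈ Finset.range n, ∀ a ∈ Finset.Ioc (-((d + 1 : ℕ) : ℤ)) (d + 1 : ℕ),
      |∑ j ∈ Finset.range (n - (d + 1)), ((∫ x in α..β,
        intCount (x + a / (d + 1 : ℕ) * (w + j) - stripWidth e w (d + 1) a j)
          (x + a / (d + 1 : ℕ) * (w + j) + stripWidth e w (d + 1) a j))
          - (β - α) * (2 * stripWidth e w (d + 1) a j))| ≤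
      4 * E₀ / (d + 1 : ℕ) * (3 * n * (1 / q (a / (d + 1 : ℕ))) + (T * (β - α) + 3)) := by
    intro d _ a ha
    rw [Finset.mem_Ioc] at ha
    set θ : ℝ := a / (d + 1 : ℕ) with hθ
    have hd' : (0 : ℝ) < (d + 1 : ℕ) := by positivity
    have hqp : (0 : ℝ) < q θ := by exact_mod_cast hq θ
    have hqT' : (q θ : ℝ) ≤ T := by exact_mod_cast hqT θ
    have hL : 0 ≤ β - α := by linarith
    have key := abs_sum_integral_intCount_sub_le α β (θ * w) θ (2 * E₀ / (d + 1 : ℕ))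
      (3 * n * (1 / q θ) + (T * (β - α) + 3)) (n - (d + 1)) (stripWidth e w (d + 1) a)
      (stripWidth_nonneg he hw _ _) (stripWidth_monotone he hw _ _)
      (fun j hj => (stripWidth_le he hw hw1 ha.1.le ha.2 hj).trans (by gcongr))
      (by positivity) (by positivity) (fun c b m hm => by
        refine (hdisc θ α β c hαβ b m).trans ?_
        have hmn : (m : ℝ) ≤ n := by exact_mod_cast hm.trans (Nat.sub_le _ _)
        have : (m / q θ : ℝ) ≤ n * (1 / q θ) := by
          rw [mul_one_div]; gcongr
        have := mul_le_mul_of_nonneg_right hqT' hL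
        linarith)
    rw [Finset.sum_sub_distrib, ← Finset.mul_sum]
    refine le_trans (le_of_eq ?_) (key.trans (le_of_eq (by ring)))
    congr 2
    refine Finset.sum_congr rfl fun j _ => ?_
    rw [integral_intCount_swap]
    refine intervalIntegral.integral_congr fun x _ => ?_
    ring_nf
  have hL : 0 ≤ β - α := by linarith
  have hfix2 : ∀ d ∈ Finset.range n, |∑ a ∈ Finset.Ioc (-((d + 1 : ℕ) : ℤ)) (d + 1 : ℕ),
      ∑ j ∈ Finset.range (n - (d + 1)), ((∫ x in α..β,
        intCount (x + a / (d + 1 : ℕ) * (w + j) - stripWidth e w (d + 1) a j)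
          (x + a / (d + 1 : ℕ) * (w + j) + stripWidth e w (d + 1) a j))
          - (β - α) * (2 * stripWidth e w (d + 1) a j))| ≤
      4 * E₀ * (36 * (n / √T) + 9 * (n * T) * (1 / (d + 1 : ℕ)) + 2 * (T * (β - α) + 3)) := by
    intro d hd
    have hd' : (0 : ℝ) < (d + 1 : ℕ) := by positivity
    refine (Finset.abs_sum_le_sum_abs _ _).trans ((Finset.sum_le_sum (hfix d hd)).trans ?_)
    rw [← Finset.mul_sum, Finset.sum_add_distrib, ← Finset.mul_sum, Finset.sum_const,
      Int.card_Ioc, nsmul_eq_mul]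
    have h1 := sum_inv_approx_den_le (d + 1) T (by omega) hT (fun a => p (a / (d + 1 : ℕ)))
      (fun a => q (a / (d + 1 : ℕ))) (fun a => hq _) (fun a => hqT _) (fun a => hpq _)
    have h2 : ((((d + 1 : ℕ) : ℤ) - -((d + 1 : ℕ) : ℤ)).toNat : ℝ) = 2 * (d + 1 : ℕ) := by
      have : (((d + 1 : ℕ) : ℤ) - -((d + 1 : ℕ) : ℤ)).toNat = 2 * (d + 1) := by omega
      rw [this]; push_cast; ring
    rw [h2]
    calc _ ≤ 4 * E₀ / (d + 1 : ℕ) * (3 * n * (12 * ((d + 1 : ℕ) / √T) + 3 * T) +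
          2 * (d + 1 : ℕ) * (T * (β - α) + 3)) := by gcongr
      _ = _ := by field_simp; ring
  refine (Finset.abs_sum_le_sum_abs _ _).trans ((Finset.sum_le_sum hfix2).trans ?_)
  have h5 : ∑ d ∈ Finset.range n, 9 * (n * T : ℝ) * (1 / (d + 1 : ℕ) : ℝ) =
      9 * (n * T) * ∑ d ∈ Finset.range n, (1 / (d + 1 : ℕ) : ℝ) := (Finset.mul_sum _ _ _).symm
  rw [← Finset.mul_sum, Finset.sum_add_distrib, Finset.sum_add_distrib, h5,
    Finset.sum_const, Finset.sum_const, Finset.card_range, nsmul_eq_mul, nsmul_eq_mul]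
  have h3 : ∑ d ∈ Finset.range n, (1 / (d + 1 : ℕ) : ℝ) ≤ 2 * √n := by
    refine le_trans (le_of_eq ?_) (sum_inv_le_two_sqrt n)
    rw [Finset.range_eq_Ico, Finset.sum_Ico_add' (fun d : ℕ => (1 / d : ℝ)) 0 n 1]
    rfl
  have h4 : 9 * (n * T : ℝ) * ∑ d ∈ Finset.range n, (1 / (d + 1 : ℕ) : ℝ) ≤
      9 * (n * T) * (2 * √n) := by gcongr
  have : (n : ℝ) * (36 * (n / √T)) = 36 * ((n : ℝ) ^ 2 / √T) := by ring
  refine mul_le_mul_of_nonneg_left ?_ (by positivity)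
  linarith

/-- Averaging along a horizontal segment the number of lattice pairs in the strips. -/
lemma abs_sum_integral_strip_sub_le (L₀ E₀ : ℝ) : ∃ C : ℝ, 0 ≤ C ∧ ∀ (e w α β : ℝ) (n : ℕ),
    0 ≤ e → 0 ≤ w → w ≤ 1 → α ≤ β → β - α ≤ L₀ → 0 < n → e * (n : ℝ) ^ 2 ≤ E₀ →
    |∑ d ∈ Finset.range n, ∑ a ∈ Finset.Ioc (-((d + 1 : ℕ) : ℤ)) (d + 1 : ℕ),
      ∑ j ∈ Finset.range (n - (d + 1)), (∫ x in α..β,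
        intCount (x + a / (d + 1 : ℕ) * (w + j) - stripWidth e w (d + 1) a j)
          (x + a / (d + 1 : ℕ) * (w + j) + stripWidth e w (d + 1) a j))
      - (β - α) * (2 / 3 * e * (n : ℝ) ^ 4)| ≤ C * (n : ℝ) ^ (15 / 8 : ℝ) := by
  refine ⟨4 * |E₀| * (36 + 36 + 2 * (2 * |L₀| + 3)) + 7 * |L₀| * |E₀|, by positivity, ?_⟩
  intro e w α β n he hw hw1 hαβ hL hn hE
  have hn1 : (1 : ℝ) ≤ n := by exact_mod_cast hn
  have hE0 : 0 ≤ E₀ := le_trans (by positivity) hE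
  have hL0 : 0 ≤ L₀ := by linarith
  rw [abs_of_nonneg hE0, abs_of_nonneg hL0]
  set z : ℝ := (n : ℝ) ^ (1 / 8 : ℝ) with hz
  have hz1 : 1 ≤ z := Real.one_le_rpow hn1 (by norm_num)
  have hz0 : 0 < z := by linarith
  have hzn : z ^ 8 = n := by
    rw [hz, ← Real.rpow_natCast, ← Real.rpow_mul (by linarith)]; norm_num
  have hz15 : (n : ℝ) ^ (15 / 8 : ℝ) = z ^ 15 := by
    rw [hz, ← Real.rpow_natCast, ← Real.rpow_mul (by linarith)]; norm_num
  set T := ⌈z ^ 2⌉₊ with hT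
  have hT0 : 0 < T := Nat.ceil_pos.2 (by positivity)
  have hT1 : z ^ 2 ≤ T := Nat.le_ceil _
  have hT2 : (T : ℝ) ≤ 2 * z ^ 2 := by
    have := Nat.ceil_lt_add_one (by positivity : 0 ≤ z ^ 2)
    have : 1 ≤ z ^ 2 := one_le_pow₀ hz1
    linarith
  have hsT : z ≤ √T := Real.le_sqrt_of_sq_le hT1
  have hsn : √(n : ℝ) = z ^ 4 := by
    rw [← hzn, show z ^ 8 = (z ^ 4) ^ 2 by ring, Real.sqrt_sq (by positivity)]
  have h1 := abs_sum_strip_sub_le e w α β he hw hw1 hαβ n T hT0 E₀ hE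
  have h2 := abs_sum_stripWidth_sub_le e w he hw hw1 n
  simp only [Finset.sum_sub_distrib] at h1
  simp only [← Finset.mul_sum] at h1 h2
  set I := ∑ d ∈ Finset.range n, ∑ a ∈ Finset.Ioc (-((d + 1 : ℕ) : ℤ)) (d + 1 : ℕ),
      ∑ j ∈ Finset.range (n - (d + 1)), (∫ x in α..β,
        intCount (x + a / (d + 1 : ℕ) * (w + j) - stripWidth e w (d + 1) a j)
          (x + a / (d + 1 : ℕ) * (w + j) + stripWidth e w (d + 1) a j))
  set V := ∑ d ∈ Finset.range n, ∑ a ∈ Finset.Ioc (-((d + 1 : ℕ) : ℤ)) (d + 1 : ℕ),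
      ∑ j ∈ Finset.range (n - (d + 1)), stripWidth e w (d + 1) a j
  have hLn : 0 ≤ β - α := by linarith
  have b1 : (n : ℝ) ^ 2 / √T ≤ z ^ 15 := by
    rw [div_le_iff₀ (by linarith), ← hzn]
    calc (z ^ 8) ^ 2 = z ^ 15 * z := by ring
      _ ≤ _ := by gcongr
  have b2 : n * T * √n ≤ 2 * z ^ 15 := by
    rw [hsn, ← hzn]
    calc z ^ 8 * T * z ^ 4 ≤ z ^ 8 * (2 * z ^ 2) * z ^ 4 := by gcongr
      _ = 2 * z ^ 14 := by ring
      _ ≤ 2 * z ^ 15 := by gcongr; first | exact hz1 | norm_num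
  have b3 : n * (T * (β - α) + 3) ≤ (2 * L₀ + 3) * z ^ 15 := by
    have hz2 : 1 ≤ z ^ 2 := one_le_pow₀ hz1
    rw [← hzn]
    calc z ^ 8 * (T * (β - α) + 3) ≤ z ^ 8 * ((2 * z ^ 2) * L₀ + 3 * z ^ 2) := by
          gcongr; linarith
      _ = (2 * L₀ + 3) * z ^ 10 := by ring
      _ ≤ _ := by gcongr; first | exact hz1 | norm_num
  have b4 : e * (n : ℝ) ^ 3 ≤ E₀ * z ^ 15 := by
    calc e * (n : ℝ) ^ 3 = e * (n : ℝ) ^ 2 * n := by ring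
      _ ≤ E₀ * z ^ 15 := by
        gcongr
        rw [← hzn]; gcongr; first | exact hz1 | norm_num
  rw [hz15]
  have h3 : |(β - α) * (2 * V) - (β - α) * (2 / 3 * e * (n : ℝ) ^ 4)| ≤
      L₀ * (7 * (E₀ * z ^ 15)) := by
    rw [← mul_sub, abs_mul, abs_of_nonneg hLn]
    gcongr
    linarith
  calc |I - (β - α) * (2 / 3 * e * (n : ℝ) ^ 4)|
      = |(I - (β - α) * (2 * V)) + ((β - α) * (2 * V) - (β - α) * (2 / 3 * e * (n : ℝ) ^ 4))| := by
        congr 1; ring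
    _ ≤ _ := abs_add_le _ _
    _ ≤ 4 * E₀ * (36 * z ^ 15 + 18 * (2 * z ^ 15) + 2 * ((2 * L₀ + 3) * z ^ 15)) +
        L₀ * (7 * (E₀ * z ^ 15)) := by
        refine add_le_add (h1.trans ?_) h3
        gcongr
    _ = _ := by ring

lemma inner_toPt (x y x' y' : ℝ) : inner ℝ (toPt x y) (toPt x' y') = x * x' + y * y' := by
  simp [toPt, PiLp.inner_apply, Fin.sum_univ_two]
  ring

lemma norm_toPt_sq (x y : ℝ) : ‖toPt x y‖ ^ 2 = x ^ 2 + y ^ 2 := by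
  rw [← real_inner_self_eq_norm_sq, inner_toPt]; ring

lemma toPt_vsub (x y x' y' : ℝ) : toPt x y -ᵥ toPt x' y' = toPt (x - x') (y - y') := by
  ext i; fin_cases i <;> simp [toPt]

lemma angle_toPt_le_iff {ε : ℝ} (h0 : 0 < ε) (h1 : ε < π / 2) (t u t' u' : ℝ) :
    InnerProductGeometry.angle (toPt t u) (toPt t' u') ≤ ε ↔
      0 < t * t' + u * u' ∧ |t * u' - t' * u| ≤ tan ε * (t * t' + u * u') := by
  have hc : 0 < cos ε := cos_pos_of_mem_Ioo ⟨by linarith, h1⟩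
  have hs : 0 < sin ε := sin_pos_of_pos_of_lt_pi h0 (by linarith)
  set p := ‖toPt t u‖ * ‖toPt t' u'‖ with hp
  set D := t * t' + u * u' with hD
  have hp0 : 0 ≤ p := by positivity
  have hpsq : p ^ 2 = D ^ 2 + (t * u' - t' * u) ^ 2 := by
    rw [hp, mul_pow, norm_toPt_sq, norm_toPt_sq]; ring
  have hle : InnerProductGeometry.angle (toPt t u) (toPt t' u') ≤ ε ↔ cos ε ≤ D / p := by
    rw [← strictAntiOn_cos.le_iff_ge ⟨h0.le, by linarith⟩
      ⟨InnerProductGeometry.angle_nonneg _ _, InnerProductGeometry.angle_le_pi _ _⟩,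
      InnerProductGeometry.cos_angle, inner_toPt]
  have hcrs : |t * u' - t' * u| ≤ tan ε * D ↔ |t * u' - t' * u| * cos ε ≤ sin ε * D := by
    rw [tan_eq_sin_div_cos, div_mul_eq_mul_div, le_div_iff₀ hc]
  rw [hle, hcrs]
  have hsc := sin_sq_add_cos_sq ε
  have e1 : (cos ε * p) ^ 2 - D ^ 2 = (|t * u' - t' * u| * cos ε) ^ 2 - (sin ε * D) ^ 2 := by
    rw [mul_pow (cos ε), mul_pow |_|, mul_pow (sin ε), hpsq, sq_abs]
    have : sin ε ^ 2 = 1 - cos ε ^ 2 := by linarith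
    rw [this]; ring
  constructor
  · intro h
    have hpp : 0 < p := by
      rcases hp0.eq_or_lt with h' | h'
      · rw [← h', div_zero] at h; linarith
      · exact h'
    rw [le_div_iff₀ hpp] at h
    have hD0 : 0 < D := lt_of_lt_of_le (by positivity) h
    refine ⟨hD0, abs_le_of_sq_le_sq' ?_ (by positivity) |>.2⟩
    have : (cos ε * p) ^ 2 ≤ D ^ 2 := by gcongr
    linarith
  · rintro ⟨hD0, h⟩
    have hpp : 0 < p := by
      rcases hp0.eq_or_lt with h' | h'
      · rw [← h'] at hpsq; nlinarith [sq_nonneg (t * u' - t' * u)]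
      · exact h'
    rw [le_div_iff₀ hpp]
    refine (abs_le_of_sq_le_sq' ?_ hD0.le).2
    have : (|t * u' - t' * u| * cos ε) ^ 2 ≤ (sin ε * D) ^ 2 := by gcongr
    linarith

/-- `P` and `P'` are seen from `(x, y)` under an angle of tangent at most `κ`. -/
def IsSmallAt (κ x y : ℝ) (P P' : ℤ × ℤ) : Prop :=
  0 < (P.1 - x) * (P'.1 - x) + (P.2 - y) * (P'.2 - y) ∧
    |(P.1 - x) * (P'.2 - y) - (P'.1 - x) * (P.2 - y)| ≤
      κ * ((P.1 - x) * (P'.1 - x) + (P.2 - y) * (P'.2 - y))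

lemma angleAt_le_iff {ε : ℝ} (h0 : 0 < ε) (h1 : ε < π / 2) (x y : ℝ) (P P' : ℤ × ℤ) :
    |angleAt x y P P'| ≤ ε ↔ IsSmallAt (tan ε) x y P P' := by
  unfold angleAt IsSmallAt
  rw [abs_of_nonneg (EuclideanGeometry.angle_nonneg _ _ _), EuclideanGeometry.angle, toPt_vsub,
    toPt_vsub, angle_toPt_le_iff h0 h1]

lemma isSmallAt_rot (κ x y : ℝ) (P P' : ℤ × ℤ) :
    IsSmallAt κ (-y) x (-P.2, P.1) (-P'.2, P'.1) ↔ IsSmallAt κ x y P P' := by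
  unfold IsSmallAt
  push_cast
  rw [show (-(P.2 : ℝ) - -y) * (-P'.2 - -y) + (P.1 - x) * (P'.1 - x) =
      (P.1 - x) * (P'.1 - x) + (P.2 - y) * (P'.2 - y) by ring,
    show (-(P.2 : ℝ) - -y) * (P'.1 - x) - (-P'.2 - -y) * (P.1 - x) =
      (P.1 - x) * (P'.2 - y) - (P'.1 - x) * (P.2 - y) by ring]

lemma IsSmallAt.neg_swap {κ x y : ℝ} {P P' : ℤ × ℤ} (h : IsSmallAt κ x y P P') :
    IsSmallAt κ (-x) (-y) (-P') (-P) := by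
  unfold IsSmallAt at h ⊢
  simp only [Prod.fst_neg, Prod.snd_neg]
  push_cast
  rw [show (-(P'.1 : ℝ) - -x) * (-P.1 - -x) + (-P'.2 - -y) * (-P.2 - -y) =
      (P.1 - x) * (P'.1 - x) + (P.2 - y) * (P'.2 - y) by ring,
    show (-(P'.1 : ℝ) - -x) * (-P.2 - -y) - (-P.1 - -x) * (-P'.2 - -y) =
      -((P.1 - x) * (P'.2 - y) - (P'.1 - x) * (P.2 - y)) by ring, abs_neg]
  exact h

/-- Pairs in the box with difference in `s`, seen under a small angle. -/
def smallPairs (s : ℤ → ℤ → Prop) (κ : ℝ) (Q : ℕ) (x y : ℝ) : Set ((ℤ × ℤ) × (ℤ × ℤ)) :=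
  {pp | pp.1 ∈ Box Q ∧ pp.2 ∈ Box Q ∧ s (pp.2.1 - pp.1.1) (pp.2.2 - pp.1.2) ∧
    IsSmallAt κ x y pp.1 pp.2}

lemma box_eq (Q : ℕ) : Box Q = ↑(Finset.Icc (-(Q : ℤ)) Q ×ˢ Finset.Icc (-(Q : ℤ)) Q) := by
  ext p
  simp only [Box, abs_le, Finset.coe_product, Finset.coe_Icc, Set.mem_prod, Set.mem_Icc,
    Set.mem_ofPred_eq]

lemma box_finite (Q : ℕ) : (Box Q).Finite := by
  rw [box_eq]; exact Finset.finite_toSet _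

lemma smallPairs_finite (s : ℤ → ℤ → Prop) (κ : ℝ) (Q : ℕ) (x y : ℝ) :
    (smallPairs s κ Q x y).Finite :=
  ((box_finite Q).prod (box_finite Q)).subset fun _ h => ⟨h.1, h.2.1⟩

lemma ncard_smallPairs_rot (s : ℤ → ℤ → Prop) (κ : ℝ) (Q : ℕ) (x y : ℝ) :
    (smallPairs (fun a b => s (-b) a) κ Q x y).ncard = (smallPairs s κ Q (-y) x).ncard := by
  refine Set.ncard_congr (fun pp _ => ((-pp.1.2, pp.1.1), (-pp.2.2, pp.2.1))) ?_ ?_ ?_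
  · rintro ⟨⟨X, Y⟩, ⟨X', Y'⟩⟩ ⟨⟨h1, h2⟩, ⟨h3, h4⟩, h5, h6⟩
    refine ⟨⟨by simpa using h2, h1⟩, ⟨by simpa using h4, h3⟩, ?_, ?_⟩
    · convert h5 using 1; simp only; ring
    · exact (isSmallAt_rot κ x y (X, Y) (X', Y')).2 h6
  · rintro ⟨⟨X, Y⟩, ⟨X', Y'⟩⟩ ⟨⟨Z, W⟩, ⟨Z', W'⟩⟩ _ _ h
    simp only [Prod.mk.injEq, neg_inj] at h ⊢
    tauto
  · rintro ⟨⟨X, Y⟩, ⟨X', Y'⟩⟩ ⟨⟨h1, h2⟩, ⟨h3, h4⟩, h5, h6⟩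
    refine ⟨((Y, -X), (Y', -X')), ⟨⟨h2, by simpa using h1⟩,
      ⟨h4, by simpa using h3⟩, ?_, ?_⟩, by simp⟩
    · convert h5 using 1; simp only; ring
    · exact (isSmallAt_rot κ x y (Y, -X) (Y', -X')).1 (by simpa using h6)

/-- The quarter plane around the positive vertical axis. -/
def InSector (a b : ℤ) : Prop := 0 < b ∧ -b < a ∧ a ≤ b

/-- Pairs in a box with difference in the upper quarter plane and lying above the horizontal line
through `(x, y)`, seen under a small angle. -/
def upperPairs (κ : ℝ) (Q : ℕ) (x y : ℝ) : Set ((ℤ × ℤ) × (ℤ × ℤ)) :=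
  smallPairs InSector κ Q x y ∩ {pp | y < pp.1.2}

lemma upperPairs_finite (κ : ℝ) (Q : ℕ) (x y : ℝ) : (upperPairs κ Q x y).Finite :=
  (smallPairs_finite _ _ _ _ _).inter_of_left _

/-- Pairs seen under a small angle do not straddle the horizontal line. -/
lemma IsSmallAt.lt_of_le {κ x y H : ℝ} {P P' : ℤ × ℤ} (h : IsSmallAt κ x y P P') (hκ : 0 ≤ κ)
    (hd : P.2 < P'.2) (hy : P.2 ≤ y) (h1 : |P.1 - x| ≤ H) (h2 : |P'.1 - x| ≤ H) (hH : κ * H < 1) :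
    P'.2 < y := by
  by_contra! hc
  obtain ⟨hD, hC⟩ := h
  have hd' : (P.2 : ℝ) + 1 ≤ P'.2 := by exact_mod_cast hd
  set t := (P.1 : ℝ) - x
  set t' := (P'.1 : ℝ) - x
  obtain ⟨u, hu⟩ : ∃ u, u = y - (P.2 : ℝ) := ⟨_, rfl⟩
  obtain ⟨u', hu'⟩ : ∃ u, u = (P'.2 : ℝ) - y := ⟨_, rfl⟩
  have eu : (P.2 : ℝ) - y = -u := by linarith
  rw [eu, ← hu'] at hD hC
  have hu0 : 0 ≤ u := by linarith
  have hu0' : 0 ≤ u' := by linarith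
  have huu : 1 ≤ u + u' := by linarith
  have huv := mul_nonneg hu0 hu0'
  have htt : 0 < t * t' := by nlinarith
  have hle : κ * (t * t' + -u * u') ≤ κ * (t * t') := mul_le_mul_of_nonneg_left (by nlinarith) hκ
  have hkey : |t| * u' + |t'| * u ≤ κ * (|t| * |t'|) := by
    rcases pos_and_pos_or_neg_and_neg_of_mul_pos htt with ⟨p, p'⟩ | ⟨p, p'⟩
    · rw [abs_of_pos p, abs_of_pos p']
      linarith [(abs_le.1 hC).2]
    · rw [abs_of_neg p, abs_of_neg p']
      linarith [(abs_le.1 hC).1]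
  have ht : 0 < |t| := abs_pos.2 (left_ne_zero_of_mul htt.ne')
  have ht' : 0 < |t'| := abs_pos.2 (right_ne_zero_of_mul htt.ne')
  have b1 : κ * (|t| * |t'|) ≤ |t| * (κ * H) := by
    calc κ * (|t| * |t'|) ≤ κ * (|t| * H) := by gcongr
      _ = _ := by ring
  have b2 : κ * (|t| * |t'|) ≤ |t'| * (κ * H) := by
    calc κ * (|t| * |t'|) ≤ κ * (H * |t'|) := by gcongr
      _ = _ := by ring
  rcases le_total |t| |t'| with hm | hm
  · nlinarith [mul_nonneg (sub_nonneg.2 hm) hu0, mul_pos ht (sub_pos.2 hH)]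
  · nlinarith [mul_nonneg (sub_nonneg.2 hm) hu0', mul_pos ht' (sub_pos.2 hH)]

lemma ncard_smallPairs_sector {κ x y M : ℝ} {Q : ℕ} (hκ : 0 ≤ κ) (hx : |x| ≤ M)
    (hH : κ * (Q + M) < 1) :
    (smallPairs InSector κ Q x y).ncard =
      (upperPairs κ Q x y).ncard + (upperPairs κ Q (-x) (-y)).ncard := by
  have hsplit : (upperPairs κ Q x y).ncard +
      (smallPairs InSector κ Q x y \ {pp | y < pp.1.2}).ncard =
      (smallPairs InSector κ Q x y).ncard :=
    Set.ncard_inter_add_ncard_sdiff_eq_ncard _ _ (smallPairs_finite _ _ _ _ _)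
  rw [← hsplit]
  congr 1
  have hcoord : ∀ X : ℤ, |X| ≤ (Q : ℤ) → |(X : ℝ) - x| ≤ Q + M := fun X hX => by
    refine (abs_sub _ _).trans (add_le_add ?_ hx)
    exact_mod_cast hX
  refine Set.ncard_congr (fun pp _ => (-pp.2, -pp.1)) ?_ ?_ ?_
  · rintro ⟨⟨X, Y⟩, ⟨X', Y'⟩⟩ ⟨⟨⟨h1, h2⟩, ⟨h3, h4⟩, h5, h6⟩, h7⟩
    have hlt := h6.lt_of_le hκ (by have := h5.1; simp only at this ⊢; omega)
      (not_lt.1 h7) (hcoord _ h1) (hcoord _ h3) hH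
    refine ⟨⟨⟨by simpa using h3, by simpa using h4⟩, ⟨by simpa using h1, by simpa using h2⟩,
      ?_, ?_⟩, ?_⟩
    · convert h5 using 1 <;> simp only [Prod.fst_neg, Prod.snd_neg] <;> ring
    · simpa using h6.neg_swap
    · simp only [Set.mem_ofPred_eq, Prod.snd_neg]
      push_cast
      linarith
  · rintro ⟨⟨X, Y⟩, ⟨X', Y'⟩⟩ ⟨⟨Z, W⟩, ⟨Z', W'⟩⟩ _ _ h
    simp only [Prod.mk.injEq, neg_inj] at h ⊢
    tauto
  · rintro ⟨⟨X, Y⟩, ⟨X', Y'⟩⟩ ⟨⟨⟨h1, h2⟩, ⟨h3, h4⟩, h5, h6⟩, h7⟩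
    refine ⟨(-(X', Y'), -(X, Y)), ⟨⟨⟨by simpa using h3, by simpa using h4⟩,
      ⟨by simpa using h1, by simpa using h2⟩, ?_, ?_⟩, ?_⟩, by simp⟩
    · convert h5 using 1 <;> simp only [Prod.fst_neg, Prod.snd_neg] <;> ring
    · simpa using h6.neg_swap
    · have := h5.1
      simp only [Set.mem_ofPred_eq, Prod.snd_neg, not_lt] at h7 ⊢
      simp only at this
      have : (Y : ℝ) ≤ Y' := by exact_mod_cast (by omega : Y ≤ Y')
      push_cast
      linarith

lemma ncard_smallPairs_ne (κ : ℝ) (Q : ℕ) (x y : ℝ) :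
    (smallPairs (fun a b => ¬(a = 0 ∧ b = 0)) κ Q x y).ncard =
      (smallPairs InSector κ Q x y).ncard + ((smallPairs InSector κ Q (-y) x).ncard +
        ((smallPairs InSector κ Q (-x) (-y)).ncard +
          (smallPairs InSector κ Q y (-x)).ncard)) := by
  have h1 := ncard_smallPairs_rot InSector κ Q x y
  have h2 := ncard_smallPairs_rot (fun a b => InSector (-b) a) κ Q x y
  have h2' := ncard_smallPairs_rot InSector κ Q (-y) x
  have h3 := ncard_smallPairs_rot (fun a b => InSector (-a) (-b)) κ Q x y
  have h3' := ncard_smallPairs_rot (fun a b => InSector (-b) a) κ Q (-y) x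
  have h3'' := ncard_smallPairs_rot InSector κ Q (-x) (-y)
  simp only [neg_neg] at h1 h2 h2' h3 h3' h3''
  rw [← h1, ← h2', ← h2, ← h3'', ← h3', ← h3]
  rw [← Set.ncard_union_eq _ (smallPairs_finite _ _ _ _ _) (smallPairs_finite _ _ _ _ _),
    ← Set.ncard_union_eq _ (smallPairs_finite _ _ _ _ _)
      ((smallPairs_finite _ _ _ _ _).union (smallPairs_finite _ _ _ _ _)),
    ← Set.ncard_union_eq _ (smallPairs_finite _ _ _ _ _)
      ((smallPairs_finite _ _ _ _ _).union ((smallPairs_finite _ _ _ _ _).union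
        (smallPairs_finite _ _ _ _ _)))]
  · congr 1
    ext pp
    have : ∀ a b : ℤ, ¬(a = 0 ∧ b = 0) ↔
        InSector a b ∨ InSector (-b) a ∨ InSector (-a) (-b) ∨ InSector b (-a) := by
      intro a b; unfold InSector; omega
    simp only [smallPairs, Set.mem_union, Set.mem_ofPred_eq, this]
    tauto
  all_goals
    rw [Set.disjoint_left]
    simp only [smallPairs, Set.mem_union, Set.mem_ofPred_eq, InSector]
    omega

lemma R2pt_eq {lam : ℝ} {Q : ℕ} (h0 : 0 < lam) (h1 : 2 * π * lam / (2 * Q + 1) ^ 2 < π / 2)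
    (x y : ℝ) : R2pt x y Q lam = ((smallPairs (fun a b => ¬(a = 0 ∧ b = 0))
      (tan (2 * π * lam / (2 * Q + 1) ^ 2)) Q x y).ncard : ℝ) / (2 * (Q : ℝ) + 1) ^ 2 := by
  unfold R2pt smallPairs
  congr 3
  ext ⟨P, P'⟩
  have hN : (0 : ℝ) < (2 * Q + 1) ^ 2 := by positivity
  have hpi := Real.pi_pos
  simp only [Set.mem_ofPred_eq]
  rw [← angleAt_le_iff (by positivity) h1, le_div_iff₀ hN, div_mul_eq_mul_div,
    div_le_iff₀ (by positivity)]
  have e1 : P ≠ P' ↔ ¬(P'.1 - P.1 = 0 ∧ P'.2 - P.2 = 0) := by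
    rw [Ne, Prod.ext_iff]; omega
  rw [e1, mul_comm ((2 * (Q : ℝ) + 1) ^ 2), mul_comm lam]

/-- Lattice pairs whose first point lies in the strip around the line through `(x, y)` directed by
their difference. -/
def stripPairs (e : ℝ) (n : ℕ) (x y : ℝ) : Set ((ℤ × ℤ) × (ℤ × ℤ)) :=
  {pp | InSector (pp.2.1 - pp.1.1) (pp.2.2 - pp.1.2) ∧ y < pp.1.2 ∧ pp.2.2 < ⌊y⌋ + 1 + n ∧
    |pp.1.1 - x - ((pp.2.1 - pp.1.1 : ℤ) : ℝ) / ((pp.2.2 - pp.1.2 : ℤ) : ℝ) * (pp.1.2 - y)| ≤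
      e * ((pp.1.2 - y) * (pp.2.2 - y) *
        (1 + (((pp.2.1 - pp.1.1 : ℤ) : ℝ) / ((pp.2.2 - pp.1.2 : ℤ) : ℝ)) ^ 2)) /
        ((pp.2.2 - pp.1.2 : ℤ) : ℝ)}

/-- The number of lattice pairs in `stripPairs`, as an explicit sum. -/
noncomputable def stripCount (e : ℝ) (n : ℕ) (x y : ℝ) : ℝ :=
  ∑ d ∈ Finset.range n, ∑ a ∈ Finset.Ioc (-((d + 1 : ℕ) : ℤ)) (d + 1 : ℕ),
    ∑ j ∈ Finset.range (n - (d + 1)),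
      intCount (x + a / (d + 1 : ℕ) * (⌊y⌋ + 1 - y + j) - stripWidth e (⌊y⌋ + 1 - y) (d + 1) a j)
        (x + a / (d + 1 : ℕ) * (⌊y⌋ + 1 - y + j) + stripWidth e (⌊y⌋ + 1 - y) (d + 1) a j)

lemma finite_stripPairs_and_stripCount_eq {e : ℝ} (he : 0 ≤ e) (n : ℕ) (x y : ℝ) :
    (stripPairs e n x y).Finite ∧ stripCount e n x y = (stripPairs e n x y).ncard := by
  classical
  set w : ℝ := ⌊y⌋ + 1 - y with hw
  have hw0 : 0 < w := by have := Int.lt_floor_add_one y; linarith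
  let s : Finset (Σ _ : ℕ, Σ _ : ℤ, Σ _ : ℕ, ℤ) :=
    (Finset.range n).sigma fun d => (Finset.Ioc (-((d + 1 : ℕ) : ℤ)) (d + 1 : ℕ)).sigma fun a =>
      (Finset.range (n - (d + 1))).sigma fun j =>
        Finset.Icc ⌈x + a / (d + 1 : ℕ) * (w + j) - stripWidth e w (d + 1) a j⌉
          ⌊x + a / (d + 1 : ℕ) * (w + j) + stripWidth e w (d + 1) a j⌋
  let φ : (Σ _ : ℕ, Σ _ : ℤ, Σ _ : ℕ, ℤ) → (ℤ × ℤ) × (ℤ × ℤ) := fun q =>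
    ((q.2.2.2, ⌊y⌋ + 1 + q.2.2.1), (q.2.2.2 + q.2.1, ⌊y⌋ + 1 + q.2.2.1 + (q.1 + 1 : ℕ)))
  have hφ : Function.Injective φ := by
    rintro ⟨d, a, j, X⟩ ⟨d', a', j', X'⟩ h
    simp only [φ, Prod.mk.injEq] at h
    obtain ⟨⟨rfl, h2⟩, h3, h4⟩ := h
    obtain rfl : a = a' := by omega
    obtain rfl : j = j' := by omega
    obtain rfl : d = d' := by omega
    rfl
  have hcond : ∀ (d : ℕ) (a : ℤ) (j : ℕ) (X : ℤ),
      X ∈ Finset.Icc ⌈x + a / (d + 1 : ℕ) * (w + j) - stripWidth e w (d + 1) a j⌉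
          ⌊x + a / (d + 1 : ℕ) * (w + j) + stripWidth e w (d + 1) a j⌋ ↔
      |X - x - (a : ℝ) / (d + 1 : ℕ) * (w + j)| ≤
        e * ((w + j) * (w + j + (d + 1 : ℕ)) * (1 + ((a : ℝ) / (d + 1 : ℕ)) ^ 2)) /
          (d + 1 : ℕ) := by
    intro d a j X
    rw [Finset.mem_Icc, Int.ceil_le, Int.le_floor, abs_le]
    unfold stripWidth
    constructor
    · rintro ⟨h1, h2⟩; constructor <;> linarith
    · rintro ⟨h1, h2⟩; constructor <;> linarith
  have himg : stripPairs e n x y = ↑(s.image φ) := by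
    ext ⟨⟨X, Y⟩, ⟨X', Y'⟩⟩
    simp only [Finset.coe_image, Set.mem_image, Finset.mem_coe, s, Finset.mem_sigma, hcond,
      Sigma.exists, φ, stripPairs, InSector, Set.mem_ofPred_eq, Finset.mem_range, Finset.mem_Ioc]
    constructor
    · rintro ⟨⟨h1, h2, h3⟩, h4, h5, h6⟩
      obtain ⟨j, hj⟩ := Int.eq_ofNat_of_zero_le
        (show 0 ≤ Y - (⌊y⌋ + 1) by have := Int.floor_lt.2 h4; omega)
      obtain ⟨d, hd⟩ := Int.eq_ofNat_of_zero_le (show 0 ≤ Y' - Y - 1 by omega)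
      refine ⟨d, X' - X, j, X, ⟨by omega, ⟨by omega, by omega⟩, by omega, ?_⟩, ?_⟩
      · have hY : (Y : ℝ) - y = w + j := by
          have : (Y : ℝ) = ⌊y⌋ + 1 + j := by exact_mod_cast (by omega : Y = ⌊y⌋ + 1 + j)
          rw [this, hw]; ring
        have hdd : ((Y' - Y : ℤ) : ℝ) = (d + 1 : ℕ) := by
          exact_mod_cast (by omega : Y' - Y = ((d + 1 : ℕ) : ℤ))
        have hY' : (Y' : ℝ) - y = w + j + (d + 1 : ℕ) := by
          rw [← hY, ← hdd]; push_cast; ring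
        rwa [hY, hY', hdd] at h6
      · simp only [Prod.mk.injEq]
        exact ⟨⟨trivial, by omega⟩, by omega, by push_cast; omega⟩
    · rintro ⟨d, a, j, X₀, ⟨h1, ⟨h2, h3⟩, h4, h5⟩, h6⟩
      simp only [Prod.mk.injEq] at h6
      obtain ⟨⟨rfl, rfl⟩, rfl, rfl⟩ := h6
      refine ⟨by omega, ?_, by omega, ?_⟩
      · push_cast; have : (0 : ℝ) ≤ j := Nat.cast_nonneg _
        linarith
      · have e1 : ((⌊y⌋ + 1 + (j : ℤ) : ℤ) : ℝ) - y = w + j := by rw [hw]; push_cast; ring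
        have e2 : ((⌊y⌋ + 1 + (j : ℤ) + ((d + 1 : ℕ) : ℤ) : ℤ) : ℝ) - y = w + j + (d + 1 : ℕ) := by
          rw [hw]; push_cast; ring
        rw [e1, e2, add_sub_cancel_left, add_sub_cancel_left]
        exact_mod_cast h5
  refine ⟨himg ▸ Finset.finite_toSet _, ?_⟩
  rw [himg, Set.ncard_coe_finset, Finset.card_image_of_injective _ hφ]
  simp only [s, Finset.card_sigma, Nat.cast_sum]
  unfold stripCount
  refine Finset.sum_congr rfl fun d _ => Finset.sum_congr rfl fun a _ =>
    Finset.sum_congr rfl fun j _ => ?_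
  rw [← intCount_eq_card]
  have := stripWidth_nonneg he hw0.le (d + 1) a j
  linarith

lemma small_of_strip {κ H t u a d : ℝ} (hκ : 0 ≤ κ) (hd : 1 ≤ d) (hu : 0 < u) (hH : u + d ≤ H)
    (ha1 : -d ≤ a) (ha2 : a ≤ d)
    (h : |t - a / d * u| ≤ κ / (1 + 2 * H * κ) * (u * (u + d) * (1 + (a / d) ^ 2)) / d) :
    0 < t * (t + a) + u * (u + d) ∧
      |t * (u + d) - (t + a) * u| ≤ κ * (t * (t + a) + u * (u + d)) := by
  have hd0 : 0 < d := by linarith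
  obtain ⟨θ, hθ⟩ : ∃ θ, θ = a / d := ⟨_, rfl⟩
  have ha : a = θ * d := by rw [hθ]; field_simp
  have hθ1 : |θ| ≤ 1 := by
    rw [hθ, abs_div, abs_of_pos hd0]; exact div_le_one_of_le₀ (abs_le.2 ⟨ha1, ha2⟩) hd0.le
  rw [← hθ] at h
  obtain ⟨τ, hτ⟩ : ∃ τ, τ = t - θ * u := ⟨_, rfl⟩
  rw [← hτ] at h
  have ht : t = θ * u + τ := by linarith
  set e := κ / (1 + 2 * H * κ) with he
  set A := u * (u + d) * (1 + θ ^ 2) with hA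
  have hH0 : 0 < H := by linarith
  have hHκ : 0 ≤ H * κ := by positivity
  have hden : 0 < 1 + 2 * H * κ := by linarith
  have hA0 : 0 < A := by positivity
  have he0 : 0 ≤ e := by positivity
  have hcrs : t * (u + d) - (t + a) * u = d * τ := by rw [ht, ha]; ring
  have hdot : t * (t + a) + u * (u + d) = A + τ * (θ * (2 * u + d)) + τ ^ 2 := by
    rw [ht, ha, hA]; ring
  have hdτ : d * |τ| ≤ e * A := by
    rw [le_div_iff₀ hd0] at h; linarith
  have hτA : |τ| ≤ e * A := by
    nlinarith [abs_nonneg τ]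
  have hlin : |τ * (θ * (2 * u + d))| ≤ e * A * (2 * H) := by
    rw [abs_mul, abs_mul, abs_of_pos (by linarith : 0 < 2 * u + d)]
    calc |τ| * (|θ| * (2 * u + d)) ≤ e * A * (1 * (2 * H)) := by gcongr; linarith
      _ = _ := by ring
  have hlow := (abs_le.1 hlin).1
  have hek : e * (1 + 2 * H * κ) = κ := by rw [he]; field_simp
  have h2He : 0 < 1 - 2 * H * e := by
    have : 1 - 2 * H * e = 1 / (1 + 2 * H * κ) := by rw [he]; field_simp; ring
    rw [this]; positivity
  have hdotlow : A * (1 - 2 * H * e) ≤ A + τ * (θ * (2 * u + d)) + τ ^ 2 := by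
    nlinarith [sq_nonneg τ]
  rw [hcrs, hdot]
  refine ⟨lt_of_lt_of_le (by positivity) hdotlow, ?_⟩
  rw [abs_mul, abs_of_pos hd0]
  refine hdτ.trans (le_trans (le_of_eq ?_) (mul_le_mul_of_nonneg_left hdotlow hκ))
  have : e = κ * (1 - 2 * H * e) := by linarith
  calc e * A = κ * (1 - 2 * H * e) * A := by rw [← this]
    _ = _ := by ring

lemma strip_of_small {κ H t u a d : ℝ} (hκ : 0 ≤ κ) (hd : 1 ≤ d) (hu : 0 < u) (hH : u + d ≤ H)
    (ha1 : -d ≤ a) (ha2 : a ≤ d) (ht1 : |t| ≤ 2 * H) (hHκ : 5 * H * κ < 1)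
    (h : |t * (u + d) - (t + a) * u| ≤ κ * (t * (t + a) + u * (u + d))) :
    |t - a / d * u| ≤ κ / (1 - 5 * H * κ) * (u * (u + d) * (1 + (a / d) ^ 2)) / d := by
  have hd0 : 0 < d := by linarith
  obtain ⟨θ, hθ⟩ : ∃ θ, θ = a / d := ⟨_, rfl⟩
  have ha : a = θ * d := by rw [hθ]; field_simp
  have hθ1 : |θ| ≤ 1 := by
    rw [hθ, abs_div, abs_of_pos hd0]; exact div_le_one_of_le₀ (abs_le.2 ⟨ha1, ha2⟩) hd0.le
  rw [← hθ]
  obtain ⟨τ, hτ⟩ : ∃ τ, τ = t - θ * u := ⟨_, rfl⟩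
  rw [← hτ]
  have ht : t = θ * u + τ := by linarith
  set A := u * (u + d) * (1 + θ ^ 2) with hA
  have hH0 : 0 < H := by linarith
  have hcrs : t * (u + d) - (t + a) * u = d * τ := by rw [ht, ha]; ring
  have hdot : t * (t + a) + u * (u + d) = A + τ * (θ * (2 * u + d)) + τ ^ 2 := by
    rw [ht, ha, hA]; ring
  have hτH : |τ| ≤ 3 * H := by
    rw [hτ]
    calc |t - θ * u| ≤ |t| + |θ * u| := abs_sub _ _
      _ ≤ 2 * H + 1 * H := by
        rw [abs_mul, abs_of_pos hu]; gcongr; linarith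
      _ = _ := by ring
  have hlin : τ * (θ * (2 * u + d)) ≤ |τ| * (2 * H) := by
    refine (le_abs_self _).trans ?_
    rw [abs_mul, abs_mul, abs_of_pos (by linarith : 0 < 2 * u + d)]
    calc |τ| * (|θ| * (2 * u + d)) ≤ |τ| * (1 * (2 * H)) := by gcongr; linarith
      _ = _ := by ring
  have hsq : τ ^ 2 ≤ |τ| * (3 * H) := by
    rw [← sq_abs, sq]; gcongr
  rw [hcrs, hdot, abs_mul, abs_of_pos hd0] at h
  have hden : 0 < 1 - 5 * H * κ := by linarith
  have h1 : d * |τ| ≤ κ * (A + 5 * H * |τ|) :=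
    h.trans (mul_le_mul_of_nonneg_left (by linarith) hκ)
  have h2 : κ * (5 * H * |τ|) ≤ 5 * H * κ * (d * |τ|) := by
    have : |τ| ≤ d * |τ| := by nlinarith [abs_nonneg τ]
    calc κ * (5 * H * |τ|) = 5 * H * κ * |τ| := by ring
      _ ≤ _ := by gcongr
  rw [le_div_iff₀ hd0, div_mul_eq_mul_div, le_div_iff₀ hden]
  nlinarith

lemma ncard_upperPairs_le_stripCount {κ x y : ℝ} {M Q : ℕ} (hκ : 0 ≤ κ) (hx : |x| ≤ M)
    (hy : |y| ≤ M) (hHκ : 5 * (Q + M) * κ < 1) :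
    ((upperPairs κ Q x y).ncard : ℝ) ≤
      stripCount (κ / (1 - 5 * (Q + M) * κ)) (Q + M) x y := by
  obtain ⟨hfin, hcard⟩ := finite_stripPairs_and_stripCount_eq
    (show 0 ≤ κ / (1 - 5 * (Q + M) * κ) from div_nonneg hκ (by linarith)) (Q + M) x y
  rw [hcard]
  have hy1 := (abs_le.1 hy).1
  have hfl : -(M : ℤ) ≤ ⌊y⌋ := Int.le_floor.2 (by push_cast; exact hy1)
  refine Nat.cast_le.2 (Set.ncard_le_ncard ?_ hfin)
  rintro ⟨⟨X, Y⟩, ⟨X', Y'⟩⟩ ⟨⟨⟨h1, h2⟩, ⟨h3, h4⟩, ⟨h5, h6, h7⟩, h8, h9⟩, h10⟩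
  simp only [Set.mem_ofPred_eq] at h1 h2 h3 h4 h5 h6 h7 h8 h9 h10
  have hY' := (abs_le.1 h4).2
  refine ⟨⟨h5, h6, h7⟩, h10, by simp only; push_cast; omega, ?_⟩
  have hd : (1 : ℝ) ≤ ((Y' - Y : ℤ) : ℝ) := by exact_mod_cast h5
  have hY'r : (Y' : ℝ) ≤ Q := by exact_mod_cast hY'
  have e1 : (Y' : ℝ) - y = (Y - y) + ((Y' - Y : ℤ) : ℝ) := by push_cast; ring
  have e2 : (X' : ℝ) - x = (X - x) + ((X' - X : ℤ) : ℝ) := by push_cast; ring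
  have hX : |(X : ℝ)| ≤ Q := by exact_mod_cast h1
  simp only [e1, e2] at h9 ⊢
  refine strip_of_small (H := Q + M) hκ hd (by linarith) (by rw [← e1]; linarith)
    (by exact_mod_cast h6.le) (by exact_mod_cast h7) ?_ hHκ h9
  have : (0 : ℝ) ≤ Q + M := by positivity
  exact (abs_sub _ _).trans (by linarith)

lemma stripCount_le_ncard_upperPairs {κ x y : ℝ} {M Q K n : ℕ} (hκ : 0 ≤ κ) (hx : |x| ≤ M)
    (hy : |y| ≤ M) (hK : 2 * (κ * (n : ℝ) ^ 2) ≤ K) (hn : n + M + K ≤ Q) :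
    stripCount (κ / (1 + 2 * Q * κ)) n x y ≤ (upperPairs κ Q x y).ncard := by
  have hden : 1 ≤ 1 + 2 * Q * κ := by
    have : (0 : ℝ) ≤ 2 * Q * κ := by positivity
    linarith
  have he0 : 0 ≤ κ / (1 + 2 * Q * κ) := by positivity
  have heκ : κ / (1 + 2 * Q * κ) ≤ κ := div_le_self hκ hden
  rw [(finite_stripPairs_and_stripCount_eq he0 n x y).2]
  have hy1 := abs_le.1 hy
  have hx1 := abs_le.1 hx
  have hfl : ⌊y⌋ ≤ (M : ℤ) := Int.floor_le_iff.2 (by push_cast; linarith)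
  refine Nat.cast_le.2 (Set.ncard_le_ncard ?_ (upperPairs_finite _ _ _ _))
  rintro ⟨⟨X, Y⟩, ⟨X', Y'⟩⟩ ⟨⟨h5, h6, h7⟩, h8, h9, h10⟩
  simp only at h5 h6 h7 h8 h9 h10
  have hd : (1 : ℝ) ≤ ((Y' - Y : ℤ) : ℝ) := by exact_mod_cast h5
  have e1 : (Y' : ℝ) - y = (Y - y) + ((Y' - Y : ℤ) : ℝ) := by push_cast; ring
  have e2 : (X' : ℝ) - x = (X - x) + ((X' - X : ℤ) : ℝ) := by push_cast; ring
  have hY'n : (Y' : ℝ) - y ≤ n := by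
    have : (Y' : ℝ) + 1 ≤ ⌊y⌋ + 1 + n := by exact_mod_cast h9
    linarith [Int.floor_le y]
  have hnQ : (n : ℝ) + M + K ≤ Q := by exact_mod_cast hn
  have hK0 : (0 : ℝ) ≤ K := Nat.cast_nonneg _
  have hM0 : (0 : ℝ) ≤ M := Nat.cast_nonneg _
  have ha1 : -((Y' - Y : ℤ) : ℝ) ≤ ((X' - X : ℤ) : ℝ) := by exact_mod_cast h6.le
  have ha2 : ((X' - X : ℤ) : ℝ) ≤ ((Y' - Y : ℤ) : ℝ) := by exact_mod_cast h7
  have hu : 0 < (Y : ℝ) - y := by linarith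
  rw [e1] at hY'n h10
  have hsmall := small_of_strip (H := Q) hκ hd hu (by linarith) ha1 ha2 h10
  obtain ⟨θ, hθ⟩ : ∃ θ, θ = ((X' - X : ℤ) : ℝ) / ((Y' - Y : ℤ) : ℝ) := ⟨_, rfl⟩
  have hθ1 : |θ| ≤ 1 := by
    rw [hθ, abs_div, abs_of_pos (by linarith : (0 : ℝ) < ((Y' - Y : ℤ) : ℝ))]
    exact div_le_one_of_le₀ (abs_le.2 ⟨ha1, ha2⟩) (by linarith)
  rw [← hθ] at h10
  have hτ : |(X : ℝ) - x - θ * (Y - y)| ≤ K := by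
    refine h10.trans ((div_le_self (by positivity) hd).trans (le_trans ?_ hK))
    have : θ ^ 2 ≤ 1 := (sq_le_one_iff_abs_le_one θ).2 hθ1
    calc κ / (1 + 2 * Q * κ) * ((Y - y) * (Y - y + ((Y' - Y : ℤ) : ℝ)) * (1 + θ ^ 2))
        ≤ κ * (n * n * (1 + 1)) := by gcongr; linarith
      _ = _ := by ring
  have hbd : ∀ v : ℝ, 0 ≤ v → v ≤ n → |θ * v| ≤ n := fun v h1 h2 => by
    rw [abs_mul, abs_of_nonneg h1]
    calc |θ| * v ≤ 1 * n := by gcongr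
      _ = n := one_mul _
  have hbox : ∀ z : ℤ, |(z : ℝ)| ≤ Q → |z| ≤ (Q : ℤ) := fun z hz => by exact_mod_cast hz
  have hXb : |(X : ℝ)| ≤ Q := by
    have h1 := abs_le.1 hτ
    have h2 := abs_le.1 (hbd _ hu.le (by linarith))
    rw [abs_le]; constructor <;> linarith
  have hX'b : |(X' : ℝ)| ≤ Q := by
    have h1 := abs_le.1 hτ
    have h2 := abs_le.1 (hbd (Y - y + ((Y' - Y : ℤ) : ℝ)) (by linarith) hY'n)
    have h3 : (X' : ℝ) = X + θ * ((Y' - Y : ℤ) : ℝ) := by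
      rw [hθ, div_mul_cancel₀ _ (by linarith : ((Y' - Y : ℤ) : ℝ) ≠ 0)]; push_cast; ring
    rw [h3, abs_le]; constructor <;> linarith
  have hYb : |(Y : ℝ)| ≤ Q := by rw [abs_le]; constructor <;> linarith
  have hY'b : |(Y' : ℝ)| ≤ Q := by rw [abs_le]; constructor <;> linarith
  refine ⟨⟨⟨hbox _ hXb, hbox _ hYb⟩, ⟨hbox _ hX'b, hbox _ hY'b⟩, ⟨h5, h6, h7⟩, ?_⟩, h8⟩
  unfold IsSmallAt
  simp only [e1, e2]
  exact hsmall

lemma measurableSet_disc (a b r : ℝ) : MeasurableSet (Disc a b r) := by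
  unfold Disc
  exact measurableSet_le (by fun_prop) measurable_const

lemma volume_disc (a b : ℝ) {r : ℝ} (hr : 0 ≤ r) :
    volume (Disc a b r) = ENNReal.ofReal (π * r ^ 2) := by
  rw [← (Complex.volume_preserving_equiv_real_prod).measure_preimage
    (measurableSet_disc a b r).nullMeasurableSet]
  have : Complex.measurableEquivRealProd ⁻¹' Disc a b r = Metric.closedBall ⟨a, b⟩ r := by
    ext z
    simp only [Disc, Set.mem_preimage, Set.mem_ofPred_eq, Complex.measurableEquivRealProd_apply,
      Metric.mem_closedBall, Complex.dist_eq_re_im]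
    rw [Real.sqrt_le_left hr]
  rw [this, Complex.volume_closedBall, mul_comm, ENNReal.ofReal_mul Real.pi_pos.le,
    ENNReal.ofReal_pow hr]
  congr 1
  exact (ENNReal.ofReal_coe_nnreal (p := NNReal.pi)).symm

lemma volume_real_disc (a b : ℝ) {r : ℝ} (hr : 0 ≤ r) :
    volume.real (Disc a b r) = π * r ^ 2 := by
  rw [Measure.real, volume_disc a b hr, ENNReal.toReal_ofReal (by positivity)]

lemma integrableOn_disc_of_bounded {f : ℝ × ℝ → ℝ} (hf : Measurable f) {M : ℝ}
    (hM : ∀ p, |f p| ≤ M) (a b : ℝ) {r : ℝ} (hr : 0 ≤ r) : IntegrableOn f (Disc a b r) := by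
  refine Measure.integrableOn_of_bounded (M := M) ?_ hf.aestronglyMeasurable
    (Filter.Eventually.of_forall hM)
  rw [volume_disc a b hr]
  exact ENNReal.ofReal_ne_top

/-- A function whose average over horizontal segments is close to `K` has integral over a disc
close to `K` times the area. -/
lemma abs_setIntegral_disc_sub_le {f : ℝ × ℝ → ℝ} {a b r K C : ℝ} (hr : 0 ≤ r)
    (hf : IntegrableOn f (Disc a b r))
    (hfi : ∀ y α β, IntervalIntegrable (fun x => f (x, y)) volume α β)
    (h : ∀ y α β, α ≤ β → β - α ≤ 2 * r → |(∫ x in α..β, f (x, y)) - (β - α) * K| ≤ C) :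
    |(∫ p in Disc a b r, f p) - π * r ^ 2 * K| ≤ 2 * r * C := by
  have hC : 0 ≤ C := (abs_nonneg _).trans (h 0 0 0 le_rfl (by linarith))
  have hKi : IntegrableOn (fun _ : ℝ × ℝ => K) (Disc a b r) :=
    integrableOn_disc_of_bounded measurable_const (M := |K|) (fun _ => le_rfl) a b hr
  have hg : Integrable ((Disc a b r).indicator fun p => f p - K) :=
    (integrable_indicator_iff (measurableSet_disc a b r)).2 (hf.sub hKi)
  have e1 : (∫ p in Disc a b r, f p) - π * r ^ 2 * K =
      ∫ y, ∫ x, (Disc a b r).indicator (fun p => f p - K) (x, y) := by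
    rw [← integral_prod_symm _ hg, ← Measure.volume_eq_prod,
      integral_indicator (measurableSet_disc a b r), integral_sub hf hKi, setIntegral_const,
      volume_real_disc a b hr, smul_eq_mul]
  have hinner : ∀ y, |∫ x, (Disc a b r).indicator (fun p => f p - K) (x, y)| ≤ C ∧
      (y ∉ Set.Icc (b - r) (b + r) →
        ∫ x, (Disc a b r).indicator (fun p => f p - K) (x, y) = 0) := by
    intro y
    by_cases hy : y ∈ Set.Icc (b - r) (b + r)
    · refine ⟨?_, fun h => absurd hy h⟩
      set ρ := √(r ^ 2 - (y - b) ^ 2) with hρ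
      have hy2 : (y - b) ^ 2 ≤ r ^ 2 := by
        exact sq_le_sq' (by linarith [hy.1]) (by linarith [hy.2])
      have hρr : ρ ≤ r := by
        rw [hρ, Real.sqrt_le_left hr]; nlinarith [sq_nonneg (y - b)]
      have hρ0 : 0 ≤ ρ := Real.sqrt_nonneg _
      have hind : (fun x => (Disc a b r).indicator (fun p => f p - K) (x, y)) =
          (Set.Icc (a - ρ) (a + ρ)).indicator fun x => f (x, y) - K := by
        ext x
        have : (x, y) ∈ Disc a b r ↔ x ∈ Set.Icc (a - ρ) (a + ρ) := by
          simp only [Disc, Set.mem_ofPred_eq, Set.mem_Icc]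
          rw [← le_sub_iff_add_le, ← Real.sq_sqrt (sub_nonneg.2 hy2), ← hρ, sq_le_sq,
            abs_of_nonneg hρ0, abs_le]
          constructor <;> rintro ⟨h1, h2⟩ <;> constructor <;> linarith
        by_cases hx : x ∈ Set.Icc (a - ρ) (a + ρ)
        · rw [Set.indicator_of_mem hx, Set.indicator_of_mem (this.2 hx)]
        · rw [Set.indicator_of_notMem hx, Set.indicator_of_notMem (mt this.1 hx)]
      rw [hind, integral_indicator measurableSet_Icc, integral_Icc_eq_integral_Ioc,
        ← intervalIntegral.integral_of_le (by linarith),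
        intervalIntegral.integral_sub (hfi _ _ _) intervalIntegrable_const,
        intervalIntegral.integral_const, smul_eq_mul]
      exact h y _ _ (by linarith) (by linarith)
    · have hz : ∫ x, (Disc a b r).indicator (fun p => f p - K) (x, y) = 0 := by
        rw [← integral_zero ℝ ℝ (μ := volume)]
        congr 1
        ext x
        refine Set.indicator_of_notMem (fun hx => hy ?_) _
        have hx' : (y - b) ^ 2 ≤ r ^ 2 := by
          have h1 : (x - a) ^ 2 + (y - b) ^ 2 ≤ r ^ 2 := hx
          nlinarith [sq_nonneg (x - a)]
        have := abs_le_of_sq_le_sq' hx' hr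
        exact ⟨by linarith [this.1], by linarith [this.2]⟩
      exact ⟨by rw [hz, abs_zero]; exact hC, fun _ => hz⟩
  rw [e1, ← setIntegral_eq_integral_of_forall_compl_eq_zero fun y hy => (hinner y).2 hy]
  have := norm_setIntegral_le_of_norm_le_const (μ := volume) (s := Set.Icc (b - r) (b + r))
    (f := fun y => ∫ x, (Disc a b r).indicator (fun p => f p - K) (x, y)) (C := C)
    (by rw [Real.volume_Icc]; exact ENNReal.ofReal_lt_top) (fun y _ => (hinner y).1)
  refine this.trans (le_of_eq ?_)
  rw [Measure.real, Real.volume_Icc, ENNReal.toReal_ofReal (by linarith)]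
  ring

lemma measurable_stripCount (e : ℝ) (n : ℕ) :
    Measurable fun p : ℝ × ℝ => stripCount e n p.1 p.2 := by
  have hfl : Measurable fun p : ℝ × ℝ => ((⌊p.2⌋ : ℤ) : ℝ) :=
    measurable_from_top.comp (Int.measurable_floor.comp measurable_snd)
  unfold stripCount
  refine Finset.measurable_sum _ fun d _ => Finset.measurable_sum _ fun a _ =>
    Finset.measurable_sum _ fun j _ => ?_
  unfold intCount stripWidth
  refine Measurable.add (Measurable.sub (measurable_from_top.comp (Int.measurable_floor.comp ?_))
    (measurable_from_top.comp (Int.measurable_ceil.comp ?_))) measurable_const <;> fun_prop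

lemma floor_add_one_sub_mem (y : ℝ) : 0 ≤ (⌊y⌋ : ℝ) + 1 - y ∧ (⌊y⌋ : ℝ) + 1 - y ≤ 1 :=
  ⟨by linarith [Int.lt_floor_add_one y], by linarith [Int.floor_le y]⟩

lemma exists_abs_stripCount_le {e : ℝ} (he : 0 ≤ e) (n : ℕ) :
    ∃ M, ∀ x y, |stripCount e n x y| ≤ M := by
  refine ⟨∑ d ∈ Finset.range n, ∑ a ∈ Finset.Ioc (-((d + 1 : ℕ) : ℤ)) (d + 1 : ℕ),
    ∑ j ∈ Finset.range (n - (d + 1)), (2 * (2 * (e * n ^ 2)) + 1), fun x y => ?_⟩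
  obtain ⟨hw0, hw1⟩ := floor_add_one_sub_mem y
  unfold stripCount
  refine (Finset.abs_sum_le_sum_abs _ _).trans (Finset.sum_le_sum fun d _ => ?_)
  refine (Finset.abs_sum_le_sum_abs _ _).trans (Finset.sum_le_sum fun a ha => ?_)
  refine (Finset.abs_sum_le_sum_abs _ _).trans (Finset.sum_le_sum fun j hj => ?_)
  rw [Finset.mem_Ioc] at ha
  have h0 := stripWidth_nonneg he hw0 (d + 1) a j
  have h1 := stripWidth_le he hw0 hw1 ha.1.le ha.2 (Finset.mem_range.1 hj)
  have h2 : 2 * (e * (n : ℝ) ^ 2) / (d + 1 : ℕ) ≤ 2 * (e * n ^ 2) :=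
    div_le_self (by positivity) (by push_cast; linarith [(Nat.cast_nonneg d : (0 : ℝ) ≤ d)])
  rw [abs_of_nonneg (intCount_nonneg (by linarith))]
  refine (intCount_le _ _).trans ?_
  linarith

lemma intervalIntegrable_sum {ι : Type*} {s : Finset ι} {f : ι → ℝ → ℝ} {α β : ℝ}
    (h : ∀ i ∈ s, IntervalIntegrable (f i) volume α β) :
    IntervalIntegrable (fun x => ∑ i ∈ s, f i x) volume α β := by
  simpa only [Finset.sum_fn] using IntervalIntegrable.sum s h

/-- Averaging the strip count over a disc of given radius. -/
lemma abs_integral_stripCount_sub_le (E₀ : ℝ) {r : ℝ} (hr : 0 ≤ r) : ∃ C : ℝ, 0 ≤ C ∧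
    ∀ (a b e : ℝ) (n : ℕ), 0 ≤ e → 0 < n → e * (n : ℝ) ^ 2 ≤ E₀ →
      |(∫ p in Disc a b r, stripCount e n p.1 p.2) - π * r ^ 2 * (2 / 3 * e * (n : ℝ) ^ 4)| ≤
        C * (n : ℝ) ^ (15 / 8 : ℝ) := by
  obtain ⟨C, hC, key⟩ := abs_sum_integral_strip_sub_le (2 * r) E₀
  refine ⟨2 * r * C, by positivity, fun a b e n he hn hE => ?_⟩
  obtain ⟨M, hM⟩ := exists_abs_stripCount_le he n
  have hii : ∀ (y α β : ℝ) (d : ℕ) (a : ℤ) (j : ℕ), IntervalIntegrable (fun x : ℝ =>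
      intCount (x + a / (d + 1 : ℕ) * (⌊y⌋ + 1 - y + j) - stripWidth e (⌊y⌋ + 1 - y) (d + 1) a j)
        (x + a / (d + 1 : ℕ) * (⌊y⌋ + 1 - y + j) + stripWidth e (⌊y⌋ + 1 - y) (d + 1) a j))
      volume α β := fun y α β d a j =>
    intervalIntegrable_intCount _ _ (fun _ _ h => by linarith)
      (fun _ _ h => by linarith) _ _
  rw [mul_assoc (2 * r)]
  refine abs_setIntegral_disc_sub_le hr
    (integrableOn_disc_of_bounded (measurable_stripCount e n) (fun p => hM _ _) a b hr) ?_ ?_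
  · intro y α β
    unfold stripCount
    exact intervalIntegrable_sum fun d _ => intervalIntegrable_sum fun a _ =>
      intervalIntegrable_sum fun j _ => hii y α β d a j
  · intro y α β hαβ hL
    obtain ⟨hw0, hw1⟩ := floor_add_one_sub_mem y
    refine le_trans (le_of_eq ?_) (key e _ α β n he hw0 hw1 hαβ hL hn hE)
    congr 2
    simp only [stripCount]
    rw [intervalIntegral.integral_finsetSum fun d _ => intervalIntegrable_sum fun a _ =>
      intervalIntegrable_sum fun j _ => hii y α β d a j]
    refine Finset.sum_congr rfl fun d _ => ?_
    rw [intervalIntegral.integral_finsetSum fun a _ =>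
      intervalIntegrable_sum fun j _ => hii y α β d a j]
    refine Finset.sum_congr rfl fun a _ => ?_
    rw [intervalIntegral.integral_finsetSum fun j _ => hii y α β d a j]

lemma measurable_ncard_upperPairs (κ : ℝ) (Q : ℕ) :
    Measurable fun p : ℝ × ℝ => ((upperPairs κ Q p.1 p.2).ncard : ℝ) := by
  classical
  let B : Finset (ℤ × ℤ) := Finset.Icc (-(Q : ℤ)) Q ×ˢ Finset.Icc (-(Q : ℤ)) Q
  let φ : (ℤ × ℤ) × (ℤ × ℤ) → Set (ℝ × ℝ) := fun pp =>
    {p | InSector (pp.2.1 - pp.1.1) (pp.2.2 - pp.1.2) ∧ IsSmallAt κ p.1 p.2 pp.1 pp.2 ∧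
      p.2 < pp.1.2}
  have e : (fun p : ℝ × ℝ => ((upperPairs κ Q p.1 p.2).ncard : ℝ)) =
      fun p => ∑ pp ∈ B ×ˢ B, (φ pp).indicator (fun _ => (1 : ℝ)) p := by
    ext p
    have : upperPairs κ Q p.1 p.2 = ↑((B ×ˢ B).filter fun pp => p ∈ φ pp) := by
      ext pp
      simp only [upperPairs, smallPairs, box_eq, Set.mem_inter_iff, Set.mem_ofPred_eq,
        Finset.coe_filter, Finset.mem_product, Finset.mem_coe, φ, B]
      tauto
    rw [this, Set.ncard_coe_finset, Finset.card_filter]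
    push_cast
    refine Finset.sum_congr rfl fun pp _ => ?_
    rw [Set.indicator_apply]
  rw [e]
  refine Finset.measurable_sum _ fun pp _ => measurable_const.indicator ?_
  have h1 : MeasurableSet {p : ℝ × ℝ | 0 < (pp.1.1 - p.1) * (pp.2.1 - p.1) +
      (pp.1.2 - p.2) * (pp.2.2 - p.2)} := measurableSet_lt measurable_const (by fun_prop)
  have h2 : MeasurableSet {p : ℝ × ℝ | |(pp.1.1 - p.1) * (pp.2.2 - p.2) -
      (pp.2.1 - p.1) * (pp.1.2 - p.2)| ≤ κ * ((pp.1.1 - p.1) * (pp.2.1 - p.1) +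
      (pp.1.2 - p.2) * (pp.2.2 - p.2))} := measurableSet_le (by fun_prop) (by fun_prop)
  have h3 : MeasurableSet {p : ℝ × ℝ | p.2 < pp.1.2} :=
    measurableSet_lt measurable_snd measurable_const
  exact (MeasurableSet.const _).inter ((h1.inter h2).inter h3)

lemma exists_ncard_upperPairs_le (κ : ℝ) (Q : ℕ) :
    ∃ M : ℝ, ∀ x y, |((upperPairs κ Q x y).ncard : ℝ)| ≤ M := by
  refine ⟨((Box Q ×ˢ Box Q).ncard : ℝ), fun x y => ?_⟩
  rw [Nat.abs_cast]
  exact Nat.cast_le.2 (Set.ncard_le_ncard (fun _ h => ⟨h.1.1, h.1.2.1⟩)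
    ((box_finite Q).prod (box_finite Q)))

lemma integrableOn_upperPairs (κ : ℝ) (Q : ℕ) (a b : ℝ) {r : ℝ} (hr : 0 ≤ r) :
    IntegrableOn (fun p : ℝ × ℝ => ((upperPairs κ Q p.1 p.2).ncard : ℝ)) (Disc a b r) := by
  obtain ⟨M, hM⟩ := exists_ncard_upperPairs_le κ Q
  exact integrableOn_disc_of_bounded (measurable_ncard_upperPairs κ Q) (fun p => hM _ _) a b hr

lemma integrableOn_stripCount {e : ℝ} (he : 0 ≤ e) (n : ℕ) (a b : ℝ) {r : ℝ} (hr : 0 ≤ r) :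
    IntegrableOn (fun p : ℝ × ℝ => stripCount e n p.1 p.2) (Disc a b r) := by
  obtain ⟨M, hM⟩ := exists_abs_stripCount_le he n
  exact integrableOn_disc_of_bounded (measurable_stripCount e n) (fun p => hM _ _) a b hr

/-- The quarter turn of the plane. -/
def quarterTurn : ℝ × ℝ ≃ᵐ ℝ × ℝ :=
  MeasurableEquiv.prodComm.trans ((MeasurableEquiv.neg ℝ).prodCongr (MeasurableEquiv.refl ℝ))

lemma quarterTurn_apply (p : ℝ × ℝ) : quarterTurn p = (-p.2, p.1) := rfl

lemma measurePreserving_quarterTurn : MeasurePreserving quarterTurn := by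
  have h1 : MeasurePreserving (Prod.swap : ℝ × ℝ → ℝ × ℝ) := Measure.measurePreserving_swap
  have h2 : MeasurePreserving (Prod.map (Neg.neg : ℝ → ℝ) (id : ℝ → ℝ)) :=
    (Measure.measurePreserving_neg (volume : Measure ℝ)).prod (MeasurePreserving.id volume)
  exact h2.comp h1

lemma preimage_quarterTurn_disc (a b r : ℝ) :
    quarterTurn ⁻¹' Disc (-b) a r = Disc a b r := by
  ext p
  simp only [Disc, Set.mem_preimage, quarterTurn_apply, Set.mem_ofPred_eq]
  rw [show (-p.2 - -b) ^ 2 + (p.1 - a) ^ 2 = (p.1 - a) ^ 2 + (p.2 - b) ^ 2 by ring]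

lemma setIntegral_disc_rot (g : ℝ × ℝ → ℝ) (a b r : ℝ) :
    ∫ p in Disc a b r, g (-p.2, p.1) = ∫ p in Disc (-b) a r, g p := by
  rw [← preimage_quarterTurn_disc]
  exact measurePreserving_quarterTurn.setIntegral_preimage_emb quarterTurn.measurableEmbedding g _

lemma integrableOn_disc_rot {g : ℝ × ℝ → ℝ} {a b r : ℝ} (hg : IntegrableOn g (Disc (-b) a r)) :
    IntegrableOn (fun p : ℝ × ℝ => g (-p.2, p.1)) (Disc a b r) := by
  rw [← preimage_quarterTurn_disc]
  exact (measurePreserving_quarterTurn.integrableOn_comp_preimage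
    quarterTurn.measurableEmbedding).2 hg

lemma tan_le_add_pow_three {ε : ℝ} (h0 : 0 ≤ ε) (h1 : ε ≤ 1) : tan ε ≤ ε + ε ^ 3 := by
  have hc := Real.one_sub_sq_div_two_le_cos (x := ε)
  have hε2 : ε ^ 2 ≤ 1 := pow_le_one₀ h0 h1
  have hcp : 0 < cos ε := by linarith
  rw [tan_eq_sin_div_cos, div_le_iff₀ hcp]
  refine (sin_le h0).trans ?_
  have : 0 ≤ ε + ε ^ 3 := by positivity
  have h2 := mul_le_mul_of_nonneg_left hc this
  have h3 : ε ^ 5 ≤ ε ^ 3 := pow_le_pow_of_le_one h0 h1 (by norm_num)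
  nlinarith

lemma abs_mul_pow_four_sub_le {e ε c K B n q : ℝ} (hn0 : 0 ≤ n) (hq : 1 ≤ q) (hε0 : 0 ≤ ε)
    (hε : ε ≤ c / q ^ 2) (he : |e - ε| ≤ K / q ^ 3) (hn : |n - q| ≤ B) (hnq : n ≤ 2 * q) :
    |e * n ^ 4 - ε * q ^ 4| ≤ (16 * K + 15 * c * B) * q := by
  have hq0 : 0 < q := by linarith
  have hB : 0 ≤ B := (abs_nonneg _).trans hn
  have hK : 0 ≤ K := by
    have := (abs_nonneg _).trans he
    rwa [le_div_iff₀ (by positivity), zero_mul] at this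
  have hc : 0 ≤ c := by
    have := hε0.trans hε
    rwa [le_div_iff₀ (by positivity), zero_mul] at this
  have e1 : e * n ^ 4 - ε * q ^ 4 =
      (e - ε) * n ^ 4 + ε * ((n - q) * ((n + q) * (n ^ 2 + q ^ 2))) := by
    ring
  have h1 : |(e - ε) * n ^ 4| ≤ 16 * K * q := by
    rw [abs_mul, abs_of_nonneg (by positivity : 0 ≤ n ^ 4)]
    calc |e - ε| * n ^ 4 ≤ K / q ^ 3 * (2 * q) ^ 4 := by gcongr
      _ = 16 * K * q := by field_simp; ring
  have h2 : |ε * ((n - q) * ((n + q) * (n ^ 2 + q ^ 2)))| ≤ 15 * c * B * q := by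
    rw [abs_mul, abs_mul, abs_of_nonneg hε0,
      abs_of_nonneg (by positivity : 0 ≤ (n + q) * (n ^ 2 + q ^ 2))]
    calc ε * (|n - q| * ((n + q) * (n ^ 2 + q ^ 2)))
        ≤ c / q ^ 2 * (B * ((2 * q + q) * ((2 * q) ^ 2 + q ^ 2))) := by gcongr
      _ = 15 * c * B * q := by field_simp; ring
  rw [e1]
  refine (abs_add_le _ _).trans ?_
  linarith

/-- Perturbed form of the averaged strip count. -/
lemma abs_integral_stripCount_perturbed_sub_le (E₀ c K B : ℝ) {r : ℝ} (hr : 0 ≤ r) :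
    ∃ C : ℝ, 0 ≤ C ∧ ∀ (a b e ε : ℝ) (n Q : ℕ), 0 ≤ e → 0 < n → 1 ≤ Q → 0 ≤ ε →
      ε ≤ c / (Q : ℝ) ^ 2 → |e - ε| ≤ K / (Q : ℝ) ^ 3 → |(n : ℝ) - Q| ≤ B → (n : ℝ) ≤ 2 * Q →
      e * (n : ℝ) ^ 2 ≤ E₀ →
      |(∫ p in Disc a b r, stripCount e n p.1 p.2) - π * r ^ 2 * (2 / 3 * ε * (Q : ℝ) ^ 4)| ≤
        C * (Q : ℝ) ^ (15 / 8 : ℝ) := by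
  obtain ⟨C, hC, key⟩ := abs_integral_stripCount_sub_le E₀ hr
  refine ⟨C * 2 ^ (15 / 8 : ℝ) + π * r ^ 2 * (2 / 3 * |16 * K + 15 * c * B|), by positivity, ?_⟩
  intro a b e ε n Q he hn hQ hε0 hε heε hnB hnQ hE
  have hQ1 : (1 : ℝ) ≤ Q := by exact_mod_cast hQ
  have h1 := key a b e n he hn hE
  have h2 := abs_mul_pow_four_sub_le (Nat.cast_nonneg n) hQ1 hε0 hε heε hnB hnQ
  have h3 : (n : ℝ) ^ (15 / 8 : ℝ) ≤ 2 ^ (15 / 8 : ℝ) * (Q : ℝ) ^ (15 / 8 : ℝ) := by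
    rw [← Real.mul_rpow (by norm_num) (by positivity)]
    gcongr
  have h4 : (Q : ℝ) ≤ (Q : ℝ) ^ (15 / 8 : ℝ) :=
    Real.self_le_rpow_of_one_le hQ1 (by norm_num)
  have h5 : |π * r ^ 2 * (2 / 3 * e * (n : ℝ) ^ 4) - π * r ^ 2 * (2 / 3 * ε * (Q : ℝ) ^ 4)| ≤
      π * r ^ 2 * (2 / 3 * |16 * K + 15 * c * B|) * (Q : ℝ) ^ (15 / 8 : ℝ) := by
    rw [show π * r ^ 2 * (2 / 3 * e * (n : ℝ) ^ 4) - π * r ^ 2 * (2 / 3 * ε * (Q : ℝ) ^ 4) =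
      π * r ^ 2 * (2 / 3) * (e * (n : ℝ) ^ 4 - ε * (Q : ℝ) ^ 4) by ring, abs_mul,
      abs_of_nonneg (by positivity : 0 ≤ π * r ^ 2 * (2 / 3))]
    calc π * r ^ 2 * (2 / 3) * |e * (n : ℝ) ^ 4 - ε * (Q : ℝ) ^ 4|
        ≤ π * r ^ 2 * (2 / 3) * (|16 * K + 15 * c * B| * (Q : ℝ) ^ (15 / 8 : ℝ)) := by
          gcongr
          exact h2.trans (mul_le_mul (le_abs_self _) h4 (by positivity) (abs_nonneg _))
      _ = _ := by ring
  refine (abs_sub_le _ (π * r ^ 2 * (2 / 3 * e * (n : ℝ) ^ 4)) _).trans ?_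
  have h6 := mul_le_mul_of_nonneg_left h3 hC
  linarith

/-- Numerical facts about `ε = 2πλ/(2Q+1)²` and its tangent. -/
lemma tan_angle_bounds {lam : ℝ} (hlam : 0 < lam) {Q : ℕ} (hQ1 : 1 ≤ Q)
    (hQ : 40 * (π * lam / 2) ≤ Q) :
    0 < 2 * π * lam / (2 * (Q : ℝ) + 1) ^ 2 ∧ 2 * π * lam / (2 * (Q : ℝ) + 1) ^ 2 ≤ 1 ∧
      2 * π * lam / (2 * (Q : ℝ) + 1) ^ 2 ≤ π * lam / 2 / (Q : ℝ) ^ 2 ∧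
      0 ≤ tan (2 * π * lam / (2 * (Q : ℝ) + 1) ^ 2) ∧
      tan (2 * π * lam / (2 * (Q : ℝ) + 1) ^ 2) ≤ 2 * (π * lam / 2) / (Q : ℝ) ^ 2 ∧
      |tan (2 * π * lam / (2 * (Q : ℝ) + 1) ^ 2) - 2 * π * lam / (2 * (Q : ℝ) + 1) ^ 2| ≤
        (π * lam / 2) ^ 3 / (Q : ℝ) ^ 3 := by
  have hpi := Real.pi_pos
  obtain ⟨c, hc⟩ : ∃ c, c = π * lam / 2 := ⟨_, rfl⟩
  obtain ⟨ε, hε⟩ : ∃ ε, ε = 2 * π * lam / (2 * (Q : ℝ) + 1) ^ 2 := ⟨_, rfl⟩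
  have hq : (1 : ℝ) ≤ Q := by exact_mod_cast hQ1
  have hc0 : 0 < c := by rw [hc]; positivity
  have hε0 : 0 < ε := by rw [hε]; positivity
  rw [← hε, ← hc]
  rw [← hc] at hQ
  have h1 : ε ≤ c / (Q : ℝ) ^ 2 := by
    rw [show c / (Q : ℝ) ^ 2 = 2 * π * lam / (2 * (Q : ℝ)) ^ 2 by rw [hc]; field_simp, hε]
    gcongr
    linarith
  have h2 : c / (Q : ℝ) ^ 2 ≤ 1 := by
    rw [div_le_one (by positivity)]; nlinarith
  have hε1 := h1.trans h2
  have ht := tan_le_add_pow_three hε0.le hε1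
  have ht0 : ε ≤ tan ε := le_tan hε0.le (by linarith [Real.pi_gt_three])
  have h3 : ε ^ 3 ≤ ε := by
    calc ε ^ 3 ≤ ε ^ 1 := pow_le_pow_of_le_one hε0.le hε1 (by norm_num)
      _ = ε := pow_one _
  refine ⟨hε0, hε1, h1, by linarith, ?_, ?_⟩
  · rw [mul_div_assoc]; linarith
  · rw [abs_of_nonneg (by linarith)]
    calc tan ε - ε ≤ ε ^ 3 := by linarith
      _ ≤ (c / (Q : ℝ) ^ 2) ^ 3 := by gcongr
      _ = c ^ 3 / ((Q : ℝ) ^ 3 * (Q : ℝ) ^ 3) := by rw [div_pow]; ring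
      _ ≤ c ^ 3 / ((Q : ℝ) ^ 3 * 1) := by
          gcongr; exact one_le_pow₀ hq
      _ = _ := by rw [mul_one]

lemma abs_le_of_mem_disc {a b r : ℝ} (hr : 0 ≤ r) (ha : |a| ≤ 1) (hb : |b| ≤ 1) {p : ℝ × ℝ}
    (hp : p ∈ Disc a b r) : |p.1| ≤ 1 + r ∧ |p.2| ≤ 1 + r := by
  have hp' : (p.1 - a) ^ 2 + (p.2 - b) ^ 2 ≤ r ^ 2 := hp
  have h1 := abs_le_of_sq_le_sq' (by nlinarith [sq_nonneg (p.2 - b)] : (p.1 - a) ^ 2 ≤ r ^ 2) hr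
  have h2 := abs_le_of_sq_le_sq' (by nlinarith [sq_nonneg (p.1 - a)] : (p.2 - b) ^ 2 ≤ r ^ 2) hr
  rw [abs_le] at ha hb
  constructor <;> rw [abs_le] <;> constructor <;> linarith [h1.1, h1.2, h2.1, h2.2]

/-- Averaging the number of upper pairs over a disc. -/
lemma abs_integral_upperPairs_sub_le {lam r : ℝ} (hlam : 0 < lam) (hr : 0 ≤ r) :
    ∃ (C : ℝ) (Q₀ : ℕ), 0 ≤ C ∧ ∀ Q : ℕ, Q₀ ≤ Q → ∀ a b : ℝ, |a| ≤ 1 → |b| ≤ 1 →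
      |(∫ p in Disc a b r,
          ((upperPairs (tan (2 * π * lam / (2 * (Q : ℝ) + 1) ^ 2)) Q p.1 p.2).ncard : ℝ)) -
        π * r ^ 2 * (2 / 3 * (2 * π * lam / (2 * (Q : ℝ) + 1) ^ 2) * (Q : ℝ) ^ 4)| ≤
        C * (Q : ℝ) ^ (15 / 8 : ℝ) := by
  have hpi := Real.pi_pos
  obtain ⟨c, hc⟩ : ∃ c, c = π * lam / 2 := ⟨_, rfl⟩
  have hc0 : 0 < c := by rw [hc]; positivity
  obtain ⟨M, hM⟩ := exists_nat_ge (1 + r)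
  obtain ⟨K, hK⟩ := exists_nat_ge (4 * c)
  obtain ⟨N, hN⟩ := exists_nat_ge (40 * c)
  obtain ⟨C, hC, key⟩ := abs_integral_stripCount_perturbed_sub_le (16 * c) c
    (80 * c ^ 2 + c ^ 3) (M + K) hr
  refine ⟨C, N + M + K + 1, hC, fun Q hQ a b ha hb => ?_⟩
  have hQ1 : 1 ≤ Q := by omega
  have hQN : (N : ℝ) ≤ Q := by exact_mod_cast (by omega : N ≤ Q)
  have hQM : (M : ℝ) ≤ Q := by exact_mod_cast (by omega : M ≤ Q)
  obtain ⟨hε0, hε1, hεc, hκ0, hκc, hκε⟩ := tan_angle_bounds hlam hQ1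
    (by rw [← hc]; exact hN.trans hQN)
  rw [← hc] at hεc hκc hκε
  set ε := 2 * π * lam / (2 * (Q : ℝ) + 1) ^ 2
  set κ := tan ε
  set q : ℝ := (Q : ℝ)
  have hq : 1 ≤ q := Nat.one_le_cast.2 hQ1
  have hq0 : 0 < q := by linarith
  have hM0 : (0 : ℝ) ≤ M := Nat.cast_nonneg _
  have hK0 : (0 : ℝ) ≤ K := Nat.cast_nonneg _
  have hκq : κ * q ^ 2 ≤ 2 * c := by rwa [le_div_iff₀ (by positivity)] at hκc
  have hκ2 : q * κ ^ 2 ≤ 4 * c ^ 2 / q ^ 3 := by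
    calc q * κ ^ 2 ≤ q * (2 * c / q ^ 2) ^ 2 := by gcongr
      _ = _ := by field_simp; ring
  have hHκ : 5 * (q + M) * κ ≤ 1 / 2 := by
    calc 5 * (q + M) * κ ≤ 5 * (q + q) * (2 * c / q ^ 2) := by gcongr
      _ = 20 * c / q := by field_simp; ring
      _ ≤ 1 / 2 := by rw [div_le_iff₀ hq0]; linarith
  have hsub : ∀ p ∈ Disc a b r, |p.1| ≤ M ∧ |p.2| ≤ M := fun p hp =>
    ⟨(abs_le_of_mem_disc hr ha hb hp).1.trans hM, (abs_le_of_mem_disc hr ha hb hp).2.trans hM⟩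
  have hκε' := abs_le.1 hκε
  have hcq : 0 ≤ c ^ 2 / q ^ 3 := by positivity
  have hsplit : (80 * c ^ 2 + c ^ 3) / q ^ 3 = 80 * (c ^ 2 / q ^ 3) + c ^ 3 / q ^ 3 := by ring
  have hκ2' : q * κ ^ 2 ≤ 4 * (c ^ 2 / q ^ 3) := by rwa [← mul_div_assoc]
  have hup : (∫ p in Disc a b r, ((upperPairs κ Q p.1 p.2).ncard : ℝ)) ≤
      π * r ^ 2 * (2 / 3 * ε * q ^ 4) + C * q ^ (15 / 8 : ℝ) := by
    have hden : 1 / 2 ≤ 1 - 5 * (q + M) * κ := by linarith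
    set e := κ / (1 - 5 * (q + M) * κ) with he
    have he0 : 0 ≤ e := div_nonneg hκ0 (by linarith)
    have heκ : e - κ = 5 * (q + M) * κ * e := by
      have hek : e * (1 - 5 * (q + M) * κ) = κ := div_mul_cancel₀ _ (by linarith)
      linarith
    have he2 : e ≤ 2 * κ := by
      rw [he, div_le_iff₀ (by linarith)]; nlinarith
    have hd1 : e - κ ≤ 20 * (q * κ ^ 2) := by
      rw [heκ]
      calc 5 * (q + M) * κ * e ≤ 5 * (q + q) * κ * (2 * κ) := by gcongr
        _ = _ := by ring
    have hd0 : 0 ≤ e - κ := by rw [heκ]; positivity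
    have h := key a b e ε (Q + M) Q he0 (by omega) hQ1 hε0.le hεc
      (by rw [hsplit, abs_le]; constructor <;> linarith)
      (by push_cast; rw [add_sub_cancel_left, abs_of_nonneg hM0]; linarith)
      (by push_cast; linarith)
      (by
        push_cast
        calc e * (q + M) ^ 2 ≤ 2 * κ * (q + q) ^ 2 := by gcongr
          _ = 8 * (κ * q ^ 2) := by ring
          _ ≤ 16 * c := by linarith)
    have h' := setIntegral_mono_on (integrableOn_upperPairs κ Q a b hr)
      (integrableOn_stripCount he0 (Q + M) a b hr) (measurableSet_disc a b r)
      fun p hp => ncard_upperPairs_le_stripCount hκ0 (hsub p hp).1 (hsub p hp).2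
        (by linarith : 5 * (q + M) * κ < 1)
    linarith [(abs_le.1 h).2]
  have hlow : π * r ^ 2 * (2 / 3 * ε * q ^ 4) - C * q ^ (15 / 8 : ℝ) ≤
      ∫ p in Disc a b r, ((upperPairs κ Q p.1 p.2).ncard : ℝ) := by
    obtain ⟨n, hn⟩ : ∃ n, Q = n + M + K := ⟨Q - M - K, by omega⟩
    have hnq : (n : ℝ) = q - M - K := by
      have : (Q : ℝ) = ((n + M + K : ℕ) : ℝ) := congrArg Nat.cast hn
      push_cast at this
      linarith
    have hnle : (n : ℝ) ≤ q := by linarith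
    have hκn : κ * (n : ℝ) ^ 2 ≤ 2 * c := le_trans (by gcongr) hκq
    have hpos : 0 ≤ 2 * q * κ := by positivity
    set e := κ / (1 + 2 * q * κ) with he
    have he0 : 0 ≤ e := by positivity
    have heκ : e ≤ κ := div_le_self hκ0 (by linarith)
    have heκ' : κ - e = 2 * q * κ * e := by
      rw [he]; field_simp; ring
    have hd1 : κ - e ≤ 2 * (q * κ ^ 2) := by
      rw [heκ']
      calc 2 * q * κ * e ≤ 2 * q * κ * κ := by gcongr
        _ = _ := by ring
    have h := key a b e ε n Q he0 (by omega) hQ1 hε0.le hεc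
      (by rw [hsplit, abs_le]; constructor <;> linarith)
      (by
        rw [hnq, abs_le]; constructor <;> linarith)
      (by linarith)
      (by
        calc e * (n : ℝ) ^ 2 ≤ κ * (n : ℝ) ^ 2 := by gcongr
          _ ≤ 16 * c := by linarith)
    have h' := setIntegral_mono_on (integrableOn_stripCount he0 n a b hr)
      (integrableOn_upperPairs κ Q a b hr) (measurableSet_disc a b r)
      fun p hp => stripCount_le_ncard_upperPairs (K := K) hκ0 (hsub p hp).1 (hsub p hp).2
        (by linarith) hn.ge
    linarith [(abs_le.1 h).1]
  rw [abs_le]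
  constructor <;> linarith

lemma R2pt_eq_sum_upperPairs {lam x y : ℝ} {M Q : ℕ} (hlam : 0 < lam) (hQ1 : 1 ≤ Q)
    (hQ : 40 * (π * lam / 2) ≤ Q) (hMQ : M ≤ Q) (hx : |x| ≤ M) (hy : |y| ≤ M) :
    R2pt x y Q lam = 2 / (2 * (Q : ℝ) + 1) ^ 2 *
      (((upperPairs (tan (2 * π * lam / (2 * (Q : ℝ) + 1) ^ 2)) Q x y).ncard : ℝ) +
        (upperPairs (tan (2 * π * lam / (2 * (Q : ℝ) + 1) ^ 2)) Q (-y) x).ncard +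
        (upperPairs (tan (2 * π * lam / (2 * (Q : ℝ) + 1) ^ 2)) Q (-x) (-y)).ncard +
        (upperPairs (tan (2 * π * lam / (2 * (Q : ℝ) + 1) ^ 2)) Q y (-x)).ncard) := by
  obtain ⟨hε0, hε1, -, hκ0, hκc, -⟩ := tan_angle_bounds hlam hQ1 hQ
  have hq : (1 : ℝ) ≤ Q := by exact_mod_cast hQ1
  have hMq : (M : ℝ) ≤ Q := by exact_mod_cast hMQ
  rw [R2pt_eq hlam (by linarith [Real.pi_gt_three])]
  set κ := tan (2 * π * lam / (2 * (Q : ℝ) + 1) ^ 2)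
  have hH : κ * (Q + M) < 1 := by
    calc κ * (Q + M) ≤ 2 * (π * lam / 2) / (Q : ℝ) ^ 2 * (Q + Q) := by gcongr
      _ = 4 * (π * lam / 2) / Q := by field_simp; ring
      _ < 1 := by
        rw [div_lt_one (by linarith)]
        have : 0 < π * lam / 2 := by positivity
        linarith
  have hx' : |-x| ≤ M := by rwa [abs_neg]
  have hy' : |-y| ≤ M := by rwa [abs_neg]
  rw [ncard_smallPairs_ne, ncard_smallPairs_sector hκ0 hx hH, ncard_smallPairs_sector hκ0 hy' hH,
    ncard_smallPairs_sector hκ0 hx' hH, ncard_smallPairs_sector hκ0 hy hH]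
  simp only [neg_neg]
  push_cast
  ring

lemma abs_pow_four_div_sub_le {q : ℝ} (hq : 1 ≤ q) :
    |q ^ 4 / (2 * q + 1) ^ 4 - 1 / 16| ≤ 1 / q := by
  have e1 : q ^ 4 / (2 * q + 1) ^ 4 - 1 / 16 =
      -((32 * q ^ 3 + 24 * q ^ 2 + 8 * q + 1) / (16 * (2 * q + 1) ^ 4)) := by
    field_simp; ring
  rw [e1, abs_neg, abs_of_nonneg (by positivity), div_le_div_iff₀ (by positivity) (by linarith)]
  have : 0 ≤ q ^ 2 := sq_nonneg q
  have h3 : 0 ≤ q ^ 3 := by positivity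
  have h4 : 0 ≤ q ^ 4 := by positivity
  nlinarith

/-- The averaged pair correlation for large boxes. -/
lemma abs_R2avg_sub_le {x0 y0 r0 lam : ℝ} (hx0 : |x0| ≤ 1) (hy0 : |y0| ≤ 1) (hr0 : 0 < r0)
    (hlam : 0 < lam) : ∃ (C : ℝ) (Q₀ : ℕ), 0 ≤ C ∧ 1 ≤ Q₀ ∧ ∀ Q : ℕ, Q₀ ≤ Q →
      |R2avg x0 y0 r0 Q lam - 2 * π * lam / 3| ≤ C * (Q : ℝ) ^ (-(1 / 8) : ℝ) := by
  have hpi := Real.pi_pos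
  obtain ⟨C, Q₀, hC, key⟩ := abs_integral_upperPairs_sub_le hlam hr0.le
  obtain ⟨M, hM⟩ := exists_nat_ge (1 + r0)
  obtain ⟨N, hN⟩ := exists_nat_ge (40 * (π * lam / 2))
  refine ⟨2 * C / (π * r0 ^ 2) + 32 / 3 * π * lam, Q₀ + M + N + 1, by positivity, by omega,
    fun Q hQ => ?_⟩
  have hQ1 : 1 ≤ Q := by omega
  have hq : (1 : ℝ) ≤ Q := by exact_mod_cast hQ1
  have hq0 : (0 : ℝ) < Q := by linarith
  have hQN : 40 * (π * lam / 2) ≤ Q := hN.trans (by exact_mod_cast (by omega : N ≤ Q))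
  set g : ℝ × ℝ → ℝ := fun p =>
    ((upperPairs (tan (2 * π * lam / (2 * (Q : ℝ) + 1) ^ 2)) Q p.1 p.2).ncard : ℝ) with hg
  have hgi : ∀ a b, IntegrableOn g (Disc a b r0) := fun a b =>
    integrableOn_upperPairs _ Q a b hr0.le
  have i1 : IntegrableOn (fun p : ℝ × ℝ => g (-p.2, p.1)) (Disc x0 y0 r0) :=
    integrableOn_disc_rot (hgi _ _)
  have i2 : IntegrableOn (fun p : ℝ × ℝ => g (-p.1, -p.2)) (Disc x0 y0 r0) :=
    integrableOn_disc_rot (g := fun p : ℝ × ℝ => g (-p.2, p.1)) (integrableOn_disc_rot (hgi _ _))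
  have i3 : IntegrableOn (fun p : ℝ × ℝ => g (p.2, -p.1)) (Disc x0 y0 r0) := by
    simpa only [neg_neg] using
      integrableOn_disc_rot (g := fun p : ℝ × ℝ => g (-p.1, -p.2)) (a := x0) (b := y0) (r := r0)
      (integrableOn_disc_rot (g := fun p : ℝ × ℝ => g (-p.2, p.1))
        (integrableOn_disc_rot (hgi _ _)))
  have j1 : ∫ p in Disc x0 y0 r0, g (-p.2, p.1) = ∫ p in Disc (-y0) x0 r0, g p :=
    setIntegral_disc_rot g _ _ _
  have j2 : ∫ p in Disc x0 y0 r0, g (-p.1, -p.2) = ∫ p in Disc (-x0) (-y0) r0, g p :=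
    (setIntegral_disc_rot (fun p : ℝ × ℝ => g (-p.2, p.1)) _ _ _).trans
      (setIntegral_disc_rot g _ _ _)
  have j3 : ∫ p in Disc x0 y0 r0, g (p.2, -p.1) = ∫ p in Disc y0 (-x0) r0, g p := by
    have h := (setIntegral_disc_rot (fun p : ℝ × ℝ => g (-p.1, -p.2)) x0 y0 r0).trans
      ((setIntegral_disc_rot (fun p : ℝ × ℝ => g (-p.2, p.1)) _ _ _).trans
        (setIntegral_disc_rot g _ _ _))
    simpa only [neg_neg] using h
  have i01 : IntegrableOn (fun p => g p + g (-p.2, p.1)) (Disc x0 y0 r0) := (hgi _ _).add i1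
  have i012 : IntegrableOn (fun p => g p + g (-p.2, p.1) + g (-p.1, -p.2)) (Disc x0 y0 r0) :=
    i01.add i2
  have hR : ∫ p in Disc x0 y0 r0, R2pt p.1 p.2 Q lam = 2 / (2 * (Q : ℝ) + 1) ^ 2 *
      ((∫ p in Disc x0 y0 r0, g p) + (∫ p in Disc (-y0) x0 r0, g p) +
        (∫ p in Disc (-x0) (-y0) r0, g p) + ∫ p in Disc y0 (-x0) r0, g p) := by
    rw [← j1, ← j2, ← j3, ← integral_add (hgi _ _) i1, ← integral_add i01 i2,
      ← integral_add i012 i3, ← integral_const_mul]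
    refine setIntegral_congr_fun (measurableSet_disc _ _ _) fun p hp => ?_
    have hb := abs_le_of_mem_disc hr0.le hx0 hy0 hp
    exact R2pt_eq_sum_upperPairs hlam hQ1 hQN (by omega) (hb.1.trans hM) (hb.2.trans hM)
  have hx0' : |-x0| ≤ 1 := by rwa [abs_neg]
  have hy0' : |-y0| ≤ 1 := by rwa [abs_neg]
  have k0 := abs_le.1 (key Q (by omega) x0 y0 hx0 hy0)
  have k1 := abs_le.1 (key Q (by omega) (-y0) x0 hy0' hx0)
  have k2 := abs_le.1 (key Q (by omega) (-x0) (-y0) hx0' hy0')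
  have k3 := abs_le.1 (key Q (by omega) y0 (-x0) hy0 hx0')
  rw [← hg] at k0 k1 k2 k3
  set S := (∫ p in Disc x0 y0 r0, g p) + (∫ p in Disc (-y0) x0 r0, g p) +
        (∫ p in Disc (-x0) (-y0) r0, g p) + ∫ p in Disc y0 (-x0) r0, g p with hS
  set D := π * r0 ^ 2 * (2 / 3 * (2 * π * lam / (2 * (Q : ℝ) + 1) ^ 2) * (Q : ℝ) ^ 4) with hD
  have hSD : |S - 4 * D| ≤ 4 * (C * (Q : ℝ) ^ (15 / 8 : ℝ)) := by
    rw [hS, abs_le]; constructor <;> linarith [k0.1, k0.2, k1.1, k1.2, k2.1, k2.2, k3.1, k3.2]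
  have hp : 0 < π * r0 ^ 2 := by positivity
  have e1 : R2avg x0 y0 r0 Q lam - 2 * π * lam / 3 =
      1 / (π * r0 ^ 2) * (2 / (2 * (Q : ℝ) + 1) ^ 2) * (S - 4 * D) +
        32 / 3 * π * lam * ((Q : ℝ) ^ 4 / (2 * (Q : ℝ) + 1) ^ 4 - 1 / 16) := by
    unfold R2avg
    rw [hR, hD]
    field_simp
    ring
  have hz : (Q : ℝ) ^ (15 / 8 : ℝ) = (Q : ℝ) ^ 2 * (Q : ℝ) ^ (-(1 / 8) : ℝ) := by
    rw [← Real.rpow_natCast, ← Real.rpow_add hq0]; norm_num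
  have hz' : 1 / (Q : ℝ) ≤ (Q : ℝ) ^ (-(1 / 8) : ℝ) := by
    rw [one_div, ← Real.rpow_neg_one]
    exact Real.rpow_le_rpow_of_exponent_le hq (by norm_num)
  have b1 : |1 / (π * r0 ^ 2) * (2 / (2 * (Q : ℝ) + 1) ^ 2) * (S - 4 * D)| ≤
      2 * C / (π * r0 ^ 2) * (Q : ℝ) ^ (-(1 / 8) : ℝ) := by
    rw [abs_mul, abs_of_nonneg (by positivity :
      0 ≤ 1 / (π * r0 ^ 2) * (2 / (2 * (Q : ℝ) + 1) ^ 2))]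
    calc 1 / (π * r0 ^ 2) * (2 / (2 * (Q : ℝ) + 1) ^ 2) * |S - 4 * D|
        ≤ 1 / (π * r0 ^ 2) * (2 / (2 * (Q : ℝ)) ^ 2) *
          (4 * (C * ((Q : ℝ) ^ 2 * (Q : ℝ) ^ (-(1 / 8) : ℝ)))) := by
          rw [← hz]; gcongr; linarith
      _ = 2 * C / (π * r0 ^ 2) * (Q : ℝ) ^ (-(1 / 8) : ℝ) := by field_simp; ring
  have b2 : |32 / 3 * π * lam * ((Q : ℝ) ^ 4 / (2 * (Q : ℝ) + 1) ^ 4 - 1 / 16)| ≤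
      32 / 3 * π * lam * (Q : ℝ) ^ (-(1 / 8) : ℝ) := by
    rw [abs_mul, abs_of_nonneg (by positivity : 0 ≤ 32 / 3 * π * lam)]
    gcongr
    exact (abs_pow_four_div_sub_le hq).trans hz'
  rw [e1]
  refine (abs_add_le _ _).trans ?_
  linarith

/-- For every `λ > 0` and `δ > 0` there is `C = C(𝔻₀,λ,δ) > 0` with
`|R^{(2)}_{𝔻₀,Q}(λ) - 2πλ/3| ≤ C Q^{-1/10+δ}` for all `Q ≥ 2`; in particular
`R^{(2)}_{𝔻₀,Q}(λ) → 2πλ/3` as `Q → ∞`. -/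
theorem pair_correlation_average (x0 y0 r0 : ℝ)
    (hx0 : x0 ∈ Set.Ico (0 : ℝ) 1) (hy0 : y0 ∈ Set.Ico (0 : ℝ) 1) (hr0 : 0 < r0)
    (lam : ℝ) (hlam : 0 < lam) (δ : ℝ) (hδ : 0 < δ) :
    (∃ C > 0, ∀ Q : ℕ, 2 ≤ Q →
      |R2avg x0 y0 r0 Q lam - 2 * π * lam / 3| ≤ C * (Q : ℝ) ^ (-(1 / 10 : ℝ) + δ)) ∧
    Filter.Tendsto (fun Q : ℕ => R2avg x0 y0 r0 Q lam) Filter.atTop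
      (nhds (2 * π * lam / 3)) := by
  obtain ⟨C, Q₀, hC, hQ₀, key⟩ := abs_R2avg_sub_le
    (abs_le.2 ⟨by linarith [hx0.1], hx0.2.le⟩) (abs_le.2 ⟨by linarith [hy0.1], hy0.2.le⟩) hr0 hlam
  constructor
  · set s : ℝ := -(1 / 10 : ℝ) + δ
    have hterm : ∀ q : ℕ, 0 ≤ |R2avg x0 y0 r0 q lam - 2 * π * lam / 3| / (q : ℝ) ^ s :=
      fun q => by positivity
    refine ⟨C + ∑ q ∈ Finset.range Q₀, |R2avg x0 y0 r0 q lam - 2 * π * lam / 3| / (q : ℝ) ^ s + 1,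
      by have := Finset.sum_nonneg fun q (_ : q ∈ Finset.range Q₀) => hterm q; linarith, ?_⟩
    intro Q hQ
    have hq : (1 : ℝ) ≤ Q := by exact_mod_cast (by omega : 1 ≤ Q)
    have hpos : 0 < (Q : ℝ) ^ s := Real.rpow_pos_of_pos (by linarith) s
    rcases le_or_gt Q₀ Q with h | h
    · refine (key Q h).trans ?_
      have hsum := Finset.sum_nonneg fun q (_ : q ∈ Finset.range Q₀) => hterm q
      refine mul_le_mul (by linarith) ?_ (by positivity) (by linarith)
      refine Real.rpow_le_rpow_of_exponent_le hq ?_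
      change -(1 / 8 : ℝ) ≤ -(1 / 10) + δ
      linarith
    · rw [← div_le_iff₀ hpos]
      have := Finset.single_le_sum (fun q _ => hterm q) (Finset.mem_range.2 h)
      linarith
  · rw [tendsto_iff_norm_sub_tendsto_zero]
    have h0 : Filter.Tendsto (fun Q : ℕ => C * (Q : ℝ) ^ (-(1 / 8) : ℝ)) Filter.atTop (nhds 0) := by
      simpa using ((tendsto_rpow_neg_atTop (by norm_num : (0 : ℝ) < 1 / 8)).comp
        tendsto_natCast_atTop_atTop).const_mul C
    refine squeeze_zero' (Filter.Eventually.of_forall fun _ => norm_nonneg _) ?_ h0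
    filter_upwards [Filter.eventually_ge_atTop Q₀] with Q hQ
    exact key Q hQ
end

section
/- Let Ω ⊂ ℝ² be a bounded open convex domain containing the origin. Then for every point (x,y) ∈ [0,1)² and every λ = (λ₁,…,λ₅) ∈ ℝ₊⁵, the 6-level correlation repartition R^{(6)}_{Ω,(x,y),Q}(λ) of the angles of directions P_{(x,y)}P, with P ranging over the lattice points of the dilated region QΩ, tends to infinity as Q → ∞. -/
open MeasureTheory Real Pointwise

/-- The lattice points inside the dilated region `QΩ`. -/
def LamPts (Ω : Set (ℝ × ℝ)) (Q : ℕ) : Set (ℤ × ℤ) :=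
  {p | (((p.1 : ℝ), (p.2 : ℝ)) : ℝ × ℝ) ∈ (Q : ℝ) • Ω}

/-- The 6-level correlation repartition `R^{(6)}_{Ω,(x,y),Q}(λ)` for lattice points in `QΩ`. -/
noncomputable def R6om (Ω : Set (ℝ × ℝ)) (x y : ℝ) (Q : ℕ) (lam : Fin 5 → ℝ) : ℝ :=
  (({P : Fin 6 → ℤ × ℤ | (∀ i, P i ∈ LamPts Ω Q) ∧ Function.Injective P ∧
      ∀ i : Fin 5, |angleAt x y (P i.castSucc) (P i.succ)| ≤
        2 * π * lam i / ((LamPts Ω Q).ncard : ℝ)}).ncard : ℝ) / ((LamPts Ω Q).ncard : ℝ)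

/-- An exponential sum with `m` terms vanishing at `m` consecutive integers vanishes at all later
integers. -/
theorem exponential_sum_eq_zero {ι R : Type*} [DecidableEq ι] [CommRing R] (I : Finset ι) (z : ι → R)
    (s₀ : ℕ) (c : ι → R) (h : ∀ j < I.card, ∑ i ∈ I, c i * z i ^ (s₀ + j) = 0)
    (s : ℕ) : ∑ i ∈ I, c i * z i ^ (s₀ + s) = 0 := by
  induction I using Finset.induction_on generalizing c s with
  | empty => simp
  | insert m I hm ih =>
    rw [Finset.card_insert_of_notMem hm] at h
    have key : ∀ s, ∑ i ∈ I, (c i * (z i - z m)) * z i ^ (s₀ + s) =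
        ∑ i ∈ insert m I, c i * z i ^ (s₀ + (s + 1)) -
          z m * ∑ i ∈ insert m I, c i * z i ^ (s₀ + s) := by
      intro s
      rw [Finset.sum_insert hm, Finset.sum_insert hm, mul_add, Finset.mul_sum,
        add_sub_add_comm, ← Finset.sum_sub_distrib, ← add_assoc]
      rw [show c m * z m ^ (s₀ + s + 1) - z m * (c m * z m ^ (s₀ + s)) = 0 by ring, zero_add]
      exact Finset.sum_congr rfl fun i _ => by ring
    have hg := ih (fun i => c i * (z i - z m)) fun j hj => by
      rw [key, h _ (by lia), h _ (by lia)]; ring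
    induction s with
    | zero => exact h 0 (by lia)
    | succ s ihs =>
      have := hg s
      rw [key, ihs] at this
      simpa using this

/-- Among `2 ^ k` consecutive integers, some integer avoids one prescribed residue class for each of
`k` given primes. -/
theorem exists_avoid_residues (S : Finset ℕ) (hS : ∀ p ∈ S, p.Prime) (r : ℕ → ℕ) (s₀ : ℕ) :
    ∃ s, s₀ ≤ s ∧ s < s₀ + 2 ^ S.card ∧ ∀ p ∈ S, ¬ s ≡ r p [MOD p] := by
  by_contra! hcon
  let ζ : ℕ → ℂ := fun p => Complex.exp (2 * π * Complex.I / p)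
  have hζ : ∀ p ∈ S, ∀ a b : ℕ, ζ p ^ a = ζ p ^ b ↔ a ≡ b [MOD p] := by
    intro p hp a b
    have hpr : IsPrimitiveRoot (ζ p) p := Complex.isPrimitiveRoot_exp p (hS p hp).ne_zero
    have hmod : ∀ a : ℕ, ζ p ^ a = ζ p ^ (a % p) := fun a => by
      have h := pow_mod_orderOf (ζ p) a
      rw [← hpr.eq_orderOf] at h
      exact h.symm
    rw [hmod a, hmod b]
    exact ⟨fun h => hpr.pow_inj (Nat.mod_lt _ (hS p hp).pos) (Nat.mod_lt _ (hS p hp).pos) h,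
      fun h => by rw [h]⟩
  have hexp : ∀ s : ℕ, ∏ p ∈ S, (ζ p ^ r p - ζ p ^ s) = ∑ t ∈ S.powerset,
      ((-1) ^ t.card * ∏ p ∈ S \ t, ζ p ^ r p) * (∏ p ∈ t, ζ p) ^ s := by
    intro s
    rw [Finset.prod_sub]
    exact Finset.sum_congr rfl fun t _ => by rw [Finset.prod_pow]
  have hzero := exponential_sum_eq_zero S.powerset (fun t => ∏ p ∈ t, ζ p) s₀
    (fun t => (-1) ^ t.card * ∏ p ∈ S \ t, ζ p ^ r p) (by
      intro j hj
      rw [Finset.card_powerset] at hj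
      rw [← hexp]
      obtain ⟨p, hp, hmod⟩ := hcon (s₀ + j) (by lia) (by lia)
      exact Finset.prod_eq_zero hp (by rw [(hζ p hp _ _).2 hmod, sub_self]))
  obtain ⟨k, hk⟩ := Nat.chineseRemainderOfFinset (fun p => r p + 1) id S
    (fun p hp => (hS p hp).ne_zero)
    (fun p hp q hq hpq => (Nat.coprime_primes (hS p hp) (hS q hq)).2 hpq)
  have hP : 0 < ∏ p ∈ S, p := Finset.prod_pos fun p hp => (hS p hp).pos
  have hle : s₀ ≤ k + s₀ * ∏ p ∈ S, p := by nlinarith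
  obtain ⟨j, hj⟩ := Nat.exists_eq_add_of_le hle
  have h0 := hzero j
  rw [← hj, ← hexp, Finset.prod_eq_zero_iff] at h0
  obtain ⟨p, hp, h⟩ := h0
  have h1 := ((hζ p hp _ _).1 (sub_eq_zero.1 h)).symm
  have h2 : k + s₀ * ∏ p ∈ S, p ≡ r p + 1 [MOD p] := by
    have h3 : s₀ * ∏ p ∈ S, p ≡ 0 [MOD p] :=
      (Nat.modEq_zero_iff_dvd).2 ((Finset.dvd_prod_of_mem _ hp).mul_left _)
    simpa using (hk p hp).add h3
  have h4 : r p + 0 ≡ r p + 1 [MOD p] := by simpa using h1.symm.trans h2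
  have h5 := (Nat.modEq_iff_dvd.1 (Nat.ModEq.add_left_cancel' _ h4))
  have h6 : (p : ℤ) ∣ 1 := by simpa using h5
  exact (hS p hp).one_lt.ne' (by exact_mod_cast Int.eq_one_of_dvd_one (by positivity) h6)

theorem factorial_card_le_prod (S : Finset ℕ) (hS : ∀ p ∈ S, 0 < p) :
    S.card.factorial ≤ ∏ p ∈ S, p := by
  induction S using Finset.induction_on_max with
  | empty => simp
  | insert m S hm ih =>
    have hmS : m ∉ S := fun h => lt_irrefl _ (hm m h)
    rw [Finset.card_insert_of_notMem hmS, Finset.prod_insert hmS, Nat.factorial_succ]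
    refine Nat.mul_le_mul ?_ (ih fun p hp => hS p (Finset.mem_insert_of_mem hp))
    have : S ⊆ Finset.Ico 1 m := fun p hp =>
      Finset.mem_Ico.2 ⟨hS p (Finset.mem_insert_of_mem hp), hm p hp⟩
    have hc := Finset.card_le_card this
    have hm0 := hS m (Finset.mem_insert_self _ _)
    rw [Nat.card_Ico] at hc
    lia

/-- `2 ^ ω(n)` grows more slowly than any power of `n`. -/
theorem exists_two_pow_card_primeFactors_le (k : ℕ) :
    ∃ C : ℝ, 1 ≤ C ∧ ∀ n : ℕ, n ≠ 0 → ((2 : ℝ) ^ n.primeFactors.card) ^ k ≤ C * n := by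
  obtain ⟨C, hC⟩ := (FloorSemiring.tendsto_pow_div_factorial_atTop ((2 : ℝ) ^ k)).bddAbove_range
  refine ⟨max C 1, le_max_right _ _, fun n hn => ?_⟩
  have h1 := hC ⟨n.primeFactors.card, rfl⟩
  have hf : (0 : ℝ) < (n.primeFactors.card.factorial : ℝ) := by positivity
  rw [div_le_iff₀ hf] at h1
  have h2 : n.primeFactors.card.factorial ≤ n :=
    (factorial_card_le_prod _ fun p hp => (Nat.prime_of_mem_primeFactors hp).pos).trans
      (Nat.le_of_dvd (Nat.pos_of_ne_zero hn) (Nat.prod_primeFactors_dvd n))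
  calc ((2 : ℝ) ^ n.primeFactors.card) ^ k = (2 ^ k) ^ n.primeFactors.card := pow_right_comm _ _ _
    _ ≤ C * (n.primeFactors.card.factorial : ℝ) := h1
    _ ≤ max C 1 * n := by
      gcongr
      exact le_max_left _ _

/-- Dirichlet's theorem for one linear form in two variables. -/
theorem exists_abs_linear_form_le (x y : ℝ) {H : ℕ} (hH : 0 < H) :
    ∃ a b c : ℤ, (a ≠ 0 ∨ b ≠ 0) ∧ |a| ≤ H ∧ |b| ≤ H ∧ |a * x + b * y - c| * (H : ℝ) ^ 2 ≤ 1 := by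
  have hH' : (0 : ℝ) < (H : ℝ) ^ 2 := by positivity
  obtain ⟨u, hu, v, hv, huv, hf⟩ := Finset.exists_ne_map_eq_of_card_lt_of_maps_to
    (s := Finset.range (H + 1) ×ˢ Finset.range (H + 1)) (t := Finset.Ico (0 : ℤ) ((H : ℤ) ^ 2))
    (f := fun u => ⌊Int.fract ((u.1 : ℝ) * x + u.2 * y) * (H : ℝ) ^ 2⌋)
    (by
      rw [Finset.card_product, Finset.card_range, Int.card_Ico, sub_zero]
      have : ((H : ℤ) ^ 2).toNat = H ^ 2 := by exact_mod_cast Int.toNat_natCast (H ^ 2)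
      rw [this]; nlinarith)
    (by
      intro u _
      simp only [Finset.coe_Ico, Set.mem_Ico]
      refine ⟨Int.floor_nonneg.2 (mul_nonneg (Int.fract_nonneg _) hH'.le), Int.floor_lt.2 ?_⟩
      push_cast
      nlinarith [Int.fract_lt_one ((u.1 : ℝ) * x + u.2 * y)])
  simp only [Finset.mem_product, Finset.mem_range] at hu hv
  refine ⟨u.1 - v.1, u.2 - v.2, ⌊(u.1 : ℝ) * x + u.2 * y⌋ - ⌊(v.1 : ℝ) * x + v.2 * y⌋,
    ?_, ?_, ?_, ?_⟩
  · by_contra! h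
    exact huv (Prod.ext (by lia) (by lia))
  · rw [abs_le]; constructor <;> lia
  · rw [abs_le]; constructor <;> lia
  · have h := (Int.abs_sub_lt_one_of_floor_eq_floor hf).le
    rw [← sub_mul, abs_mul, abs_of_pos hH'] at h
    refine (le_of_eq ?_).trans h
    congr 2
    simp only [Int.fract]
    push_cast
    ring

/-- An integer linear form in `x, y` together with a second one that is independent of it modulo
every prime, both of them taking small values. -/
theorem exists_independent_linear_forms (x y : ℝ) {H : ℕ} (hH : 0 < H) :
    ∃ a b c a' b' c' : ℤ, |a| ≤ H ∧ |b| ≤ H ∧ |a * x + b * y - c| * (H : ℝ) ^ 2 ≤ 1 ∧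
      |a'| ≤ H ∧ |b'| ≤ H ∧ |a' * x + b' * y - c'| * (H : ℝ) ≤ 1 ∧
      a * b' - b * a' ≠ 0 ∧
      ∀ p : ℕ, p.Prime → ¬ ((p : ℤ) ∣ a ∧ (p : ℤ) ∣ b ∧ (p : ℤ) ∣ a' ∧ (p : ℤ) ∣ b') := by
  have hH' : (0 : ℝ) < (H : ℝ) := by exact_mod_cast hH
  have hdvd : ∀ (p : ℕ), p.Prime → ∀ n : ℤ, |(p : ℤ) * n| ≤ p * H → |n| ≤ H := by
    intro p hp n h
    have : (0 : ℤ) < p := by exact_mod_cast hp.pos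
    rw [abs_mul, abs_of_pos this] at h
    exact le_of_mul_le_mul_left h this
  obtain ⟨⟨a, b, c⟩, ⟨hne, ha, hb, hl⟩, hmin⟩ := exists_minimalFor_of_wellFoundedLT
    (fun w : ℤ × ℤ × ℤ => (w.1 ≠ 0 ∨ w.2.1 ≠ 0) ∧ |w.1| ≤ H ∧ |w.2.1| ≤ H ∧
      |w.1 * x + w.2.1 * y - w.2.2| * (H : ℝ) ^ 2 ≤ 1)
    (fun w => w.1.natAbs + w.2.1.natAbs)
    (by
      obtain ⟨a, b, c, h⟩ := exists_abs_linear_form_le x y hH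
      exact ⟨⟨a, b, c⟩, h⟩)
  dsimp only at hne ha hb hl hmin
  have hprim : ∀ p : ℕ, p.Prime → (p : ℤ) ∣ a → (p : ℤ) ∣ b → ¬ (p : ℤ) ∣ c := by
    rintro p hp ⟨a, rfl⟩ ⟨b, rfl⟩ ⟨c, rfl⟩
    have hp2 : (2 : ℝ) ≤ p := by exact_mod_cast hp.two_le
    have hne' : a ≠ 0 ∨ b ≠ 0 := by
      by_contra! h
      simp [h.1, h.2] at hne
    have hp0 : (1 : ℤ) ≤ p := by exact_mod_cast hp.one_le
    have h := @hmin (a, b, c) ⟨hne', hdvd p hp a (by nlinarith), hdvd p hp b (by nlinarith), by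
      refine le_trans ?_ hl
      push_cast
      rw [show (p : ℝ) * a * x + p * b * y - p * c = p * (a * x + b * y - c) by ring, abs_mul,
        abs_of_nonneg (by positivity : (0 : ℝ) ≤ p)]
      gcongr
      nlinarith [abs_nonneg (a * x + b * y - c)]⟩
    simp only [Int.natAbs_mul, Int.natAbs_natCast] at h
    have h2 := hp.two_le
    have h3 : 0 < a.natAbs + b.natAbs := by lia
    have h4 : p * a.natAbs + p * b.natAbs ≤ a.natAbs + b.natAbs := h (by nlinarith)
    nlinarith
  obtain ⟨⟨a', b', c'⟩, ⟨hD, ha', hb', hl'⟩, hmin'⟩ := exists_minimalFor_of_wellFoundedLT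
    (fun w : ℤ × ℤ × ℤ => a * w.2.1 - b * w.1 ≠ 0 ∧ |w.1| ≤ H ∧ |w.2.1| ≤ H ∧
      |w.1 * x + w.2.1 * y - w.2.2| * (H : ℝ) ≤ 1)
    (fun w => (a * w.2.1 - b * w.1).natAbs)
    (by
      have hdir : ∀ t : ℝ, ∃ n m : ℤ, n ≠ 0 ∧ |n| ≤ H ∧ |n * t - m| * (H : ℝ) ≤ 1 := by
        intro t
        obtain ⟨m, n, hn, hnH, h⟩ := Real.exists_int_int_abs_mul_sub_le t hH
        refine ⟨n, m, hn.ne', by rwa [abs_of_pos hn], ?_⟩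
        rw [le_div_iff₀ (by positivity)] at h
        nlinarith [abs_nonneg (n * t - m)]
      rcases hne with h | h
      · obtain ⟨n, m, hn, hnH, hnm⟩ := hdir y
        exact ⟨(0, n, m), by simp [h, hn], by simp, hnH, by simpa using hnm⟩
      · obtain ⟨n, m, hn, hnH, hnm⟩ := hdir x
        exact ⟨(n, 0, m), by simp [h, hn], hnH, by simp, by simpa using hnm⟩)
  dsimp only at hD ha' hb' hl' hmin'
  refine ⟨a, b, c, a', b', c', ha, hb, hl, ha', hb', hl', hD, ?_⟩
  rintro p hp ⟨hpa, hpb, hpa', hpb'⟩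
  have hcop : IsCoprime (p : ℤ) c :=
    (Nat.prime_iff_prime_int.1 hp).coprime_iff_not_dvd.2 (hprim p hp hpa hpb)
  obtain ⟨u, v, huv⟩ := hcop
  have hp2 : (2 : ℤ) ≤ p := by exact_mod_cast hp.two_le
  obtain ⟨t, ht, htp⟩ : ∃ t : ℤ, (p : ℤ) ∣ c' - t * c ∧ 2 * |t| ≤ p := by
    refine ⟨(c' * v).bmod p, ?_, ?_⟩
    · have h1 : (p : ℤ) ∣ c' * v - (c' * v).bmod p := Int.dvd_self_sub_bmod
      have h2 : c' - (c' * v).bmod p * c = p * (u * c') + (c' * v - (c' * v).bmod p) * c := by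
        linear_combination (-c') * huv
      rw [h2]
      exact dvd_add (dvd_mul_right _ _) (h1.mul_right _)
    · have h1 := Int.le_bmod (x := c' * v) hp.pos
      have h2 := Int.bmod_lt (x := c' * v) hp.pos
      rcases abs_cases ((c' * v).bmod p) with h | h <;> lia
  obtain ⟨α, hα⟩ : (p : ℤ) ∣ a' - t * a := dvd_sub hpa' (hpa.mul_left _)
  obtain ⟨β, hβ⟩ : (p : ℤ) ∣ b' - t * b := dvd_sub hpb' (hpb.mul_left _)
  obtain ⟨γ, hγ⟩ := ht
  have hdet : a * b' - b * a' = p * (a * β - b * α) := by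
    linear_combination a * hβ - b * hα
  have hbound : ∀ m n : ℤ, |m| ≤ H → |n| ≤ H → |m - t * n| ≤ p * H := by
    intro m n hm hn
    have h1 : |m - t * n| ≤ |m| + |t| * |n| := by
      rw [← abs_mul]; exact abs_sub _ _
    have h2 : |t| * |n| ≤ |t| * H := mul_le_mul_of_nonneg_left hn (abs_nonneg _)
    nlinarith
  have h := @hmin' (α, β, γ) ⟨fun h0 => hD (by rw [hdet, h0, mul_zero]),
    hdvd p hp α (hα ▸ hbound _ _ ha' ha), hdvd p hp β (hβ ▸ hbound _ _ hb' hb), by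
      have e1 : (p : ℝ) * (α * x + β * y - γ) =
          (a' * x + b' * y - c') - t * (a * x + b * y - c) := by
        have hα' : (a' : ℝ) - t * a = p * α := by exact_mod_cast hα
        have hβ' : (b' : ℝ) - t * b = p * β := by exact_mod_cast hβ
        have hγ' : (c' : ℝ) - t * c = p * γ := by exact_mod_cast hγ
        linear_combination (-x) * hα' - y * hβ' + hγ'
      have hp2' : (2 : ℝ) ≤ p := by exact_mod_cast hp2
      have htp' : 2 * |(t : ℝ)| ≤ p := by exact_mod_cast htp
      have e2 : (p : ℝ) * |α * x + β * y - γ| ≤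
          |a' * x + b' * y - c'| + |(t : ℝ)| * |a * x + b * y - c| := by
        rw [← Nat.abs_cast p, ← abs_mul, e1, ← abs_mul]
        exact abs_sub _ _
      have hH1 : (1 : ℝ) ≤ H := by exact_mod_cast hH
      have e3 : |a * x + b * y - c| * (H : ℝ) ≤ 1 := by
        nlinarith [abs_nonneg (a * x + b * y - c),
          mul_nonneg (abs_nonneg (a * x + b * y - c)) hH'.le]
      have e4 : (p : ℝ) * (|α * x + β * y - γ| * H) ≤ p * 1 := by
        nlinarith [mul_le_mul_of_nonneg_right e2 hH'.le,
          mul_le_mul_of_nonneg_left e3 (abs_nonneg (t : ℝ))]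
      exact le_of_mul_le_mul_left e4 (by positivity)⟩
  dsimp only at h
  rw [hdet, Int.natAbs_mul, Int.natAbs_natCast] at h
  have h0 : 0 < (a * β - b * α).natAbs := by
    rw [Int.natAbs_pos]
    exact fun h0 => hD (by rw [hdet, h0, mul_zero])
  have h2 := hp.two_le
  have := h (by nlinarith)
  nlinarith

/-- A primitive integer linear form of controlled size taking a small value at `(x, y)`. -/
theorem exists_coprime_linear_form :
    ∃ K : ℝ, 0 < K ∧ ∀ (x y : ℝ) (H : ℕ), 0 < H → ∃ a b c : ℤ, IsCoprime a b ∧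
      |a * x + b * y - c| * (H : ℝ) ≤ K ∧ (H : ℝ) ^ 2 ≤ (a : ℝ) ^ 2 + (b : ℝ) ^ 2 ∧
      ((a : ℝ) ^ 2 + (b : ℝ) ^ 2) ^ 8 ≤ K * (H : ℝ) ^ 18 := by
  obtain ⟨C, hC1, hC⟩ := exists_two_pow_card_primeFactors_le 16
  refine ⟨max (5 + 2 * C) (72 ^ 8 * (2 * C)), by positivity, fun x y H hH => ?_⟩
  obtain ⟨a, b, c, a', b', c', ha, hb, hl, ha', hb', hl', hD, hind⟩ :=
    exists_independent_linear_forms x y hH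
  have hHZ : (1 : ℤ) ≤ H := by exact_mod_cast hH
  have hHR : (1 : ℝ) ≤ H := by exact_mod_cast hH
  set D := a * b' - b * a' with hDdef
  set S := D.natAbs.primeFactors with hS
  set J : ℕ := 2 ^ S.card with hJ
  have hJ1 : 1 ≤ J := Nat.one_le_two_pow
  have hJ1R : (1 : ℝ) ≤ J := by exact_mod_cast hJ1
  have hDle : (D.natAbs : ℝ) ≤ 2 * (H : ℝ) ^ 2 := by
    have h1 : |D| ≤ |a| * |b'| + |b| * |a'| := by
      rw [← abs_mul, ← abs_mul]; exact abs_sub _ _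
    have h2 : |a| * |b'| ≤ H * H := by gcongr
    have h3 : |b| * |a'| ≤ H * H := by gcongr
    have h4 : |D| ≤ 2 * (H : ℤ) ^ 2 := by nlinarith
    rw [Nat.cast_natAbs]
    exact_mod_cast h4
  have hJ16 : (J : ℝ) ^ 16 ≤ 2 * C * (H : ℝ) ^ 2 := by
    have h1 := hC D.natAbs (Int.natAbs_ne_zero.2 hD)
    have h2 : (J : ℝ) = 2 ^ S.card := by rw [hJ]; push_cast; rfl
    rw [h2]
    nlinarith
  have hJH : (J : ℝ) ≤ 2 * C * H := by
    have h1 : (1 : ℝ) ≤ 2 * C * H := by nlinarith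
    refine le_of_pow_le_pow_left₀ (n := 16) (by norm_num) (by positivity) (hJ16.trans ?_)
    calc 2 * C * (H : ℝ) ^ 2 ≤ (2 * C * H) ^ 2 := by nlinarith
      _ ≤ (2 * C * H) ^ 16 := pow_le_pow_right₀ h1 (by norm_num)
  -- `s₀` is chosen so that `s₀ * max |a| |b|` is comparable to `H`
  set h : ℤ := max |a| |b| with hh
  have hh1 : 1 ≤ h := by
    by_contra! h0
    have h1 : |a| ≤ 0 := (le_max_left |a| |b|).trans (by lia)
    have h2 : |b| ≤ 0 := (le_max_right |a| |b|).trans (by lia)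
    apply hD
    rw [hDdef, abs_nonpos_iff.1 h1, abs_nonpos_iff.1 h2]
    ring
  have hhH : h ≤ H := max_le ha hb
  obtain ⟨s₀, hs₀, hs₀'⟩ : ∃ s₀ : ℕ, 3 * (H : ℤ) ≤ s₀ * h ∧ s₀ * h ≤ 4 * (H : ℤ) := by
    refine ⟨(3 * (H : ℤ) / h + 1).toNat, ?_, ?_⟩ <;>
      rw [Int.toNat_of_nonneg (by positivity)] <;>
      nlinarith [Int.mul_ediv_add_emod (3 * (H : ℤ)) h, Int.emod_nonneg (3 * (H : ℤ)) (by lia : h ≠ 0),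
        Int.emod_lt_of_pos (3 * (H : ℤ)) (by lia : 0 < h)]
  classical
  let r : ℕ → ℕ := fun p => if h : ∃ s : ℕ, (p : ℤ) ∣ s * a + a' ∧ (p : ℤ) ∣ s * b + b' then h.choose
    else 0
  obtain ⟨s, hs1, hs2, hs⟩ := exists_avoid_residues S (fun p hp => Nat.prime_of_mem_primeFactors hp)
    r s₀
  have hsJ : (s : ℤ) ≤ s₀ + J := by exact_mod_cast hs2.le
  have hs1' : (s₀ : ℤ) ≤ s := by exact_mod_cast hs1
  have hbig : ∀ m n : ℤ, |m| = h → |n| ≤ H → 2 * (H : ℤ) ≤ |s * m + n| := by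
    intro m n hm hn
    have h1 : |(s : ℤ) * m| ≤ |s * m + n| + |n| := by
      simpa using abs_sub (s * m + n) n
    rw [abs_mul, Nat.abs_cast, hm] at h1
    nlinarith
  have hsmall : ∀ m n : ℤ, |m| ≤ h → |n| ≤ H → |s * m + n| ≤ 6 * J * H := by
    intro m n hm hn
    have h1 : |s * m + n| ≤ |(s : ℤ) * m| + |n| := abs_add_le _ _
    rw [abs_mul, Nat.abs_cast] at h1
    have h2 : (s : ℤ) * |m| ≤ (s₀ + J) * h := by gcongr
    have h3 : (1 : ℤ) ≤ J := by exact_mod_cast hJ1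
    nlinarith
  refine ⟨s * a + a', s * b + b', s * c + c', ?_, ?_, ?_, ?_⟩
  · rw [Int.isCoprime_iff_gcd_eq_one]
    by_contra hg
    obtain ⟨p, hp, hpg⟩ := Nat.exists_prime_and_dvd hg
    have h1 : (p : ℤ) ∣ s * a + a' := (Int.natCast_dvd_natCast.2 hpg).trans (Int.gcd_dvd_left _ _)
    have h2 : (p : ℤ) ∣ s * b + b' := (Int.natCast_dvd_natCast.2 hpg).trans (Int.gcd_dvd_right _ _)
    have hpD : (p : ℤ) ∣ D := by
      have : D = a * (s * b + b') - b * (s * a + a') := by rw [hDdef]; ring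
      rw [this]
      exact dvd_sub (h2.mul_left _) (h1.mul_left _)
    have hpS : p ∈ S := Nat.mem_primeFactors.2
      ⟨hp, Int.natCast_dvd.1 hpD, Int.natAbs_ne_zero.2 hD⟩
    have hex : ∃ s : ℕ, (p : ℤ) ∣ s * a + a' ∧ (p : ℤ) ∣ s * b + b' := ⟨s, h1, h2⟩
    have hr : (p : ℤ) ∣ r p * a + a' ∧ (p : ℤ) ∣ r p * b + b' := by
      simp only [r, dif_pos hex]
      exact hex.choose_spec
    have hpr : Prime (p : ℤ) := Nat.prime_iff_prime_int.1 hp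
    have hns : ¬ (p : ℤ) ∣ (r p : ℤ) - s := fun h => hs p hpS (Nat.modEq_iff_dvd.2 h)
    have hpa : (p : ℤ) ∣ a := by
      refine (hpr.dvd_or_dvd (?_ : (p : ℤ) ∣ ((r p : ℤ) - s) * a)).resolve_left hns
      rw [show ((r p : ℤ) - s) * a = r p * a + a' - (s * a + a') by ring]
      exact dvd_sub hr.1 h1
    have hpb : (p : ℤ) ∣ b := by
      refine (hpr.dvd_or_dvd (?_ : (p : ℤ) ∣ ((r p : ℤ) - s) * b)).resolve_left hns
      rw [show ((r p : ℤ) - s) * b = r p * b + b' - (s * b + b') by ring]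
      exact dvd_sub hr.2 h2
    exact hind p hp ⟨hpa, hpb, (Int.dvd_add_right (hpa.mul_left _)).1 h1,
      (Int.dvd_add_right (hpb.mul_left _)).1 h2⟩
  · refine le_trans ?_ (le_max_left _ _)
    have hs₀4 : (s₀ : ℤ) ≤ 4 * H := by nlinarith
    have hsR : (s : ℝ) ≤ 4 * H + J := by
      have : (s : ℤ) ≤ 4 * H + J := by linarith
      exact_mod_cast this
    push_cast
    have h1 : |((s : ℝ) * a + a') * x + (s * b + b') * y - (s * c + c')| ≤
        s * |a * x + b * y - c| + |a' * x + b' * y - c'| := by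
      rw [← Nat.abs_cast s, ← abs_mul, Nat.abs_cast]
      refine le_trans (le_of_eq ?_) (abs_add_le _ _)
      congr 1; ring
    have h2 : (s : ℝ) * |a * x + b * y - c| * H ≤ 4 + 2 * C := by
      have h3 : (s : ℝ) ≤ (4 + 2 * C) * H := by linarith
      calc (s : ℝ) * |a * x + b * y - c| * H ≤ (4 + 2 * C) * H * |a * x + b * y - c| * H := by
            gcongr
        _ = (4 + 2 * C) * (|a * x + b * y - c| * H ^ 2) := by ring
        _ ≤ (4 + 2 * C) * 1 := by gcongr
        _ = 4 + 2 * C := mul_one _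
    nlinarith [mul_le_mul_of_nonneg_right h1 (by positivity : (0 : ℝ) ≤ H)]
  · have key : ∀ m : ℤ, 2 * (H : ℤ) ≤ |m| → (H : ℝ) ^ 2 ≤ (m : ℝ) ^ 2 := by
      intro m hm
      have : (H : ℝ) ≤ |(m : ℝ)| := by exact_mod_cast (by linarith : (H : ℤ) ≤ |m|)
      rw [← sq_abs (m : ℝ)]
      gcongr
    rcases max_choice |a| |b| with hm | hm
    · have := key _ (hbig a a' (by rw [hh, hm]) ha')
      nlinarith [sq_nonneg (((s * b + b' : ℤ)) : ℝ)]
    · have := key _ (hbig b b' (by rw [hh, hm]) hb')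
      nlinarith [sq_nonneg (((s * a + a' : ℤ)) : ℝ)]
  · refine le_trans ?_ (mul_le_mul_of_nonneg_right (le_max_right _ _) (by positivity))
    have key : ∀ m : ℤ, |m| ≤ 6 * J * H → (m : ℝ) ^ 2 ≤ (6 * J * H) ^ 2 := by
      intro m hm
      have : |(m : ℝ)| ≤ 6 * J * H := by exact_mod_cast hm
      rw [← sq_abs (m : ℝ)]
      gcongr
    have h1 := key _ (hsmall a a' (le_max_left _ _) ha')
    have h2 := key _ (hsmall b b' (le_max_right _ _) hb')
    calc (((s * a + a' : ℤ) : ℝ) ^ 2 + ((s * b + b' : ℤ) : ℝ) ^ 2) ^ 8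
        ≤ (72 * (J : ℝ) ^ 2 * (H : ℝ) ^ 2) ^ 8 := by
          gcongr
          linarith
      _ = 72 ^ 8 * (J : ℝ) ^ 16 * (H : ℝ) ^ 16 := by ring
      _ ≤ 72 ^ 8 * (2 * C * (H : ℝ) ^ 2) * (H : ℝ) ^ 16 := by gcongr
      _ = 72 ^ 8 * (2 * C) * (H : ℝ) ^ 18 := by ring

theorem exists_coprime_linear_form_le (x y : ℝ) {ε : ℝ} (hε : 0 < ε) :
    ∃ K : ℝ, 0 < K ∧ ∀ Q : ℕ, 0 < Q → ∃ a b c : ℤ, IsCoprime a b ∧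
      |a * x + b * y - c| * Q ≤ ε * √((a : ℝ) ^ 2 + (b : ℝ) ^ 2) ∧
      ((a : ℝ) ^ 2 + (b : ℝ) ^ 2) ^ 8 ≤ K * (Q : ℝ) ^ 9 := by
  obtain ⟨K, hK, hform⟩ := exists_coprime_linear_form
  obtain ⟨C, hC⟩ := exists_nat_gt (K / ε)
  have hC0 : (0 : ℝ) < C := (div_pos hK hε).trans hC
  refine ⟨K * (4 * C) ^ 9, by positivity, fun Q hQ => ?_⟩
  have hCQ : 0 < C * Q := Nat.mul_pos (by exact_mod_cast hC0) hQ
  obtain ⟨a, b, c, hab, hl, hm, hm8⟩ := hform x y (Nat.sqrt (C * Q) + 1) (Nat.succ_pos _)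
  set H := Nat.sqrt (C * Q) + 1 with hH
  have hH1 : C * Q ≤ H ^ 2 := by rw [sq]; exact (Nat.lt_succ_sqrt (C * Q)).le
  have hH2 : H ^ 2 ≤ 4 * (C * Q) := by
    have h1 := Nat.sqrt_le (C * Q)
    have h2 := Nat.sqrt_pos.2 hCQ
    nlinarith
  have hH1' : (C : ℝ) * Q ≤ (H : ℝ) ^ 2 := by exact_mod_cast hH1
  have hH2' : (H : ℝ) ^ 2 ≤ 4 * (C * Q) := by exact_mod_cast hH2
  have hH0 : (0 : ℝ) < H := by positivity
  refine ⟨a, b, c, hab, ?_, hm8.trans ?_⟩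
  · have h1 : (H : ℝ) ≤ √((a : ℝ) ^ 2 + (b : ℝ) ^ 2) := Real.le_sqrt_of_sq_le hm
    refine le_trans ?_ (mul_le_mul_of_nonneg_left h1 hε.le)
    rw [div_lt_iff₀ hε] at hC
    have h2 : |a * x + b * y - c| * (C * Q) ≤ C * (ε * H) := by
      calc |a * x + b * y - c| * (C * Q) ≤ |a * x + b * y - c| * (H : ℝ) ^ 2 := by gcongr
        _ = (|a * x + b * y - c| * H) * H := by ring
        _ ≤ K * H := by gcongr
        _ ≤ C * ε * H := by gcongr
        _ = C * (ε * H) := by ring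
    refine le_of_mul_le_mul_left ?_ hC0
    linarith
  · calc K * (H : ℝ) ^ 18 = K * ((H : ℝ) ^ 2) ^ 9 := by ring
      _ ≤ K * (4 * (C * Q)) ^ 9 := by gcongr
      _ = K * (4 * C) ^ 9 * (Q : ℝ) ^ 9 := by ring

/-- The inner product of two plane vectors in the orthogonal coordinates attached to `(b, -a)` and
`(a, b)`. -/
theorem sq_add_sq_mul_inner (a b u₁ u₂ v₁ v₂ : ℝ) :
    (a ^ 2 + b ^ 2) * inner ℝ !₂[u₁, u₂] !₂[v₁, v₂] =
      (b * u₁ - a * u₂) * (b * v₁ - a * v₂) + (a * u₁ + b * u₂) * (a * v₁ + b * v₂) := by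
  simp only [PiLp.inner_apply, Fin.sum_univ_two, RCLike.inner_apply, conj_trivial]
  simp only [Matrix.cons_val_zero, Matrix.cons_val_one, Matrix.cons_val_fin_one]
  ring

theorem le_abs_div_of_sq_mul_eq {s δ τ τ' L : ℝ} (hL : 0 < L) (h₁ : L ≤ τ) (h₂ : τ ≤ 2 * L)
    (h₁' : L ≤ τ') (h₂' : τ' ≤ 2 * L)
    (hs : s ^ 2 * ((τ * τ + δ * δ) * (τ' * τ' + δ * δ)) = (δ * (τ - τ')) ^ 2) :
    s ≤ |δ| / L := by
  rw [le_div_iff₀ hL]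
  refine le_of_sq_le_sq ?_ (abs_nonneg δ)
  have e₁ : L ^ 2 ≤ τ * τ + δ * δ := by nlinarith
  have e₂ : L ^ 2 ≤ τ' * τ' + δ * δ := by nlinarith
  have hLL : L ^ 2 * L ^ 2 ≤ (τ * τ + δ * δ) * (τ' * τ' + δ * δ) :=
    mul_le_mul e₁ e₂ (sq_nonneg L) ((sq_nonneg L).trans e₁)
  have hd : (τ - τ') ^ 2 ≤ L ^ 2 := sq_le_sq' (by linarith) (by linarith)
  have h3 : (s * L) ^ 2 * L ^ 2 ≤ |δ| ^ 2 * L ^ 2 := by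
    calc (s * L) ^ 2 * L ^ 2 = s ^ 2 * (L ^ 2 * L ^ 2) := by ring
      _ ≤ s ^ 2 * ((τ * τ + δ * δ) * (τ' * τ' + δ * δ)) := by gcongr
      _ = δ ^ 2 * (τ - τ') ^ 2 := by rw [hs]; ring
      _ ≤ δ ^ 2 * L ^ 2 := by gcongr
      _ = |δ| ^ 2 * L ^ 2 := by rw [sq_abs]
  exact le_of_mul_le_mul_right h3 (by positivity)

/-- The angle at `(x, y)` between two points of the line `aX + bY = c`, in terms of their
coordinates along the line. -/
theorem angleAt_le {a b c : ℤ} {x y L : ℝ} {P P' : ℤ × ℤ} (hL : 0 < L)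
    (hP : a * P.1 + b * P.2 = c) (hP' : a * P'.1 + b * P'.2 = c)
    (h₁ : L ≤ b * (P.1 - x) - a * (P.2 - y)) (h₂ : b * (P.1 - x) - a * (P.2 - y) ≤ 2 * L)
    (h₁' : L ≤ b * (P'.1 - x) - a * (P'.2 - y)) (h₂' : b * (P'.1 - x) - a * (P'.2 - y) ≤ 2 * L) :
    |angleAt x y P P'| ≤ π / 2 * (|a * x + b * y - c| / L) := by
  have hPR : (a : ℝ) * P.1 + b * P.2 = c := by exact_mod_cast hP
  have hPR' : (a : ℝ) * P'.1 + b * P'.2 = c := by exact_mod_cast hP'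
  have hu : toPt P.1 P.2 -ᵥ toPt x y = !₂[(P.1 : ℝ) - x, (P.2 : ℝ) - y] := by
    ext i; fin_cases i <;> simp [toPt]
  have hu' : toPt P'.1 P'.2 -ᵥ toPt x y = !₂[(P'.1 : ℝ) - x, (P'.2 : ℝ) - y] := by
    ext i; fin_cases i <;> simp [toPt]
  have e1 : a * ((P.1 : ℝ) - x) + b * (P.2 - y) = -(a * x + b * y - c) := by linarith
  have e2 : a * ((P'.1 : ℝ) - x) + b * (P'.2 - y) = -(a * x + b * y - c) := by linarith
  have i1 := sq_add_sq_mul_inner a b (P.1 - x) (P.2 - y) (P'.1 - x) (P'.2 - y)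
  have i2 := sq_add_sq_mul_inner a b (P.1 - x) (P.2 - y) (P.1 - x) (P.2 - y)
  have i3 := sq_add_sq_mul_inner a b (P'.1 - x) (P'.2 - y) (P'.1 - x) (P'.2 - y)
  rw [e1, e2, neg_mul_neg] at i1
  rw [e1, neg_mul_neg] at i2
  rw [e2, neg_mul_neg] at i3
  have hm0 : 0 < (a : ℝ) ^ 2 + (b : ℝ) ^ 2 := by
    rcases (by positivity : 0 ≤ (a : ℝ) ^ 2 + (b : ℝ) ^ 2).lt_or_eq with h | h
    · exact h
    · have ha : (a : ℝ) = 0 := by nlinarith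
      have hb : (b : ℝ) = 0 := by nlinarith
      rw [ha, hb] at h₁
      linarith
  rw [angleAt, EuclideanGeometry.angle, hu, hu']
  generalize (!₂[(P.1 : ℝ) - x, (P.2 : ℝ) - y] : EuclideanSpace ℝ (Fin 2)) = u at *
  generalize (!₂[(P'.1 : ℝ) - x, (P'.2 : ℝ) - y] : EuclideanSpace ℝ (Fin 2)) = u' at *
  generalize (b : ℝ) * (P.1 - x) - a * (P.2 - y) = τ at *
  generalize (b : ℝ) * (P'.1 - x) - a * (P'.2 - y) = τ' at *
  generalize (a : ℝ) * x + b * y - c = δ at *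
  generalize (a : ℝ) ^ 2 + (b : ℝ) ^ 2 = m at *
  have hinner : 0 ≤ inner ℝ u u' := by
    refine (mul_nonneg_iff_of_pos_left hm0).1 ?_
    rw [i1]
    nlinarith [mul_self_nonneg δ]
  have hangle : InnerProductGeometry.angle u u' ≤ π / 2 :=
    Real.arccos_le_pi_div_two.2 (by positivity)
  have hsin := InnerProductGeometry.sin_angle_mul_norm_mul_norm u u'
  have hθ0 : 0 ≤ InnerProductGeometry.angle u u' := InnerProductGeometry.angle_nonneg _ _
  generalize InnerProductGeometry.angle u u' = θ at *
  have hsq : Real.sin θ ^ 2 * ((τ * τ + δ * δ) * (τ' * τ' + δ * δ)) = (δ * (τ - τ')) ^ 2 := by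
    have h1 : (Real.sin θ * (‖u‖ * ‖u'‖)) ^ 2 =
        inner ℝ u u * inner ℝ u' u' - inner ℝ u u' * inner ℝ u u' := by
      rw [hsin, Real.sq_sqrt]
      have := real_inner_mul_inner_self_le u u'
      linarith
    rw [mul_pow, mul_pow, ← real_inner_self_eq_norm_sq, ← real_inner_self_eq_norm_sq] at h1
    have h2 : m ^ 2 * (inner ℝ u u * inner ℝ u' u' - inner ℝ u u' * inner ℝ u u') =
        (m * inner ℝ u u) * (m * inner ℝ u' u') - (m * inner ℝ u u') * (m * inner ℝ u u') := by ring
    rw [i1, i2, i3] at h2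
    rw [← i2, ← i3]
    linear_combination m ^ 2 * h1 + h2
  have hsinle := le_abs_div_of_sq_mul_eq hL h₁ h₂ h₁' h₂' hsq
  rw [abs_of_nonneg hθ0]
  have h4 := Real.mul_le_sin hθ0 hangle
  calc θ = π / 2 * (2 / π * θ) := by field_simp
    _ ≤ π / 2 * (|δ| / L) := by gcongr; exact h4.trans hsinle

/-- Lattice points on a segment of a primitive line. -/
theorem exists_finset_line_points {a b : ℤ} (hab : IsCoprime a b) (c : ℤ) (x y L : ℝ) :
    ∃ S : Finset (ℤ × ℤ), L / ((a : ℝ) ^ 2 + (b : ℝ) ^ 2) - 1 ≤ S.card ∧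
      ∀ P ∈ S, a * P.1 + b * P.2 = c ∧ L ≤ b * (P.1 - x) - a * (P.2 - y) ∧
        b * (P.1 - x) - a * (P.2 - y) ≤ 2 * L := by
  obtain ⟨u, v, huv⟩ := hab
  have hmZ : 0 < a ^ 2 + b ^ 2 := by
    by_contra! h
    have ha : a = 0 := by nlinarith
    have hb : b = 0 := by nlinarith
    simp [ha, hb] at huv
  set m : ℝ := (a : ℝ) ^ 2 + (b : ℝ) ^ 2 with hm
  have hm0 : 0 < m := by rw [hm]; exact_mod_cast hmZ
  set τ : ℝ := b * (c * u - x) - a * (c * v - y) with hτ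
  let f : ℤ → ℤ × ℤ := fun k => (c * u + k * b, c * v - k * a)
  have hf : Function.Injective f := by
    intro k l hkl
    have h1 : c * u + k * b = c * u + l * b := congrArg Prod.fst hkl
    have h2 : c * v - k * a = c * v - l * a := congrArg Prod.snd hkl
    have h3 : (k - l) * (a ^ 2 + b ^ 2) = 0 := by linear_combination b * h1 - a * h2
    exact sub_eq_zero.1 ((mul_eq_zero.1 h3).resolve_right hmZ.ne')
  refine ⟨(Finset.Icc ⌈(L - τ) / m⌉ ⌊(2 * L - τ) / m⌋).map ⟨f, hf⟩, ?_, ?_⟩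
  · rw [Finset.card_map, Int.card_Icc]
    have h1 := Int.ceil_lt_add_one ((L - τ) / m)
    have h2 := Int.lt_floor_add_one ((2 * L - τ) / m)
    have h3 : ((⌊(2 * L - τ) / m⌋ + 1 - ⌈(L - τ) / m⌉ : ℤ) : ℝ) ≤
        ((⌊(2 * L - τ) / m⌋ + 1 - ⌈(L - τ) / m⌉).toNat : ℝ) := by
      exact_mod_cast Int.self_le_toNat _
    push_cast at h3
    have h4 : L / m = (2 * L - τ) / m - (L - τ) / m := by ring
    linarith
  · intro P hP
    obtain ⟨k, hk, rfl⟩ := Finset.mem_map.1 hP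
    rw [Finset.mem_Icc, Int.ceil_le, Int.le_floor, div_le_iff₀ hm0, le_div_iff₀ hm0] at hk
    have hcoord : (b : ℝ) * (((c * u + k * b : ℤ) : ℝ) - x) - a * (((c * v - k * a : ℤ) : ℝ) - y) =
        τ + k * m := by
      rw [hτ, hm]; push_cast; ring
    refine ⟨?_, ?_, ?_⟩
    · change a * (c * u + k * b) + b * (c * v - k * a) = c
      linear_combination c * huv
    · change L ≤ (b : ℝ) * (((c * u + k * b : ℤ) : ℝ) - x) - a * (((c * v - k * a : ℤ) : ℝ) - y)
      rw [hcoord]; linarith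
    · change (b : ℝ) * (((c * u + k * b : ℤ) : ℝ) - x) - a * (((c * v - k * a : ℤ) : ℝ) - y) ≤ 2 * L
      rw [hcoord]; linarith

theorem card_sub_pow_le_ncard {α : Type*} {n : ℕ} (S : Finset α) {T : Set (Fin n → α)}
    (hT : T.Finite) (hST : ∀ P : Fin n → α, (∀ i, P i ∈ S) → Function.Injective P → P ∈ T) :
    (S.card + 1 - n) ^ n ≤ T.ncard := by
  have : Finite T := hT
  classical
  calc (S.card + 1 - n) ^ n ≤ S.card.descFactorial n := Nat.pow_sub_le_descFactorial _ _
    _ = Nat.card (Fin n ↪ S) := by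
      rw [Nat.card_eq_fintype_card, Fintype.card_embedding_eq, Fintype.card_coe, Fintype.card_fin]
    _ ≤ Nat.card T := by
      refine Nat.card_le_card_of_injective
        (fun e => ⟨fun i => (e i : α), hST _ (fun i => (e i).2)
          (Subtype.val_injective.comp e.injective)⟩) ?_
      intro e e' h
      ext i
      exact congrFun (congrArg Subtype.val h) i
    _ = T.ncard := rfl

theorem exists_lamPts_finite_ncard_le {Ω : Set (ℝ × ℝ)} (hΩ : Bornology.IsBounded Ω) :
    ∃ B : ℝ, 0 < B ∧ ∀ Q : ℕ, 0 < Q →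
      (LamPts Ω Q).Finite ∧ ((LamPts Ω Q).ncard : ℝ) ≤ B * (Q : ℝ) ^ 2 := by
  obtain ⟨R, hR⟩ := hΩ.exists_norm_le
  obtain ⟨n, hn⟩ := exists_nat_gt (max R 0)
  have hn0 : 0 < n := by exact_mod_cast (le_max_right R 0).trans_lt hn
  have hRn : R ≤ n := (le_max_left R 0).trans hn.le
  refine ⟨9 * (n : ℝ) ^ 2, by positivity, fun Q hQ => ?_⟩
  have hQ1 : 1 ≤ n * Q := Nat.mul_pos hn0 hQ
  set I := Finset.Icc (-((n * Q : ℕ) : ℤ)) ((n * Q : ℕ) : ℤ) with hI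
  have hsub : LamPts Ω Q ⊆ ↑(I ×ˢ I) := by
    rintro ⟨p, q⟩ ⟨w, hw, hwe⟩
    have hw' := hR w hw
    have h1 : |w.1| ≤ n := (norm_fst_le w).trans (hw'.trans hRn)
    have h2 : |w.2| ≤ n := (norm_snd_le w).trans (hw'.trans hRn)
    have e1 : (Q : ℝ) * w.1 = p := congrArg Prod.fst hwe
    have e2 : (Q : ℝ) * w.2 = q := congrArg Prod.snd hwe
    have key : ∀ (t : ℝ) (k : ℤ), |t| ≤ n → (Q : ℝ) * t = k → k ∈ I := by
      intro t k ht hk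
      have : |(k : ℝ)| ≤ ((n * Q : ℕ) : ℤ) := by
        rw [← hk, abs_mul, Nat.abs_cast]
        push_cast
        rw [mul_comm (n : ℝ)]
        gcongr
      rw [hI, Finset.mem_Icc, ← abs_le]
      exact_mod_cast this
    simpa only [Finset.coe_product, Set.mem_prod, Finset.mem_coe] using
      And.intro (key _ _ h1 e1) (key _ _ h2 e2)
  refine ⟨(Finset.finite_toSet _).subset hsub, ?_⟩
  have h1 := Set.ncard_le_ncard hsub (Finset.finite_toSet _)
  rw [Set.ncard_coe_finset, Finset.card_product, hI, Int.card_Icc] at h1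
  have h2 : (((n * Q : ℕ) : ℤ) + 1 - -((n * Q : ℕ) : ℤ)).toNat = 2 * (n * Q) + 1 := by lia
  rw [h2] at h1
  have h3 : (LamPts Ω Q).ncard ≤ 9 * n ^ 2 * Q ^ 2 := by nlinarith
  exact_mod_cast h3

theorem exists_mem_lamPts {Ω : Set (ℝ × ℝ)} (hΩo : IsOpen Ω) (hΩ0 : ((0 : ℝ), (0 : ℝ)) ∈ Ω) :
    ∃ ρ : ℝ, 0 < ρ ∧ ∀ Q : ℕ, 0 < Q → ∀ P : ℤ × ℤ,
      |(P.1 : ℝ)| < ρ * Q → |(P.2 : ℝ)| < ρ * Q → P ∈ LamPts Ω Q := by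
  obtain ⟨ρ, hρ, hball⟩ := Metric.isOpen_iff.1 hΩo _ hΩ0
  refine ⟨ρ, hρ, fun Q hQ P h1 h2 => ?_⟩
  have hQ' : (0 : ℝ) < Q := by exact_mod_cast hQ
  refine ⟨((P.1 : ℝ) / Q, (P.2 : ℝ) / Q), hball ?_, ?_⟩
  · rw [Metric.mem_ball, Prod.dist_eq, max_lt_iff]
    simp only [dist_zero_right, Real.norm_eq_abs, abs_div, Nat.abs_cast]
    exact ⟨(div_lt_iff₀ hQ').2 h1, (div_lt_iff₀ hQ').2 h2⟩
  · ext <;> simp <;> field_simp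

theorem abs_lt_of_sub_sq_le {t z r : ℝ} (hz : z ∈ Set.Ico (0 : ℝ) 1) (hr : 4 < r)
    (ht : (t - z) ^ 2 ≤ (r / 2) ^ 2 + 1) : |t| < r := by
  have h : |t - z| ≤ r / 2 + 1 := by
    refine abs_le_of_sq_le_sq (ht.trans ?_) (by linarith)
    rw [add_sq]
    linarith
  rw [abs_le] at h
  rw [abs_lt]
  constructor <;> linarith [hz.1, hz.2]

/-- A point close to `(x, y)` in the orthogonal coordinates attached to `(a, b)` and `(b, -a)` has
small coordinates. -/
theorem abs_lt_and_abs_lt_of_sq_le {a b x y s t r : ℝ} (hx : x ∈ Set.Ico (0 : ℝ) 1)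
    (hy : y ∈ Set.Ico (0 : ℝ) 1) (hr : 4 < r) (hm : 0 < a ^ 2 + b ^ 2)
    (hδ : (a * (s - x) + b * (t - y)) ^ 2 ≤ a ^ 2 + b ^ 2)
    (hτ : (b * (s - x) - a * (t - y)) ^ 2 ≤ (a ^ 2 + b ^ 2) * (r / 2) ^ 2) :
    |s| < r ∧ |t| < r := by
  have h : (s - x) ^ 2 + (t - y) ^ 2 ≤ (r / 2) ^ 2 + 1 := by
    refine le_of_mul_le_mul_left ?_ hm
    have e : (a ^ 2 + b ^ 2) * ((s - x) ^ 2 + (t - y) ^ 2) =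
        (a * (s - x) + b * (t - y)) ^ 2 + (b * (s - x) - a * (t - y)) ^ 2 := by ring
    rw [e, mul_add, mul_one]
    linarith
  exact ⟨abs_lt_of_sub_sq_le hx hr (by linarith [sq_nonneg (t - y)]),
    abs_lt_of_sub_sq_le hy hr (by linarith [sq_nonneg (s - x)])⟩

theorem pi_div_two_mul_div_le {ε B ρ l Q q δ N : ℝ} (hB : 0 < B) (hρ : 0 < ρ) (hQ : 0 < Q)
    (hq : 0 < q) (hN : 0 < N) (hl : 0 ≤ l) (hε : ε * B ≤ l * ρ) (hδ : δ * Q ≤ ε * q)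
    (hNB : N ≤ B * Q ^ 2) :
    π / 2 * (δ / (ρ * Q * q / 4)) ≤ 2 * π * l / N := by
  have h : δ / (ρ * Q * q / 4) ≤ 4 * ε / (ρ * Q ^ 2) := by
    rw [div_le_div_iff₀ (by positivity) (by positivity)]
    calc δ * (ρ * Q ^ 2) = (ρ * Q) * (δ * Q) := by ring
      _ ≤ (ρ * Q) * (ε * q) := mul_le_mul_of_nonneg_left hδ (by positivity)
      _ = 4 * ε * (ρ * Q * q / 4) := by ring
  have h' : ε / ρ ≤ l / B := by rwa [div_le_div_iff₀ hρ hB]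
  calc π / 2 * (δ / (ρ * Q * q / 4)) ≤ π / 2 * (4 * ε / (ρ * Q ^ 2)) := by gcongr
    _ = 2 * π * (ε / ρ) / Q ^ 2 := by field_simp; ring
    _ ≤ 2 * π * (l / B) / Q ^ 2 := by
      refine div_le_div_of_nonneg_right ?_ (by positivity)
      exact mul_le_mul_of_nonneg_left h' (by positivity)
    _ = 2 * π * l / (B * Q ^ 2) := by field_simp
    _ ≤ 2 * π * l / N := by gcongr

theorem mul_pow_le_of_div_sub_one_le {ρ K Q q : ℝ} {N : ℕ} (hρ : 0 < ρ) (hK : 0 < K)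
    (hQ : 0 < Q) (hq : 0 < q) (hm : (q ^ 2) ^ 8 ≤ K * Q ^ 9)
    (hN : ρ * Q * q / 4 / q ^ 2 - 1 ≤ N) :
    (ρ / 4) ^ 16 / K * Q ^ 7 ≤ (((N - 5 : ℕ) : ℝ) + 6) ^ 16 := by
  have h : ρ / 4 * (Q / q) ≤ ((N - 5 : ℕ) : ℝ) + 6 := by
    have e₁ : ρ / 4 * (Q / q) = ρ * Q * q / 4 / q ^ 2 := by field_simp
    have e₂ : (N : ℝ) ≤ ((N - 5 : ℕ) : ℝ) + 5 := by
      exact_mod_cast (by lia : N ≤ N - 5 + 5)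
    linarith
  refine le_trans ?_ (pow_le_pow_left₀ (by positivity) h 16)
  have e₃ : (ρ / 4 * (Q / q)) ^ 16 = (ρ / 4) ^ 16 * (Q ^ 16 / (q ^ 2) ^ 8) := by
    rw [mul_pow, div_pow Q, ← pow_mul]
  rw [e₃, div_mul_eq_mul_div, mul_div_assoc]
  refine mul_le_mul_of_nonneg_left ?_ (by positivity)
  rw [div_le_div_iff₀ hK (by positivity)]
  calc Q ^ 7 * (q ^ 2) ^ 8 ≤ Q ^ 7 * (K * Q ^ 9) := by gcongr
    _ = Q ^ 16 * K := by ring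

/-- A quantitative lower bound for the number of close `6`-tuples of lattice points. -/
theorem exists_le_R6om {Ω : Set (ℝ × ℝ)} (hΩb : Bornology.IsBounded Ω) (hΩo : IsOpen Ω)
    (hΩ0 : ((0 : ℝ), (0 : ℝ)) ∈ Ω) {x y : ℝ} (hx : x ∈ Set.Ico (0 : ℝ) 1)
    (hy : y ∈ Set.Ico (0 : ℝ) 1) {lam : Fin 5 → ℝ} (hlam : ∀ i, 0 < lam i) :
    ∃ κ B : ℝ, 0 < κ ∧ 0 < B ∧ ∀ᶠ Q : ℕ in Filter.atTop, ∃ n : ℕ,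
      κ * (Q : ℝ) ^ 7 ≤ ((n : ℝ) + 6) ^ 16 ∧ (n : ℝ) ^ 6 / (B * (Q : ℝ) ^ 2) ≤ R6om Ω x y Q lam := by
  obtain ⟨B, hB, hcard⟩ := exists_lamPts_finite_ncard_le hΩb
  obtain ⟨ρ, hρ, hmem⟩ := exists_mem_lamPts hΩo hΩ0
  obtain ⟨i₀, hi₀⟩ := Finite.exists_min lam
  set ε := min 1 (lam i₀ * ρ / B) with hε
  have hε0 : 0 < ε := lt_min one_pos (div_pos (mul_pos (hlam i₀) hρ) hB)
  obtain ⟨K, hK, hform⟩ := exists_coprime_linear_form_le x y hε0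
  refine ⟨(ρ / 4) ^ 16 / K, B, by positivity, hB, ?_⟩
  obtain ⟨Q₀, hQ₀⟩ := exists_nat_gt (4 / ρ)
  filter_upwards [Filter.eventually_ge_atTop (max Q₀ 1)] with Q hQ
  have hQ1 : 1 ≤ Q := (le_max_right _ _).trans hQ
  have hQ1R : (1 : ℝ) ≤ Q := by exact_mod_cast hQ1
  have hρQ : 4 < ρ * Q := by
    have : (Q₀ : ℝ) ≤ Q := by exact_mod_cast (le_max_left _ _).trans hQ
    have := hQ₀.trans_le this
    rwa [div_lt_iff₀' hρ] at this
  obtain ⟨a, b, c, hab, hl, hm8⟩ := hform Q hQ1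
  have hmZ : 1 ≤ a ^ 2 + b ^ 2 := by
    obtain ⟨u, v, huv⟩ := hab
    by_contra! h
    have ha : a = 0 := by nlinarith
    have hb : b = 0 := by nlinarith
    simp [ha, hb] at huv
  have hm0 : 0 < (a : ℝ) ^ 2 + (b : ℝ) ^ 2 := by exact_mod_cast hmZ
  obtain ⟨q, hq0, hqm, hqs⟩ : ∃ q : ℝ, 0 < q ∧ q ^ 2 = (a : ℝ) ^ 2 + (b : ℝ) ^ 2 ∧
      √((a : ℝ) ^ 2 + (b : ℝ) ^ 2) = q :=
    ⟨_, Real.sqrt_pos.2 hm0, Real.sq_sqrt hm0.le, rfl⟩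
  rw [hqs] at hl
  have hL0 : 0 < ρ * Q * q / 4 := by positivity
  obtain ⟨S, hS, hSP⟩ := exists_finset_line_points hab c x y (ρ * Q * q / 4)
  obtain ⟨hfin, hN⟩ := hcard Q hQ1
  have hNpos : 0 < (LamPts Ω Q).ncard := by
    rw [Set.ncard_pos hfin]
    exact ⟨(0, 0), hmem Q hQ1 _ (by simp; linarith) (by simp; linarith)⟩
  have hNpos' : (0 : ℝ) < ((LamPts Ω Q).ncard : ℝ) := by exact_mod_cast hNpos
  have hδq : |a * x + b * y - c| ≤ q :=
    calc |a * x + b * y - c| ≤ |a * x + b * y - c| * Q := le_mul_of_one_le_right (abs_nonneg _) hQ1R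
      _ ≤ ε * q := hl
      _ ≤ 1 * q := by gcongr; exact min_le_left _ _
      _ = q := one_mul q
  have hSmem : ∀ P ∈ S, P ∈ LamPts Ω Q := by
    intro P hP
    obtain ⟨h1, h2, h3⟩ := hSP P hP
    have h1R : (a : ℝ) * P.1 + b * P.2 = c := by exact_mod_cast h1
    have hd : a * ((P.1 : ℝ) - x) + b * (P.2 - y) = -(a * x + b * y - c) := by linarith
    obtain ⟨g1, g2⟩ := abs_lt_and_abs_lt_of_sq_le (s := P.1) (t := P.2) hx hy hρQ hm0
      (by
        rw [hd, neg_sq, ← sq_abs, ← hqm]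
        exact pow_le_pow_left₀ (abs_nonneg _) hδq 2)
      (by
        refine (pow_le_pow_left₀ (hL0.le.trans h2) h3 2).trans_eq ?_
        rw [← hqm]
        ring)
    exact hmem Q hQ1 P g1 g2
  have hangle : ∀ P ∈ S, ∀ P' ∈ S, ∀ i, |angleAt x y P P'| ≤
      2 * π * lam i / ((LamPts Ω Q).ncard : ℝ) := by
    intro P hP P' hP' i
    obtain ⟨h1, h2, h3⟩ := hSP P hP
    obtain ⟨h1', h2', h3'⟩ := hSP P' hP'
    refine (angleAt_le hL0 h1 h1' h2 h3 h2' h3').trans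
      (pi_div_two_mul_div_le hB hρ (by linarith) hq0 hNpos' (hlam i).le ?_ hl hN)
    have : ε ≤ lam i₀ * ρ / B := min_le_right _ _
    rw [le_div_iff₀ hB] at this
    exact this.trans (mul_le_mul_of_nonneg_right (hi₀ i) hρ.le)
  rw [← hqm] at hS hm8
  refine ⟨S.card - 5, mul_pow_le_of_div_sub_one_le hρ hK (by linarith) hq0 hm8 hS, ?_⟩
  rw [R6om]
  have h1 := card_sub_pow_le_ncard (n := 6) S
    (T := {P : Fin 6 → ℤ × ℤ | (∀ i, P i ∈ LamPts Ω Q) ∧ Function.Injective P ∧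
      ∀ i : Fin 5, |angleAt x y (P i.castSucc) (P i.succ)| ≤
        2 * π * lam i / ((LamPts Ω Q).ncard : ℝ)})
    ((Set.Finite.pi fun _ => hfin).subset fun P hP i _ => hP.1 i)
    (fun P hP hinj => ⟨fun i => hSmem _ (hP i), hinj, fun i => hangle _ (hP _) _ (hP _) i⟩)
  gcongr
  exact_mod_cast h1

/-- For a bounded open convex domain `Ω ⊆ ℝ²` containing the origin, the 6-level
correlations of angles of directions `P_{(x,y)}P`, `P ∈ ℤ² ∩ QΩ`, diverge as `Q → ∞`. -/
theorem six_level_correlation_diverges_convex (Ω : Set (ℝ × ℝ))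
    (hΩb : Bornology.IsBounded Ω) (hΩo : IsOpen Ω) (hΩc : Convex ℝ Ω)
    (hΩ0 : ((0 : ℝ), (0 : ℝ)) ∈ Ω)
    (x y : ℝ) (hx : x ∈ Set.Ico (0 : ℝ) 1) (hy : y ∈ Set.Ico (0 : ℝ) 1)
    (lam : Fin 5 → ℝ) (hlam : ∀ i, 0 < lam i) :
    Filter.Tendsto (fun Q : ℕ => R6om Ω x y Q lam) Filter.atTop Filter.atTop := by
  obtain ⟨κ, B, hκ, hB, h⟩ := exists_le_R6om hΩb hΩo hΩ0 hx hy hlam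
  rw [Filter.tendsto_atTop]
  intro A
  have hcast : Filter.Tendsto (fun Q : ℕ => (Q : ℝ)) Filter.atTop Filter.atTop :=
    tendsto_natCast_atTop_atTop
  have h7 : ∀ᶠ Q : ℕ in Filter.atTop, 13 ^ 16 / κ ≤ (Q : ℝ) := hcast.eventually_ge_atTop _
  have hA : ∀ᶠ Q : ℕ in Filter.atTop, (max A 1 * B) ^ 8 * 2 ^ 48 / κ ^ 3 ≤ (Q : ℝ) :=
    hcast.eventually_ge_atTop _
  filter_upwards [h, h7, hA, Filter.eventually_ge_atTop 1] with Q hQ hQ7 hQA hQ1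
  obtain ⟨n, hn, hR⟩ := hQ
  refine le_trans ?_ hR
  have hQ1R : (1 : ℝ) ≤ Q := by exact_mod_cast hQ1
  rw [div_le_iff₀ hκ] at hQ7
  rw [div_le_iff₀ (by positivity)] at hQA
  have hn6 : (6 : ℝ) ≤ n := by
    have h1 : (13 : ℝ) ^ 16 ≤ ((n : ℝ) + 6) ^ 16 := by
      refine le_trans (hQ7.trans ?_) hn
      rw [mul_comm]
      gcongr
      exact le_self_pow₀ hQ1R (by norm_num)
    have := le_of_pow_le_pow_left₀ (by norm_num) (by positivity) h1
    linarith
  have hn2 : κ * (Q : ℝ) ^ 7 ≤ (2 * (n : ℝ)) ^ 16 :=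
    hn.trans (pow_le_pow_left₀ (by positivity) (by linarith) 16)
  rw [le_div_iff₀ (by positivity)]
  have key : max A 1 * B * (Q : ℝ) ^ 2 ≤ (n : ℝ) ^ 6 := by
    refine le_of_pow_le_pow_left₀ (n := 8) (by norm_num) (by positivity) ?_
    have h48 : (κ * (Q : ℝ) ^ 7) ^ 3 ≤ ((2 * (n : ℝ)) ^ 16) ^ 3 :=
      pow_le_pow_left₀ (by positivity) hn2 3
    refine le_of_mul_le_mul_right (a := (2 : ℝ) ^ 48) ?_ (by positivity)
    calc (max A 1 * B * (Q : ℝ) ^ 2) ^ 8 * 2 ^ 48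
        = ((max A 1 * B) ^ 8 * 2 ^ 48) * (Q : ℝ) ^ 16 := by ring
      _ ≤ (Q * κ ^ 3) * (Q : ℝ) ^ 16 := by gcongr
      _ = κ ^ 3 * (Q : ℝ) ^ 17 := by ring
      _ ≤ κ ^ 3 * (Q : ℝ) ^ 21 := by
        gcongr
        norm_num
      _ = (κ * (Q : ℝ) ^ 7) ^ 3 := by ring
      _ ≤ ((2 * (n : ℝ)) ^ 16) ^ 3 := h48
      _ = ((n : ℝ) ^ 6) ^ 8 * 2 ^ 48 := by ring
  calc A * (B * (Q : ℝ) ^ 2) ≤ max A 1 * (B * (Q : ℝ) ^ 2) := by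
        gcongr
        exact le_max_left _ _
    _ = max A 1 * B * (Q : ℝ) ^ 2 := by ring
    _ ≤ (n : ℝ) ^ 6 := key
end
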